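/- Let 1 ≤ m ≤ n be natural numbers and let μ be the Lebesgue measure restricted to the unit cube [0,1]^n ⊂ ℝ^n. Then for any continuous map f : [0,1]^n → ℝ^m there exists t ∈ ℝ^m such that μ(f^{-1}(t) +_∞ r) ≥ (r/2)^m for all 0 < r < 1/2, where for A ⊂ ℝ^n and r > 0, A +_∞ r = {x ∈ ℝ^n : ∃ a ∈ A, ‖x − a‖_∞ ≤ r} is the closed r-neighborhood of A with respect to the ℓ^∞-norm. -/

import Mathlib

open Filter Topology
open scoped ENNReal NNReal

noncomputable section

/-- Diameter (in `ℝ≥0∞`) of a set with respect to a distance function `ρ`. -/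
def setEDiam {X : Type*} (ρ : X → X → ℝ) (E : Set X) : ℝ≥0∞ :=
  ⨆ x ∈ E, ⨆ y ∈ E, ENNReal.ofReal (ρ x y)

/-- Openness with respect to a distance function `ρ`. -/
def ROpen {X : Type*} (ρ : X → X → ℝ) (U : Set X) : Prop :=
  ∀ x ∈ U, ∃ δ > 0, ∀ y, ρ x y < δ → y ∈ U

/-- `#(E, ρ, ε)`: the minimal number `n` of `ρ`-open sets of `ρ`-diameter `< ε` covering `E`
(`0` when `E = ∅`, since the empty family covers it). -/
def covNum {X : Type*} (ρ : X → X → ℝ) (ε : ℝ) (E : Set X) : ℕ :=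
  sInf {n : ℕ | ∃ U : Fin n → Set X, (∀ i, ROpen ρ (U i)) ∧
    (∀ i, setEDiam ρ (U i) < ENNReal.ofReal ε) ∧ E ⊆ ⋃ i, U i}

/-- The dynamical metric `d_N(x,y) = max_{0 ≤ n < N} d(Tⁿx, Tⁿy)`. -/
def dynDist {X : Type*} (T : X → X) (d : X → X → ℝ) (N : ℕ) (x y : X) : ℝ :=
  sSup {r : ℝ | ∃ n, n < N ∧ r = d (T^[n] x) (T^[n] y)}

/-- `sup_{y ∈ Y} log #(π⁻¹(y), ρ, ε)`. -/
def supLogCov {X Y : Type*} (π : X → Y) (ρ : X → X → ℝ) (ε : ℝ) : ℝ :=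
  ⨆ y : Y, Real.log (covNum ρ ε (π ⁻¹' {y}) : ℝ)

/-- `sup_{y ∈ Y} log #(π⁻¹(B_δ(y, ρY)), ρX, ε)` where `B_δ` is the closed `δ`-ball. -/
def supLogCovBall {X Y : Type*} (π : X → Y) (ρX : X → X → ℝ) (ρY : Y → Y → ℝ)
    (ε δ : ℝ) : ℝ :=
  ⨆ y : Y, Real.log (covNum ρX ε (π ⁻¹' {x | ρY x y ≤ δ}) : ℝ)

/-- Topological conditional entropy
`h_top(π, T) = lim_{ε→0} lim_{N→∞} (sup_y log #(π⁻¹(y), d_N, ε))/N`, as an extended real. -/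
def condEntropy {X Y : Type*} (π : X → Y) (T : X → X) (d : X → X → ℝ) : EReal :=
  Filter.limsup (fun ε : ℝ => Filter.liminf
      (fun N : ℕ => ((supLogCov π (dynDist T d N) ε / N : ℝ) : EReal)) Filter.atTop)
    (𝓝[>] (0 : ℝ))

/-- `lim_{N→∞} (sup_y log #(π⁻¹(y), d_N, ε))/(N log(1/ε))` (the limit exists by
subadditivity; it is realized here as a liminf). -/
def condMdimRate {X Y : Type*} (π : X → Y) (T : X → X) (d : X → X → ℝ) (ε : ℝ) : EReal :=
  Filter.liminf (fun N : ℕ =>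
    ((supLogCov π (dynDist T d N) ε / (N * Real.log (1 / ε)) : ℝ) : EReal)) Filter.atTop

/-- Lower conditional metric mean dimension of `π : (X,T,d) → Y`. -/
def lowerCondMdimM {X Y : Type*} (π : X → Y) (T : X → X) (d : X → X → ℝ) : EReal :=
  Filter.liminf (fun ε : ℝ => condMdimRate π T d ε) (𝓝[>] (0 : ℝ))

/-- Upper conditional metric mean dimension of `π : (X,T,d) → Y`. -/
def upperCondMdimM {X Y : Type*} (π : X → Y) (T : X → X) (d : X → X → ℝ) : EReal :=
  Filter.limsup (fun ε : ℝ => condMdimRate π T d ε) (𝓝[>] (0 : ℝ))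

/-- `lim_{N→∞} log #(X, d_N, ε)/(N log(1/ε))`. -/
def mdimMRate {X : Type*} (T : X → X) (d : X → X → ℝ) (ε : ℝ) : EReal :=
  Filter.liminf (fun N : ℕ =>
    ((Real.log (covNum (dynDist T d N) ε (Set.univ : Set X) : ℝ) /
      (N * Real.log (1 / ε)) : ℝ) : EReal)) Filter.atTop

/-- Lower metric mean dimension of `(X, T, d)`. -/
def lowerMdimM {X : Type*} (T : X → X) (d : X → X → ℝ) : EReal :=
  Filter.liminf (fun ε : ℝ => mdimMRate T d ε) (𝓝[>] (0 : ℝ))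

/-- Upper metric mean dimension of `(X, T, d)`. -/
def upperMdimM {X : Type*} (T : X → X) (d : X → X → ℝ) : EReal :=
  Filter.limsup (fun ε : ℝ => mdimMRate T d ε) (𝓝[>] (0 : ℝ))

/-- `widim_ε(X, ρ)`: the minimal `k` such that there are a finite simplicial complex of
dimension `≤ k` (realized in some `ℝ^m`) and a continuous `ε`-embedding `f : X → P`
(all fibers of `f` have `ρ`-diameter `< ε`). -/
def widim (X : Type*) [TopologicalSpace X] (ρ : X → X → ℝ) (ε : ℝ) : ℕ :=
  sInf {k : ℕ | ∃ (m : ℕ) (K : Geometry.SimplicialComplex ℝ (Fin m → ℝ)),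
    K.faces.Finite ∧ (∀ s ∈ K.faces, s.card ≤ k + 1) ∧
    ∃ f : X → K.space, Continuous f ∧
      ∀ p : K.space, setEDiam ρ (f ⁻¹' {p}) < ENNReal.ofReal ε}

/-- Mean dimension `mdim(X, T) = lim_{ε→0} lim_{N→∞} widim_ε(X, d_N)/N`. -/
def mdim (X : Type*) [TopologicalSpace X] (T : X → X) (d : X → X → ℝ) : EReal :=
  Filter.limsup (fun ε : ℝ => Filter.liminf
      (fun N : ℕ => (((widim X (dynDist T d N) ε : ℝ) / N : ℝ) : EReal)) Filter.atTop)
    (𝓝[>] (0 : ℝ))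

/-- The cube `[0,1]^a`. -/
abbrev Cube (a : ℕ) := Fin a → unitInterval

/-- The full shift space `([0,1]^a)^ℤ`. -/
abbrev FullShift (a : ℕ) := ℤ → Cube a

/-- The shift map `σ((x_n)_n) = (x_{n+1})_n`. -/
def shift {α : Type*} (x : ℤ → α) : ℤ → α := fun n => x (n + 1)

/-- The `ℓ^∞`-distance on the cube `[0,1]^a`. -/
def cubeDist {a : ℕ} (x y : Cube a) : ℝ :=
  ‖(fun i => (x i : ℝ)) - fun i => (y i : ℝ)‖

/-- The metric `D((x_n), (y_n)) = Σ_{n∈ℤ} 2^{-|n|} ‖x_n − y_n‖_∞` on the full shift. -/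
def shiftDist {a : ℕ} (x y : FullShift a) : ℝ :=
  ∑' n : ℤ, (2 : ℝ) ^ (-|n|) * cubeDist (x n) (y n)

end

section BorsukUlam

open Finset

/-- `0` lies in the convex hull of the points `a i`, `i ∈ ι`. -/
def ZeroInHull {ι W : Type*} [Fintype ι] [AddCommGroup W] [Module ℝ W] (a : ι → W) : Prop :=
  ∃ c : ι → ℝ, (∀ i, 0 ≤ c i) ∧ ∑ i, c i = 1 ∧ ∑ i, c i • a i = 0

/-- `0` lies in the convex hull of the points `a k`, `k ≠ i`. -/
def ZeroInHullOmit {ι W : Type*} [Fintype ι] [AddCommGroup W] [Module ℝ W] (a : ι → W) (i : ι) :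
    Prop :=
  ∃ c : ι → ℝ, (∀ i, 0 ≤ c i) ∧ ∑ i, c i = 1 ∧ ∑ i, c i • a i = 0 ∧ c i = 0

/-- A linear relation with two vanishing coefficients is trivial. -/
def RelGeneric {ι W : Type*} [Fintype ι] [AddCommGroup W] [Module ℝ W] (a : ι → W) : Prop :=
  ∀ c : ι → ℝ, (∃ i j, i ≠ j ∧ c i = 0 ∧ c j = 0) → ∑ i, c i • a i = 0 → c = 0

lemma RelGeneric.exists_partner {ι W : Type*} [Fintype ι] [AddCommGroup W]
    [Module ℝ W] [FiniteDimensional ℝ W] {a : ι → W} (ha : RelGeneric a)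
    (hcard : Fintype.card ι = Module.finrank ℝ W + 2) {i : ι} (hi : ZeroInHullOmit a i) :
    ∃ j, j ≠ i ∧ ∀ l, ZeroInHullOmit a l ↔ l = i ∨ l = j := by
  classical
  obtain ⟨c, hc0, hc1, hca, hci⟩ := hi
  have hpos : ∀ k, k ≠ i → 0 < c k := by
    intro k hk
    refine lt_of_le_of_ne (hc0 k) fun h => ?_
    have := ha c ⟨k, i, hk, h.symm, hci⟩ hca
    simp [this] at hc1
  have : Nontrivial ι := by
    apply Fintype.one_lt_card_iff_nontrivial.1; omega
  obtain ⟨j₀, hj₀⟩ := exists_ne i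
  -- a relation with coefficient one at `i`
  obtain ⟨b, hba, hbi⟩ : ∃ b : ι → ℝ, ∑ k, b k • a k = 0 ∧ b i = 1 := by
    let T : (ι → ℝ) →ₗ[ℝ] W × ℝ :=
      (Fintype.linearCombination ℝ a).prod (LinearMap.proj j₀)
    obtain ⟨b, hb, hb0⟩ := T.ker.exists_mem_ne_zero_of_ne_bot
      (LinearMap.ker_ne_bot_of_finrank_lt (by simp [hcard]))
    have hb1 : ∑ k, b k • a k = 0 := by
      have := congrArg Prod.fst (LinearMap.mem_ker.1 hb)
      simpa [T, Fintype.linearCombination_apply] using this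
    have hb2 : b j₀ = 0 := by
      have := congrArg Prod.snd (LinearMap.mem_ker.1 hb)
      simpa [T] using this
    have hbi : b i ≠ 0 := fun h => hb0 (ha b ⟨i, j₀, hj₀.symm, h, hb2⟩ hb1)
    refine ⟨fun k => (b i)⁻¹ * b k, ?_, by field_simp⟩
    simp only [mul_smul, ← Finset.smul_sum, hb1, smul_zero]
  obtain ⟨j, hj, hmax⟩ := Finset.exists_max_image (univ.erase i) (fun k => - b k / c k)
    ⟨j₀, by simp [hj₀]⟩
  have hji : j ≠ i := by simpa using hj
  set s := - b j / c j with hs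
  set v : ι → ℝ := fun k => b k + s * c k with hv
  have hva : ∑ k, v k • a k = 0 := by
    simp only [hv, add_smul, mul_smul, sum_add_distrib, ← Finset.smul_sum, hba, hca]; simp
  have hvi : v i = 1 := by simp [hv, hbi, hci]
  have hvj : v j = 0 := by
    have := (hpos j hji).ne'
    simp only [hv, hs]; field_simp; ring
  have hv0 : ∀ k, 0 ≤ v k := by
    intro k
    by_cases hk : k = i
    · rw [hk, hvi]; norm_num
    · have h1 := hmax k (by simp [hk])
      have h2 := hpos k hk
      rw [div_le_iff₀ h2] at h1
      simp only [hv]; linarith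
  have hvs : 0 < ∑ k, v k := sum_pos' (fun k _ => hv0 k) ⟨i, mem_univ _, by rw [hvi]; norm_num⟩
  refine ⟨j, hji, fun l => ⟨?_, ?_⟩⟩
  · rintro ⟨w, hw0, hw1, hwa, hwl⟩
    by_contra! hl
    obtain ⟨hli, hlj⟩ := hl
    have hwpos : ∀ k, k ≠ l → 0 < w k := by
      intro k hk
      refine lt_of_le_of_ne (hw0 k) fun h => ?_
      have := ha w ⟨k, l, hk, h.symm, hwl⟩ hwa
      simp [this] at hw1
    have hwi := hwpos i (Ne.symm hli)
    have hwj := hwpos j (Ne.symm hlj)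
    -- the combination `w - w i • v` vanishes at `i`, hence is a multiple of `c`
    let u : ι → ℝ := fun k => w k - w i * v k - (w j / c j) * c k
    have hu : u = 0 := by
      refine ha u ⟨i, j, hji.symm, by simp [u, hvi, hci], ?_⟩ ?_
      · have := (hpos j hji).ne'
        simp only [u, hvj]; field_simp; ring
      · simp only [u, sub_smul, mul_smul, sum_sub_distrib, ← Finset.smul_sum, hwa, hva, hca]; simp
    have h1 := congrFun hu l
    simp only [u, hwl, Pi.zero_apply] at h1
    have h2 : 0 < w j / c j * c l := mul_pos (div_pos hwj (hpos j hji)) (hpos l hli)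
    have h3 := mul_nonneg hwi.le (hv0 l)
    linarith
  · rintro (rfl | rfl)
    · exact ⟨c, hc0, hc1, hca, hci⟩
    · refine ⟨fun k => (∑ k, v k)⁻¹ * v k, fun k => mul_nonneg (inv_nonneg.2 hvs.le) (hv0 k),
        ?_, ?_, by simp [hvj]⟩
      · rw [← mul_sum]; exact inv_mul_cancel₀ hvs.ne'
      · simp only [mul_smul, ← Finset.smul_sum, hva, smul_zero]

open Classical in
/-- In general position, the number of facets containing `0` in their hull is even. -/
lemma RelGeneric.sum_omit_eq_zero {ι W : Type*} [Fintype ι] [AddCommGroup W]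
    [Module ℝ W] [FiniteDimensional ℝ W] {a : ι → W} (ha : RelGeneric a)
    (hcard : Fintype.card ι = Module.finrank ℝ W + 2) :
    ∑ i, (if ZeroInHullOmit a i then (1 : ZMod 2) else 0) = 0 := by
  by_cases h : ∃ i, ZeroInHullOmit a i
  · obtain ⟨i, hi⟩ := h
    obtain ⟨j, hji, hj⟩ := ha.exists_partner hcard hi
    simp only [hj]
    rw [← sum_filter, show univ.filter (fun l => l = i ∨ l = j) = {i, j} by ext; simp,
      sum_pair hji.symm]
    decide
  · push Not at h
    simp [h]

lemma ZeroInHullOmit.of_linearEquiv {ι W : Type*} [Fintype ι] [AddCommGroup W] [Module ℝ W]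
    {a b : ι → W} {i : ι} (g : W ≃ₗ[ℝ] W) (h : ∀ k, k ≠ i → b k = g (a k))
    (ha : ZeroInHullOmit a i) : ZeroInHullOmit b i := by
  obtain ⟨c, h0, h1, h2, h3⟩ := ha
  refine ⟨c, h0, h1, ?_, h3⟩
  have : ∀ k, c k • b k = g (c k • a k) := by
    intro k
    by_cases hk : k = i
    · simp [hk, h3]
    · simp [h k hk]
  simp only [this, ← map_sum, h2, map_zero]

lemma zeroInHull_iff_omit_none {ι W : Type*} [Fintype ι] [AddCommGroup W] [Module ℝ W]
    (a : Option ι → W) : ZeroInHull (fun i => a (some i)) ↔ ZeroInHullOmit a none := by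
  constructor
  · rintro ⟨c, h0, h1, h2⟩
    refine ⟨fun o => o.elim 0 c, ?_, ?_, ?_, rfl⟩
    · rintro (_ | i); exacts [le_rfl, h0 i]
    · simpa [Fintype.sum_option] using h1
    · simpa [Fintype.sum_option] using h2
  · rintro ⟨c, h0, h1, h2, h3⟩
    rw [Fintype.sum_option, h3] at h1 h2
    exact ⟨fun i => c (some i), fun i => h0 _, by simpa using h1, by simpa using h2⟩

lemma zeroInHull_update_iff_omit {ι W : Type*} [Fintype ι] [DecidableEq ι] [AddCommGroup W]
    [Module ℝ W] (a : Option ι → W) (j : ι) :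
    ZeroInHull (Function.update (fun i => a (some i)) j (a none)) ↔
      ZeroInHullOmit a (some j) := by
  constructor
  · rintro ⟨c, h0, h1, h2⟩
    refine ⟨fun o => o.elim (c j) (Function.update c j 0), ?_, ?_, ?_, by simp⟩
    · rintro (_ | i)
      · exact h0 j
      · by_cases hi : i = j
        · simp [hi]
        · simp [hi, h0]
    · rw [Fintype.sum_option, ← h1, ← Finset.add_sum_erase _ _ (mem_univ j),
        ← Finset.add_sum_erase _ c (mem_univ j)]
      simp only [Option.elim_none, Option.elim_some, Function.update_self, zero_add]
      congr 1
      exact sum_congr rfl fun x hx => by rw [Function.update_of_ne (ne_of_mem_erase hx)]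
    · rw [Fintype.sum_option, ← h2, ← Finset.add_sum_erase _ _ (mem_univ j),
        ← Finset.add_sum_erase _ (fun i => c i • _) (mem_univ j)]
      simp only [Option.elim_none, Option.elim_some, Function.update_self, zero_smul, zero_add]
      congr 1
      exact sum_congr rfl fun x hx => by
        rw [Function.update_of_ne (ne_of_mem_erase hx), Function.update_of_ne (ne_of_mem_erase hx)]
  · rintro ⟨c, h0, h1, h2, h3⟩
    rw [Fintype.sum_option, ← Finset.add_sum_erase _ _ (mem_univ j), h3] at h1 h2
    refine ⟨Function.update (fun i => c (some i)) j (c none), ?_, ?_, ?_⟩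
    · intro i
      by_cases hi : i = j
      · simp [hi, h0]
      · simp [hi, h0]
    · rw [← Finset.add_sum_erase _ _ (mem_univ j), Function.update_self, ← h1, zero_add]
      congr 1
      exact sum_congr rfl fun x hx => by rw [Function.update_of_ne (ne_of_mem_erase hx)]
    · rw [← Finset.add_sum_erase _ _ (mem_univ j), Function.update_self, Function.update_self, ← h2,
        zero_smul, zero_add]
      congr 1
      exact sum_congr rfl fun x hx => by
        rw [Function.update_of_ne (ne_of_mem_erase hx), Function.update_of_ne (ne_of_mem_erase hx)]

open Classical in
/-- Changing the vertex map at one colour does not change the parity of the number of cells whose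
image contains the origin. -/
lemma sum_zeroInHull_update_eq {Φ ι W : Type*} [Fintype Φ] [Fintype ι] [DecidableEq ι]
    [AddCommGroup W] [Module ℝ W] [FiniteDimensional ℝ W]
    (hcard : Fintype.card ι = Module.finrank ℝ W + 1) (V : Φ → ι → W) (j : ι) (X : Φ → W)
    (hσ : ∀ i, i ≠ j → ∃ σ : Φ → Φ, Function.Involutive σ ∧ (∀ φ, σ φ ≠ φ) ∧
      ∀ φ, ∃ g : W ≃ₗ[ℝ] W, (∀ k, k ≠ i → V (σ φ) k = g (V φ k)) ∧ X (σ φ) = g (X φ))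
    (hgen : ∀ φ, RelGeneric (fun o : Option ι => o.elim (X φ) (V φ))) :
    ∑ φ, (if ZeroInHull (V φ) then (1 : ZMod 2) else 0) =
      ∑ φ, (if ZeroInHull (Function.update (V φ) j (X φ)) then (1 : ZMod 2) else 0) := by
  have h1 : ∀ φ, ∑ o, (if ZeroInHullOmit (fun o : Option ι => o.elim (X φ) (V φ)) o then
      (1 : ZMod 2) else 0) = 0 := fun φ => (hgen φ).sum_omit_eq_zero (by simp [hcard])
  have h2 : ∑ o : Option ι, ∑ φ, (if ZeroInHullOmit (fun o : Option ι => o.elim (X φ) (V φ)) o then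
      (1 : ZMod 2) else 0) = 0 := by
    rw [sum_comm]; exact sum_eq_zero fun φ _ => h1 φ
  rw [Fintype.sum_option, ← Finset.add_sum_erase _ _ (mem_univ j), sum_eq_zero (s := erase _ _),
    add_zero] at h2
  · simp only [← zeroInHull_iff_omit_none, ← zeroInHull_update_iff_omit] at h2
    exact CharTwo.add_eq_zero.1 h2
  · intro i hi
    obtain ⟨σ, hσ1, hσ2, hσ3⟩ := hσ i (ne_of_mem_erase hi)
    have key : ∀ φ, ZeroInHullOmit (fun o : Option ι => o.elim (X φ) (V φ)) (some i) →
        ZeroInHullOmit (fun o : Option ι => o.elim (X (σ φ)) (V (σ φ))) (some i) := by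
      intro φ h
      obtain ⟨g, hg, hX⟩ := hσ3 φ
      refine h.of_linearEquiv g ?_
      rintro (_ | k) hk
      · exact hX
      · exact hg k (by simpa using hk)
    refine Finset.sum_involution (fun φ _ => σ φ) ?_ (fun φ _ _ => hσ2 φ) (fun _ _ => mem_univ _)
      (fun φ _ => hσ1 φ)
    intro φ _
    have hiff : ZeroInHullOmit (fun o : Option ι => o.elim (X (σ φ)) (V (σ φ))) (some i) ↔
        ZeroInHullOmit (fun o : Option ι => o.elim (X φ) (V φ)) (some i) :=
      ⟨fun h => by simpa [hσ1 φ] using key _ h, key φ⟩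
    simp only [hiff]
    exact CharTwo.add_self_eq_zero _

/-- An action of `G` on an index set by signed permutations (acting contravariantly on indices). -/
structure SignedAction (G V : Type*) [Group G] where
  /-- the underlying map of indices -/
  perm : G → V → V
  /-- the signs -/
  sign : G → V → ℤˣ
  perm_one : ∀ v, perm 1 v = v
  sign_one : ∀ v, sign 1 v = 1
  perm_mul : ∀ g h v, perm (g * h) v = perm h (perm g v)
  sign_mul : ∀ g h v, sign (g * h) v = sign g v * sign h (perm g v)

namespace SignedAction

variable {G V M : Type*} [Group G] (S : SignedAction G V)

/-- The induced action on families indexed by `V`. -/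
def act [SMul ℤˣ M] (g : G) (x : V → M) : V → M := fun v => S.sign g v • x (S.perm g v)

lemma act_apply [SMul ℤˣ M] (g : G) (x : V → M) (v : V) :
    S.act g x v = S.sign g v • x (S.perm g v) := rfl

lemma act_one [MulAction ℤˣ M] (x : V → M) : S.act 1 x = x := by
  ext v; simp [act, S.perm_one, S.sign_one]

lemma act_act [MulAction ℤˣ M] (g h : G) (x : V → M) :
    S.act g (S.act h x) = S.act (g * h) x := by
  ext v; simp [act, S.perm_mul, S.sign_mul, mul_smul]

lemma act_inv_act [MulAction ℤˣ M] (g : G) (x : V → M) : S.act g⁻¹ (S.act g x) = x := by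
  rw [act_act, inv_mul_cancel, act_one]

lemma act_act_inv [MulAction ℤˣ M] (g : G) (x : V → M) : S.act g (S.act g⁻¹ x) = x := by
  rw [act_act, mul_inv_cancel, act_one]

lemma act_injective [MulAction ℤˣ M] (g : G) : Function.Injective (S.act g : (V → M) → V → M) :=
  fun x y h => by rw [← S.act_inv_act g x, h, act_inv_act]

lemma perm_perm_inv (g : G) (v : V) : S.perm g (S.perm g⁻¹ v) = v := by
  rw [← S.perm_mul, inv_mul_cancel, S.perm_one]

lemma perm_inv_perm (g : G) (v : V) : S.perm g⁻¹ (S.perm g v) = v := by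
  rw [← S.perm_mul, mul_inv_cancel, S.perm_one]

/-- The action on families indexed by `V × P`, trivial on `P`. -/
@[simps] def prod (P : Type*) : SignedAction G (V × P) where
  perm g q := (S.perm g q.1, q.2)
  sign g q := S.sign g q.1
  perm_one q := by simp [S.perm_one]
  sign_one q := S.sign_one _
  perm_mul g h q := by simp [S.perm_mul]
  sign_mul g h q := S.sign_mul _ _ _

/-- The action on real valued families, as a linear equivalence. -/
def linearEquiv (g : G) : (V → ℝ) ≃ₗ[ℝ] (V → ℝ) where
  toFun := S.act g
  invFun := S.act g⁻¹
  map_add' x y := by ext v; simp [act]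
  map_smul' r x := by
    ext v; simp only [act, Pi.smul_apply, RingHom.id_apply]; rw [smul_comm]
  left_inv x := S.act_inv_act g x
  right_inv x := S.act_act_inv g x

end SignedAction

/-- A cell of the unit grid `ℤ^I` scaled by two: even coordinates are free, odd ones are fixed.
`CellCovers a b` says that `a` is a facet of `b`. -/
def CellCovers {I : Type*} (a b : I → ℤ) : Prop :=
  ∃ q, Even (b q) ∧ (a q = b q + 1 ∨ a q = b q - 1) ∧ ∀ j, j ≠ q → a j = b j

/-- The dimension of a cell. -/
def cellDim {I : Type*} [Fintype I] (z : I → ℤ) : ℕ := #{q | Even (z q)}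

/-- The top-dimensional cells of the product over `V` of the boundaries of the cube `[-L,L]^P`. -/
def IsTopCell {V P : Type*} (L : ℤ) (z : V × P → ℤ) : Prop :=
  ∀ v, ∃ p, |z (v, p)| = L ∧ ∀ p', p' ≠ p → Even (z (v, p')) ∧ |z (v, p')| ≤ L

/-- Complete flags of cells. -/
structure IsCellFlag {V P : Type*} (L : ℤ) {D : ℕ} (c : Fin (D + 1) → V × P → ℤ) : Prop where
  top : IsTopCell L (c (Fin.last D))
  covers : ∀ k : Fin D, CellCovers (c k.castSucc) (c k.succ)

lemma units_int_smul_eq_or (e : ℤˣ) (z : ℤ) : e • z = z ∨ e • z = -z := by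
  rcases Int.units_eq_one_or e with rfl | rfl <;> simp [Units.smul_def]

lemma even_units_smul (e : ℤˣ) (z : ℤ) : Even (e • z) ↔ Even z := by
  rcases units_int_smul_eq_or e z with h | h <;> simp [h]

lemma abs_units_smul (e : ℤˣ) (z : ℤ) : |e • z| = |z| := by
  rcases units_int_smul_eq_or e z with h | h <;> simp [h]

section Action
variable {G V P : Type*} [Group G]

lemma CellCovers.act (S : SignedAction G V) (g : G) {a b : V → ℤ} (h : CellCovers a b) :
    CellCovers (S.act g a) (S.act g b) := by
  obtain ⟨q, h1, h2, h3⟩ := h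
  refine ⟨S.perm g⁻¹ q, ?_, ?_, ?_⟩
  · rw [S.act_apply, even_units_smul, S.perm_perm_inv]; exact h1
  · simp only [S.act_apply, S.perm_perm_inv]
    rcases Int.units_eq_one_or (S.sign g (S.perm g⁻¹ q)) with h | h <;>
      rcases h2 with h2 | h2 <;> simp [h, h2, Units.smul_def, sub_eq_add_neg]
  · intro q' hq'
    rw [S.act_apply, S.act_apply, h3]
    rintro rfl
    exact hq' (S.perm_inv_perm g q').symm

lemma IsTopCell.act (S : SignedAction G V) (g : G) {L : ℤ} {z : V × P → ℤ} (h : IsTopCell L z) :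
    IsTopCell L ((S.prod P).act g z) := by
  intro v
  obtain ⟨p, h1, h2⟩ := h (S.perm g v)
  refine ⟨p, ?_, fun p' hp' => ?_⟩
  · simpa [SignedAction.act_apply, abs_units_smul] using h1
  · simpa [SignedAction.act_apply, abs_units_smul, even_units_smul] using h2 p' hp'

lemma IsCellFlag.act (S : SignedAction G V) (g : G) {L : ℤ} {D : ℕ} {c : Fin (D + 1) → V × P → ℤ}
    (h : IsCellFlag L c) : IsCellFlag L (fun k => (S.prod P).act g (c k)) :=
  ⟨h.top.act S g, fun k => (h.covers k).act _ g⟩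

end Action

lemma CellCovers.cellDim {I : Type*} [Fintype I] {a b : I → ℤ} (h : CellCovers a b) :
    cellDim b = cellDim a + 1 := by
  classical
  obtain ⟨q, h1, h2, h3⟩ := h
  have : (univ.filter fun q => Even (b q)) = insert q (univ.filter fun q => Even (a q)) := by
    ext q'
    by_cases hq : q' = q
    · simp [hq, h1]
    · simp [hq, h3 q' hq]
  rw [_root_.cellDim, _root_.cellDim, this, card_insert_of_notMem]
  simp only [mem_filter, mem_univ, true_and]
  rw [Int.not_even_iff_odd]
  rcases h2 with h2 | h2 <;> rw [h2]
  · exact h1.add_one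
  · exact h1.sub_odd odd_one

lemma IsTopCell.cellDim {V : Type*} [Fintype V] {d : ℕ} {L : ℤ} (hL : Odd L)
    {z : V × Fin (d + 1) → ℤ} (h : IsTopCell L z) : cellDim z = Fintype.card V * d := by
  classical
  choose p hp1 hp2 using h
  have key : univ.filter (fun q => ¬ Even (z q)) = univ.image (fun v => (v, p v)) := by
    ext ⟨v, p'⟩
    simp only [mem_filter, mem_univ, true_and, mem_image, Prod.mk.injEq]
    constructor
    · intro h
      refine ⟨v, rfl, ?_⟩
      by_contra hne
      exact h (hp2 v p' (Ne.symm hne)).1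
    · rintro ⟨v, rfl, rfl⟩
      rw [← even_abs, hp1 v, Int.not_even_iff_odd]; exact hL
  have h1 := card_filter_add_card_filter_not (s := univ) (fun q => Even (z q))
  rw [key, card_image_of_injective _ (fun a b h => (Prod.ext_iff.1 h).1)] at h1
  simp only [card_univ, Fintype.card_prod, Fintype.card_fin, mul_add, mul_one] at h1
  have h2 : _root_.cellDim z = #{q | Even (z q)} := rfl
  omega

lemma IsCellFlag.cellDim {V : Type*} [Fintype V] {d : ℕ} {L : ℤ} (hL : Odd L)
    {c : Fin (Fintype.card V * d + 1) → V × Fin (d + 1) → ℤ} (h : IsCellFlag L c)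
    (k : Fin (Fintype.card V * d + 1)) : cellDim (c k) = k := by
  induction k using Fin.reverseInduction with
  | last => rw [h.top.cellDim hL]; simp
  | cast i ih =>
    have := (h.covers i).cellDim
    rw [ih] at this
    simp at this ⊢
    omega

/-- The diamond property in the interior of a flag. -/
lemma CellCovers.diamond {I : Type*} {a x b : I → ℤ} (h1 : CellCovers a x) (h2 : CellCovers x b) :
    ∃! y, y ≠ x ∧ CellCovers a y ∧ CellCovers y b := by
  classical
  obtain ⟨q₁, e1, s1, o1⟩ := h1
  obtain ⟨q₂, e2, s2, o2⟩ := h2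
  have hne : q₁ ≠ q₂ := by
    rintro rfl
    rcases s2 with s2 | s2 <;> rw [s2] at e1 <;>
      [rw [Int.even_add_one] at e1; rw [Int.even_sub_one] at e1] <;>
      exact e1 e2
  have b1 : x q₁ = b q₁ := o2 _ hne
  refine ⟨Function.update b q₁ (a q₁), ⟨?_, ⟨q₂, ?_, ?_, ?_⟩, ⟨q₁, ?_, ?_, ?_⟩⟩, ?_⟩
  · intro h
    have := congrFun h q₁
    simp at this; omega
  · rw [Function.update_of_ne hne.symm]; exact e2
  · rw [Function.update_of_ne hne.symm, o1 _ hne.symm]; exact s2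
  · intro q hq
    by_cases hq1 : q = q₁
    · simp [hq1]
    · rw [Function.update_of_ne hq1, o1 _ hq1, o2 _ hq]
  · rw [← b1]; exact e1
  · rw [← b1]; simpa using s1
  · intro q hq; rw [Function.update_of_ne hq]
  · rintro y ⟨hyx, ⟨q₃, e3, s3, o3⟩, ⟨q₄, e4, s4, o4⟩⟩
    have ha1 : a q₁ ≠ b q₁ := by omega
    have ha2 : a q₂ ≠ b q₂ := by have := o1 _ hne.symm; omega
    have h34 : ∀ q, a q ≠ b q → q = q₃ ∨ q = q₄ := by
      intro q hq; by_contra! h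
      exact hq ((o3 q h.1).trans (o4 q h.2))
    have h4 : q₄ = q₁ := by
      by_contra h41
      have h31 : q₁ = q₃ := (h34 _ ha1).resolve_right (Ne.symm h41)
      have h42 : q₂ = q₄ := (h34 _ ha2).resolve_left (by rw [← h31]; exact hne.symm)
      apply hyx
      ext q
      by_cases hq : q = q₂
      · subst hq
        rw [← o3 _ (by rw [← h31]; exact hne.symm), o1 _ hne.symm]
      · rw [o4 _ (by rw [← h42]; exact hq), o2 _ hq]
    subst h4
    have h32 : q₂ = q₃ := (h34 _ ha2).resolve_right hne.symm
    ext q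
    by_cases hq : q = q₄
    · subst hq
      rw [Function.update_self, o3 _ (by rw [← h32]; exact hne)]
    · rw [Function.update_of_ne hq, o4 _ hq]

/-- The diamond property at the bottom of a flag. -/
lemma CellCovers.diamond_bot {I : Type*} [Fintype I] {x b : I → ℤ} (hx : _root_.cellDim x = 0)
    (h : CellCovers x b) : ∃! y, y ≠ x ∧ CellCovers y b := by
  classical
  obtain ⟨q, e, s, o⟩ := h
  have hodd : ∀ q, ¬ Even (x q) := by
    intro q hq
    have h1 : q ∈ univ.filter (fun q => Even (x q)) := by simp [hq]
    rw [card_eq_zero.1 hx] at h1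
    simp at h1
  refine ⟨Function.update b q (2 * b q - x q), ⟨?_, ⟨q, e, ?_, ?_⟩⟩, ?_⟩
  · intro h
    have := congrFun h q
    simp at this; omega
  · simp; omega
  · intro q' hq'; rw [Function.update_of_ne hq']
  · rintro y ⟨hyx, q₂, e2, s2, o2⟩
    have hq : q₂ = q := by
      by_contra hq
      exact hodd q₂ (by rw [o _ hq]; exact e2)
    subst hq
    have hy : y q₂ ≠ x q₂ := by
      intro h
      apply hyx
      ext q
      by_cases hq : q = q₂
      · rw [hq, h]
      · rw [o2 _ hq, o _ hq]
    ext q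
    by_cases hq : q = q₂
    · subst hq; rw [Function.update_self]; omega
    · rw [Function.update_of_ne hq, o2 _ hq]

/-- The diamond property at the top of a flag. -/
lemma CellCovers.diamond_top {V P : Type*} {L : ℤ} (hL : Odd L) {a x : V × P → ℤ}
    (hx : IsTopCell L x) (h : CellCovers a x) :
    ∃! y, y ≠ x ∧ IsTopCell L y ∧ CellCovers a y := by
  classical
  obtain ⟨⟨v, j⟩, e, s, o⟩ := h
  have hLodd : ∀ z : ℤ, |z| = L → ¬ Even z := fun z hz => by
    rw [← even_abs, hz, Int.not_even_iff_odd]; exact hL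
  choose p hp1 hp2 using hx
  have hjp : j ≠ p v := by rintro rfl; exact hLodd _ (hp1 v) e
  have hxj := (hp2 v j hjp).2
  have haodd : ¬ Even (a (v, j)) := by
    rcases s with s | s <;> rw [s] <;> [rw [Int.even_add_one]; rw [Int.even_sub_one]] <;>
      exact not_not.2 e
  have hxjL : |x (v, j)| ≠ L := fun h => hLodd _ h e
  have haL : |a (v, j)| ≤ L := by
    rw [abs_le] at hxj ⊢
    rcases abs_cases (x (v,j)) with h | h <;> omega
  have hLpos : 0 < L := by
    have := abs_nonneg (x (v, j))
    omega
  -- uniqueness relies on locating the coordinate in which `a` and `y` differ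
  have hloc : ∀ y, IsTopCell L y → ∀ q, Even (y q) → (∀ q', q' ≠ q → a q' = y q') →
      q = (v, j) ∨ (q = (v, p v) ∧ |a (v, j)| = L) := by
    intro y hy ⟨w, i⟩ hq hoq
    obtain ⟨p₁, hp₁, hp₂⟩ := hy v
    by_cases hqj : (w, i) = (v, j)
    · exact Or.inl hqj
    right
    have hy1 := hoq (v, j) (Ne.symm hqj)
    have hjp1 : j = p₁ := by
      by_contra hne
      exact haodd (hy1 ▸ (hp₂ j hne).1)
    subst hjp1
    refine ⟨?_, by rw [hy1]; exact hp₁⟩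
    by_contra hne
    have h1 : Even (a (v, p v)) := by
      rw [hoq _ (Ne.symm hne)]
      exact (hp₂ (p v) (Ne.symm hjp)).1
    rw [o (v, p v) (by simpa using (Ne.symm hjp))] at h1
    exact hLodd _ (hp1 v) h1
  by_cases hcase : |a (v, j)| = L
  · -- move the other extreme coordinate of the block
    obtain ⟨t, ht1, ht2⟩ : ∃ t, (t = x (v, p v) + 1 ∨ t = x (v, p v) - 1) ∧ |t| ≤ L ∧
        ∀ t', (t' = x (v, p v) + 1 ∨ t' = x (v, p v) - 1) → |t'| ≤ L → t' = t := by
      have h1 := hp1 v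
      rcases abs_cases (x (v, p v)) with h | h
      · refine ⟨x (v, p v) - 1, Or.inr rfl, ?_, ?_⟩
        · rw [abs_le]; omega
        · intro t' ht' h'
          rw [abs_le] at h'; omega
      · refine ⟨x (v, p v) + 1, Or.inl rfl, ?_, ?_⟩
        · rw [abs_le]; omega
        · intro t' ht' h'
          rw [abs_le] at h'; omega
    have hteven : Even t := by
      have h1 := hLodd _ (hp1 v)
      rcases ht1 with h | h <;> rw [h] <;> [rw [Int.even_add_one]; rw [Int.even_sub_one]] <;>
        exact h1
    have hpj : (v, p v) ≠ (v, j) := by simpa using Ne.symm hjp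
    refine ⟨Function.update a (v, p v) t, ⟨?_, ?_, ⟨(v, p v), ?_, ?_, ?_⟩⟩, ?_⟩
    · intro h
      have := congrFun h (v, p v)
      simp only [Function.update_self] at this
      omega
    · intro w
      by_cases hw : w = v
      · subst hw
        refine ⟨j, ?_, fun p' hp' => ?_⟩
        · rw [Function.update_of_ne hpj.symm]; exact hcase
        · by_cases hpp : p' = p w
          · subst hpp; simpa using ⟨hteven, ht2.1⟩
          · rw [Function.update_of_ne (by simpa using hpp), o _ (by simpa using hp')]
            exact hp2 w p' hpp
      · refine ⟨p w, ?_, fun p' hp' => ?_⟩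
        · rw [Function.update_of_ne (by simp [hw]), o _ (by simp [hw])]; exact hp1 w
        · rw [Function.update_of_ne (by simp [hw]), o _ (by simp [hw])]; exact hp2 w p' hp'
    · simpa using hteven
    · rw [Function.update_self, o _ hpj]; omega
    · intro q hq; rw [Function.update_of_ne hq]
    · rintro y ⟨hyx, hy, q, eq, sq, oq⟩
      rcases hloc y hy q eq oq with rfl | ⟨rfl, -⟩
      · exfalso
        apply hyx
        have hyj : |y (v, j)| ≤ L := by
          obtain ⟨p₁, h1, h2⟩ := hy v
          by_cases h : j = p₁
          · rw [h, h1]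
          · exact (h2 j h).2
        ext q
        by_cases hq : q = (v, j)
        · subst hq
          rw [abs_le] at hyj hxj
          rcases abs_cases (a (v,j)) with h | h <;> omega
        · rw [← oq _ hq, o _ hq]
      · ext q
        by_cases hq : q = (v, p v)
        · subst hq
          rw [Function.update_self]
          rw [o _ hpj] at sq
          refine ht2.2 _ (by omega) ?_
          obtain ⟨p₁, h1, h2⟩ := hy v
          by_cases h : p v = p₁
          · rw [h, h1]
          · exact (h2 _ h).2
        · rw [Function.update_of_ne hq, oq _ hq]
  · -- reflect
    have haL' : |a (v, j)| < L := lt_of_le_of_ne haL hcase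
    have hbd : |2 * a (v, j) - x (v, j)| ≤ L := by
      rw [abs_lt] at haL'
      rw [abs_le]
      omega
    have heven : Even (2 * a (v, j) - x (v, j)) := (even_two_mul _).sub e
    refine ⟨Function.update a (v, j) (2 * a (v, j) - x (v, j)),
      ⟨?_, ?_, ⟨(v, j), ?_, ?_, ?_⟩⟩, ?_⟩
    · intro h
      have := congrFun h (v, j)
      simp only [Function.update_self] at this
      omega
    · intro w
      by_cases hw : w = v
      · subst hw
        refine ⟨p w, ?_, fun p' hp' => ?_⟩
        · rw [Function.update_of_ne (by simpa using Ne.symm hjp), o _ (by simpa using Ne.symm hjp)]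
          exact hp1 w
        · by_cases hpp : p' = j
          · subst hpp; simpa using ⟨heven, hbd⟩
          · rw [Function.update_of_ne (by simpa using hpp), o _ (by simpa using hpp)]
            exact hp2 w p' hp'
      · refine ⟨p w, ?_, fun p' hp' => ?_⟩
        · rw [Function.update_of_ne (by simp [hw]), o _ (by simp [hw])]; exact hp1 w
        · rw [Function.update_of_ne (by simp [hw]), o _ (by simp [hw])]; exact hp2 w p' hp'
    · simpa using heven
    · rw [Function.update_self]; omega
    · intro q hq; rw [Function.update_of_ne hq]
    · rintro y ⟨hyx, hy, q, eq, sq, oq⟩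
      rcases hloc y hy q eq oq with rfl | ⟨-, h⟩
      · have hyj : y (v, j) ≠ x (v, j) := by
          intro h; apply hyx; ext q
          by_cases hq : q = (v, j)
          · rw [hq, h]
          · rw [← oq _ hq, o _ hq]
        ext q
        by_cases hq : q = (v, j)
        · subst hq; rw [Function.update_self]; omega
        · rw [Function.update_of_ne hq, oq _ hq]
      · exact absurd h hcase

lemma IsCellFlag.update_iff {V P : Type*} {L : ℤ} {D : ℕ} {c : Fin (D + 1) → V × P → ℤ}
    (h : IsCellFlag L c) (k : Fin (D + 1)) (x : V × P → ℤ) :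
    IsCellFlag L (Function.update c k x) ↔ (k = Fin.last D → IsTopCell L x) ∧
      (∀ j : Fin D, j.castSucc = k → CellCovers x (c j.succ)) ∧
      (∀ j : Fin D, j.succ = k → CellCovers (c j.castSucc) x) := by
  constructor
  · rintro ⟨h1, h2⟩
    refine ⟨?_, ?_, ?_⟩
    · rintro rfl; simpa using h1
    · rintro j rfl
      have := h2 j
      rwa [Function.update_self, Function.update_of_ne (by simp [Fin.ext_iff])] at this
    · rintro j rfl
      have := h2 j
      rwa [Function.update_self, Function.update_of_ne (by simp [Fin.ext_iff])] at this
  · rintro ⟨h1, h2, h3⟩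
    refine ⟨?_, fun j => ?_⟩
    · by_cases hk : Fin.last D = k
      · subst hk; simpa using h1
      · rw [Function.update_of_ne hk]; exact h.top
    · by_cases hj : j.castSucc = k
      · have := h2 j hj
        subst hj
        rwa [Function.update_self, Function.update_of_ne (by simp [Fin.ext_iff])]
      · by_cases hj' : j.succ = k
        · have := h3 j hj'
          subst hj'
          rwa [Function.update_self, Function.update_of_ne hj]
        · rw [Function.update_of_ne hj, Function.update_of_ne hj']; exact h.covers j

/-- Every cell of a flag can be exchanged in exactly one way. -/
lemma IsCellFlag.existsUnique_exchange {V : Type*} [Fintype V] {d : ℕ} {L : ℤ} (hL : Odd L)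
    (hD : 0 < Fintype.card V * d)
    {c : Fin (Fintype.card V * d + 1) → V × Fin (d + 1) → ℤ} (h : IsCellFlag L c)
    (k : Fin (Fintype.card V * d + 1)) :
    ∃! x, x ≠ c k ∧ IsCellFlag L (Function.update c k x) := by
  have hdim := h.cellDim hL
  simp only [h.update_iff]
  generalize Fintype.card V * d = D at *
  obtain ⟨D, rfl⟩ : ∃ E, D = E + 1 := ⟨D - 1, by omega⟩
  rcases Fin.eq_castSucc_or_eq_last k with ⟨j, rfl⟩ | rfl
  · have hlast : ¬ (j.castSucc = Fin.last (D + 1)) := (Fin.castSucc_lt_last j).ne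
    rcases Fin.eq_zero_or_eq_succ j with rfl | ⟨i, rfl⟩
    · have := CellCovers.diamond_bot (by rw [hdim]; rfl) (h.covers 0)
      have hz : ∀ j : Fin (D + 1), j.succ ≠ Fin.castSucc 0 := fun j h =>
        Nat.succ_ne_zero _ (congrArg Fin.val h)
      simpa [hlast, Fin.castSucc_inj, hz] using this
    · have := (h.covers i.castSucc).diamond (x := c i.succ.castSucc) (h.covers i.succ)
      have hs : ∀ j : Fin (D + 1), j.succ = i.succ.castSucc ↔ j = i.castSucc := fun j => by
        simp [Fin.ext_iff]
      simp only [hlast, Fin.castSucc_inj, hs, forall_eq, IsEmpty.forall_iff, true_and]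
      simpa only [and_comm] using this
  · have := CellCovers.diamond_top hL h.top (h.covers (Fin.last D))
    have hz : ∀ j : Fin (D + 1), j.castSucc ≠ Fin.last (D + 1) := fun j =>
      (Fin.castSucc_lt_last j).ne
    have hs : ∀ j : Fin (D + 1), j.succ = Fin.last (D + 1) ↔ j = Fin.last D := fun j => by
      simp [Fin.ext_iff]
    simpa [hz, hs] using this

lemma isClosed_setOf_zeroInHull {ι Q : Type*} [Fintype ι] [Finite Q] :
    IsClosed {a : ι → Q → ℝ | ZeroInHull a} := by
  have hc : CompactSpace (stdSimplex ℝ ι) := isCompact_iff_compactSpace.1 (isCompact_stdSimplex ℝ ι)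
  have h1 : IsClosed {x : stdSimplex ℝ ι × (ι → Q → ℝ) | ∑ i, (x.1 : ι → ℝ) i • x.2 i = 0} :=
    isClosed_eq (continuous_finsetSum _ fun i _ =>
      ((continuous_apply i).comp (continuous_subtype_val.comp continuous_fst)).smul
        ((continuous_apply i).comp continuous_snd)) continuous_const
  convert isClosedMap_snd_of_compactSpace _ h1
  ext a
  constructor
  · rintro ⟨c, h0, h1, h2⟩
    exact ⟨(⟨c, h0, h1⟩, a), h2, rfl⟩
  · rintro ⟨⟨⟨c, h0, h1⟩, _⟩, h2, rfl⟩
    exact ⟨c, h0, h1, h2⟩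

/-- A nondegenerate simplex with `0` in its interior keeps this property under perturbations. -/
lemma eventually_zeroInHull {ι Q : Type*} [Fintype ι] [Fintype Q]
    (hcard : Fintype.card ι = Fintype.card Q + 1) (a : ι → Q → ℝ) (c₀ : ι → ℝ)
    (hc₀ : ∀ i, 0 < c₀ i) (hc₁ : ∑ i, c₀ i = 1) (hca : ∑ i, c₀ i • a i = 0)
    (hker : ∀ c : ι → ℝ, ∑ i, c i = 0 → ∑ i, c i • a i = 0 → c = 0) :
    ∀ᶠ b in 𝓝 a, ZeroInHull b := by
  classical
  let f : ι ≃ Option Q := Fintype.equivOfCardEq (by simp [hcard])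
  let N : (ι → Q → ℝ) → Matrix ι ι ℝ := fun b => Matrix.of fun i k => (f i).elim 1 (b k)
  let β : ι → ℝ := fun i => (f i).elim 1 fun _ => 0
  have hN : ∀ b c i, ((N b).mulVec c) i = (f i).elim (∑ k, c k) (∑ k, c k • b k) := by
    intro b c i
    simp only [Matrix.mulVec, dotProduct, N, Matrix.of_apply]
    rcases f i with _ | q
    · simp
    · simp [mul_comm]
  have hNc : Continuous N := by
    refine continuous_matrix fun i k => ?_
    simp only [N, Matrix.of_apply]
    rcases f i with _ | q
    · exact continuous_const
    · simp only [Option.elim_some]; fun_prop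
  have hdet : (N a).det ≠ 0 := by
    intro h
    obtain ⟨c, hc, hc'⟩ := Matrix.exists_mulVec_eq_zero_iff.2 h
    refine hc (hker c ?_ ?_)
    · have := hN a c (f.symm none)
      simpa [hc'] using this.symm
    · ext q
      have := hN a c (f.symm (some q))
      simpa [hc'] using this.symm
  let lam : (ι → Q → ℝ) → ι → ℝ := fun b => (N b).det⁻¹ • (N b).cramer β
  have hlam : ∀ b, (N b).det ≠ 0 → (N b).mulVec (lam b) = β := by
    intro b hb
    simp only [lam, Matrix.mulVec_smul, Matrix.mulVec_cramer, smul_smul, inv_mul_cancel₀ hb,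
      one_smul]
  have hlama : lam a = c₀ := by
    have h1 : (N a).mulVec c₀ = β := by
      ext i
      rw [hN, hc₁, hca]
      rfl
    have h2 : (N a).mulVec (lam a - c₀) = 0 := by
      rw [Matrix.mulVec_sub, hlam a hdet, h1, sub_self]
    by_contra hne
    exact hdet (Matrix.exists_mulVec_eq_zero_iff.1 ⟨_, sub_ne_zero.2 hne, h2⟩)
  have hdc : ContinuousAt (fun b => (N b).det) a := hNc.matrix_det.continuousAt
  have hlc : ContinuousAt lam a :=
    (hdc.inv₀ hdet).smul (hNc.matrix_cramer continuous_const).continuousAt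
  have h1 : ∀ᶠ b in 𝓝 a, (N b).det ≠ 0 := hdc.eventually_ne hdet
  have h2 : ∀ᶠ b in 𝓝 a, ∀ i, 0 < lam b i := by
    rw [eventually_all]
    intro i
    have : ContinuousAt (fun b => lam b i) a := (continuous_apply i).continuousAt.comp hlc
    exact this.eventually (lt_mem_nhds (by simpa only [hlama] using hc₀ i))
  filter_upwards [h1, h2] with b hb1 hb2
  have h3 := hlam b hb1
  refine ⟨lam b, fun i => (hb2 i).le, ?_, ?_⟩
  · have := hN b (lam b) (f.symm none)
    rw [h3] at this
    simpa [β] using this.symm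
  · ext q
    have := hN b (lam b) (f.symm (some q))
    rw [h3] at this
    simpa [β] using this.symm

lemma dense_setOf_det_ne_zero {Q : Type*} [Fintype Q] [DecidableEq Q] :
    Dense {M : Matrix Q Q ℝ | M.det ≠ 0} := by
  intro M
  have hfin : {t : ℝ | (-M).charpoly.IsRoot t}.Finite :=
    Polynomial.finite_setOfPred_isRoot (Matrix.charpoly_monic _).ne_zero
  have hd : Dense {t : ℝ | (-M).charpoly.IsRoot t}ᶜ := hfin.countable.dense_compl ℝ
  have hc : Continuous fun t : ℝ => M + t • (1 : Matrix Q Q ℝ) := by fun_prop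
  have := hc.continuousAt.continuousWithinAt.mem_closure_image (hd 0)
  simp only [zero_smul, add_zero] at this
  refine closure_mono ?_ this
  rintro _ ⟨t, ht, rfl⟩ h0
  apply ht
  change Polynomial.eval t _ = 0
  rw [Matrix.eval_charpoly]
  rw [sub_neg_eq_add, add_comm]
  rw [← h0]
  simp [Matrix.smul_one_eq_diagonal]

lemma dense_setOf_linearIndependent {T Q K : Type*} [Fintype T] [Fintype Q] [Finite K]
    (g : K → (Q → ℝ) ≃ₗ[ℝ] (Q → ℝ)) :
    Dense {R : T → Q → ℝ | ∀ τ : Q → T, Function.Injective τ → ∀ h : Q → K,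
      LinearIndependent ℝ fun q => g (h q) (R (τ q))} := by
  classical
  have : {R : T → Q → ℝ | ∀ τ : Q → T, Function.Injective τ → ∀ h : Q → K,
      LinearIndependent ℝ fun q => g (h q) (R (τ q))} =
      ⋂ x : {τ : Q → T // Function.Injective τ} × (Q → K),
        {R | LinearIndependent ℝ fun q => g (x.2 q) (R (x.1.1 q))} := by
    ext R; simp
  rw [this]
  have key : ∀ x : {τ : Q → T // Function.Injective τ} × (Q → K), ∃ Λ : (T → Q → ℝ) →ₗ[ℝ]
      Matrix Q Q ℝ, Function.Surjective Λ ∧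
      {R | LinearIndependent ℝ fun q => g (x.2 q) (R (x.1.1 q))} =
        Λ ⁻¹' {M : Matrix Q Q ℝ | M.det ≠ 0} := by
    rintro ⟨⟨τ, hτ⟩, h⟩
    refine ⟨(Matrix.ofLinearEquiv ℝ).toLinearMap ∘ₗ
      LinearMap.pi (fun q => (g (h q)).toLinearMap ∘ₗ LinearMap.proj (τ q)), ?_, ?_⟩
    · intro M
      refine ⟨fun t => if ht : ∃ q, τ q = t then (g (h ht.choose)).symm (M ht.choose) else 0, ?_⟩
      ext q q'
      have hq : ∃ q₁, τ q₁ = τ q := ⟨q, rfl⟩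
      have hq' : hq.choose = q := hτ hq.choose_spec
      change g (h q) (if ht : ∃ q₁, τ q₁ = τ q then (g (h ht.choose)).symm (M ht.choose) else 0) q'
        = M q q'
      rw [dif_pos hq, hq', LinearEquiv.apply_symm_apply]
    · ext R
      simp only [Set.mem_ofPred_eq, Set.mem_preimage]
      rw [← isUnit_iff_ne_zero, ← Matrix.isUnit_iff_isUnit_det,
        ← Matrix.linearIndependent_rows_iff_isUnit]
      rfl
  refine dense_iInter_of_isOpen (fun x => ?_) (fun x => ?_)
  · obtain ⟨Λ, -, h⟩ := key x
    rw [h]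
    exact (isOpen_compl_singleton.preimage (continuous_id.matrix_det)).preimage
      Λ.continuous_of_finiteDimensional
  · obtain ⟨Λ, hs, h⟩ := key x
    rw [h]
    exact dense_setOf_det_ne_zero.preimage (Λ.isOpenMap_of_finiteDimensional hs)

open Classical in
/-- The sign of an integer vector: the sign of its first nonzero entry. -/
noncomputable def lexSign {d : ℕ} (w : Fin d → ℤ) : ℤˣ := if 0 < toLex w then 1 else -1

lemma lexSign_units_smul {d : ℕ} (e : ℤˣ) {w : Fin d → ℤ} (hw : w ≠ 0) :
    lexSign (e • w) = e * lexSign w := by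
  have h0 : toLex w ≠ 0 := fun h => hw h
  rcases Int.units_eq_one_or e with rfl | rfl
  · simp
  · have h1 : toLex ((-1 : ℤˣ) • w) = - toLex w := by
      rw [Units.neg_smul, one_smul]; rfl
    have h2 : 0 < toLex ((-1 : ℤˣ) • w) ↔ ¬ 0 < toLex w := by
      rw [h1]
      exact ⟨fun h h' => lt_asymm h' (neg_pos.1 h), fun h => neg_pos.2
        ((lt_or_gt_of_ne h0).resolve_right h)⟩
    rw [lexSign, lexSign]
    by_cases h : 0 < toLex w
    · exact (if_neg fun h' => h2.1 h' h).trans (by rw [if_pos h]; rfl)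
    · exact (if_pos (h2.2 h)).trans (by rw [if_neg h]; rfl)

/-- The cells lying in the product of the boundaries of the cube `[-L,L]^P`. -/
def IsGridCell {V P : Type*} (L : ℤ) (z : V × P → ℤ) : Prop :=
  (∀ v, ∃ p, |z (v, p)| = L) ∧ ∀ q, |z q| ≤ L

lemma IsTopCell.isGridCell {V P : Type*} {L : ℤ} {z : V × P → ℤ} (h : IsTopCell L z) :
    IsGridCell L z := by
  refine ⟨fun v => ⟨_, (h v).choose_spec.1⟩, fun ⟨v, p'⟩ => ?_⟩
  obtain ⟨p, h1, h2⟩ := h v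
  by_cases hp : p' = p
  · rw [hp, h1]
  · exact (h2 p' hp).2

lemma CellCovers.isGridCell {V P : Type*} {L : ℤ} (hL : Odd L) {a b : V × P → ℤ}
    (h : CellCovers a b) (hb : IsGridCell L b) : IsGridCell L a := by
  obtain ⟨q, e, s, o⟩ := h
  have hne : ∀ q', |b q'| = L → ¬ Even (b q') := by
    intro q' h
    rw [← even_abs, h, Int.not_even_iff_odd]; exact hL
  refine ⟨fun v => ?_, fun q' => ?_⟩
  · obtain ⟨p, hp⟩ := hb.1 v
    refine ⟨p, ?_⟩
    rw [o _ (by rintro rfl; exact hne _ hp e), hp]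
  · by_cases hq : q' = q
    · subst hq
      have h1 := hb.2 q'
      have h2 : |b q'| ≠ L := fun h => hne _ h e
      have h3 : |b q'| < L := lt_of_le_of_ne h1 h2
      rw [abs_lt] at h3
      rw [abs_le]; omega
    · rw [o _ hq]; exact hb.2 _

lemma IsCellFlag.isGridCell {V P : Type*} {L : ℤ} (hL : Odd L) {D : ℕ}
    {c : Fin (D + 1) → V × P → ℤ} (h : IsCellFlag L c) (k : Fin (D + 1)) :
    IsGridCell L (c k) := by
  induction k using Fin.reverseInduction with
  | last => exact h.top.isGridCell
  | cast i ih => exact (h.covers i).isGridCell hL ih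

lemma IsCellFlag.apply_eq_or {V P : Type*} {L : ℤ} {D : ℕ}
    {c : Fin (D + 1) → V × P → ℤ} (h : IsCellFlag L c) (q : V × P) (k : Fin (D + 1)) :
    c k q = c (Fin.last D) q ∨ (Even (c (Fin.last D) q) ∧
      (c k q = c (Fin.last D) q + 1 ∨ c k q = c (Fin.last D) q - 1)) := by
  induction k using Fin.reverseInduction with
  | last => exact Or.inl rfl
  | cast i ih =>
    obtain ⟨q', e, s, o⟩ := h.covers i
    by_cases hq : q = q'
    · subst hq
      have : c i.succ q = c (Fin.last D) q := by
        rcases ih with ih | ⟨h1, h2⟩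
        · exact ih
        · exfalso
          rcases h2 with h2 | h2 <;> rw [h2] at e <;>
            [rw [Int.even_add_one] at e; rw [Int.even_sub_one] at e] <;> exact e h1
      rw [this] at e s
      exact Or.inr ⟨e, s⟩
    · rw [o q hq]; exact ih

lemma SignedAction.cellDim_act {G I : Type*} [Group G] [Fintype I] (S : SignedAction G I) (g : G)
    (z : I → ℤ) : cellDim (S.act g z) = cellDim z := by
  refine Finset.card_bij' (fun q _ => S.perm g q) (fun q _ => S.perm g⁻¹ q) ?_ ?_ ?_ ?_
  · intro q hq
    simpa [S.act_apply, even_units_smul] using hq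
  · intro q hq
    simpa [S.act_apply, even_units_smul, S.perm_perm_inv] using hq
  · intro q _; exact S.perm_inv_perm g q
  · intro q _; exact S.perm_perm_inv g q

lemma IsGridCell.act {G V P : Type*} [Group G] (S : SignedAction G V) (g : G) {L : ℤ}
    {z : V × P → ℤ} (h : IsGridCell L z) : IsGridCell L ((S.prod P).act g z) := by
  refine ⟨fun v => ?_, fun q => ?_⟩
  · obtain ⟨p, hp⟩ := h.1 (S.perm g v)
    exact ⟨p, by simpa [SignedAction.act_apply, abs_units_smul] using hp⟩
  · simpa [SignedAction.act_apply, abs_units_smul] using h.2 _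

namespace SignedAction
variable {G V : Type*} [Group G] (S : SignedAction G V)

/-- The action on sign patterns is simply transitive. -/
def SimplyTransitive : Prop := ∀ s : V → ℤˣ, ∃! g, S.act g s = fun _ => 1

variable {S} (hS : S.SimplyTransitive) {d : ℕ}

/-- The group element making all blocks of a cell positive. -/
noncomputable def SimplyTransitive.normalizer (z : V × Fin d → ℤ) : G :=
  (hS fun v => lexSign fun p => z (v, p)).choose

lemma SimplyTransitive.act_normalizer (z : V × Fin d → ℤ) :
    S.act (hS.normalizer z) (fun v => lexSign fun p => z (v, p)) = fun _ => 1 :=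
  (hS fun v => lexSign fun p => z (v, p)).choose_spec.1

lemma SimplyTransitive.eq_normalizer {z : V × Fin d → ℤ} {g : G}
    (h : S.act g (fun v => lexSign fun p => z (v, p)) = fun _ => 1) : g = hS.normalizer z :=
  (hS fun v => lexSign fun p => z (v, p)).unique h (hS.act_normalizer z)

lemma SimplyTransitive.normalizer_eq_one_iff {z : V × Fin d → ℤ} :
    hS.normalizer z = 1 ↔ ∀ v, lexSign (fun p => z (v, p)) = 1 := by
  constructor
  · intro h v
    have := congrFun (hS.act_normalizer z) v
    rwa [h, act_one] at this
  · intro h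
    refine (hS.eq_normalizer ?_).symm
    rw [act_one]
    exact funext h

lemma SimplyTransitive.normalizer_act {L : ℤ} (hL : L ≠ 0) (g : G) {z : V × Fin d → ℤ}
    (hz : IsGridCell L z) :
    hS.normalizer ((S.prod (Fin d)).act g z) = hS.normalizer z * g⁻¹ := by
  symm
  apply hS.eq_normalizer
  have : (fun v => lexSign fun p => (S.prod (Fin d)).act g z (v, p)) =
      S.act g fun v => lexSign fun p => z (v, p) := by
    ext1 v
    simp only [act_apply, prod_sign, prod_perm, smul_eq_mul]
    rw [← lexSign_units_smul]
    · rfl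
    · intro h
      obtain ⟨p, hp⟩ := hz.1 (S.perm g v)
      rw [congrFun h p] at hp
      exact hL (by simpa using hp.symm)
  rw [this, act_act, inv_mul_cancel_right]
  exact hS.act_normalizer z

/-- The positive representative of the orbit of a cell. -/
noncomputable def SimplyTransitive.rep (z : V × Fin d → ℤ) : V × Fin d → ℤ :=
  (S.prod (Fin d)).act (hS.normalizer z) z

lemma SimplyTransitive.rep_act {L : ℤ} (hL : L ≠ 0) (g : G) {z : V × Fin d → ℤ}
    (hz : IsGridCell L z) : hS.rep ((S.prod (Fin d)).act g z) = hS.rep z := by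
  rw [rep, hS.normalizer_act hL g hz, act_act, inv_mul_cancel_right, rep]

lemma SimplyTransitive.eq_one_of_act_eq (hS : S.SimplyTransitive) {L : ℤ} (hL : L ≠ 0)
    {g : G} {z : V × Fin d → ℤ} (hz : IsGridCell L z)
    (h : (S.prod (Fin d)).act g z = z) : g = 1 := by
  have := hS.normalizer_act hL g hz
  rw [h] at this
  simpa using this

/-- Extending a choice of values on representatives to an equivariant assignment. -/
noncomputable def SimplyTransitive.extend {Q : Type*} (R : (V × Fin d → ℤ) → V × Q → ℝ)
    (z : V × Fin d → ℤ) : V × Q → ℝ :=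
  (S.prod Q).act (hS.normalizer z)⁻¹ (R (hS.rep z))

lemma SimplyTransitive.extend_act {Q : Type*} (R : (V × Fin d → ℤ) → V × Q → ℝ) {L : ℤ}
    (hL : L ≠ 0) (g : G) {z : V × Fin d → ℤ} (hz : IsGridCell L z) :
    hS.extend R ((S.prod (Fin d)).act g z) = (S.prod Q).act g (hS.extend R z) := by
  rw [extend, hS.rep_act hL g hz, hS.normalizer_act hL g hz, extend, act_act, mul_inv_rev, inv_inv]

lemma SimplyTransitive.extend_of_equivariant {Q : Type*} (F : (V × Fin d → ℤ) → V × Q → ℝ)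
    {z : V × Fin d → ℤ} (hF : ∀ g, F ((S.prod (Fin d)).act g z) = (S.prod Q).act g (F z)) :
    hS.extend F z = F z := by
  rw [extend, rep, hF, act_inv_act]

end SignedAction

section Flags
variable {G V : Type*} [Group G] {S : SignedAction G V} (hS : S.SimplyTransitive)
  [Fintype V] {d : ℕ} {L : ℤ}

/-- Flags of cells whose top cell is positive. -/
abbrev PosFlag (d : ℕ) (L : ℤ) : Type _ :=
  {c : Fin (Fintype.card V * d + 1) → V × Fin (d + 1) → ℤ //
    IsCellFlag L c ∧ hS.normalizer (c (Fin.last _)) = 1}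

lemma finite_posFlag (hL : Odd L) : Finite (PosFlag hS d L) := by
  classical
  have : {c : Fin (Fintype.card V * d + 1) → V × Fin (d + 1) → ℤ |
      IsCellFlag L c ∧ hS.normalizer (c (Fin.last _)) = 1}.Finite := by
    refine (Set.finite_Icc (fun _ _ => -L) (fun _ _ => L)).subset ?_
    rintro c ⟨hc, -⟩
    exact ⟨fun k q => (abs_le.1 ((hc.isGridCell hL k).2 q)).1,
      fun k q => (abs_le.1 ((hc.isGridCell hL k).2 q)).2⟩
  exact this

lemma PosFlag.exists_involution (hL : Odd L) (hD : 0 < Fintype.card V * d)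
    (k : Fin (Fintype.card V * d + 1)) :
    ∃ σ : PosFlag hS d L → PosFlag hS d L, Function.Involutive σ ∧ (∀ φ, σ φ ≠ φ) ∧
      ∀ φ, ∃ g : G, ∀ l, l ≠ k → (σ φ).1 l = (S.prod (Fin (d + 1))).act g (φ.1 l) := by
  classical
  have hL0 : L ≠ 0 := by rintro rfl; exact absurd hL (by decide)
  have hex : ∀ φ : PosFlag hS d L, ∃ ψ : PosFlag hS d L, ∃ g : G, ∃ x, x ≠ φ.1 k ∧
      IsCellFlag L (Function.update φ.1 k x) ∧
      ∀ l, ψ.1 l = (S.prod (Fin (d + 1))).act g (Function.update φ.1 k x l) := by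
    intro φ
    obtain ⟨x, hx1, hx2⟩ := (φ.2.1.existsUnique_exchange hL hD k).exists
    let c := Function.update φ.1 k x
    refine ⟨⟨fun l => (S.prod (Fin (d + 1))).act (hS.normalizer (c (Fin.last _))) (c l),
      hx2.act S _, ?_⟩, _, x, hx1, hx2, fun _ => rfl⟩
    rw [hS.normalizer_act hL0 _ (hx2.isGridCell hL _), mul_inv_cancel]
  choose σ γ x hx1 hx2 hσ using hex
  have hσk : ∀ φ l, l ≠ k → (σ φ).1 l = (S.prod (Fin (d + 1))).act (γ φ) (φ.1 l) := by
    intro φ l hl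
    rw [hσ, Function.update_of_ne hl]
  refine ⟨σ, ?_, ?_, fun φ => ⟨γ φ, hσk φ⟩⟩
  · intro φ
    -- undo the first normalization
    have h1 : x (σ φ) = (S.prod (Fin (d + 1))).act (γ φ) (φ.1 k) := by
      refine ((σ φ).2.1.existsUnique_exchange hL hD k).unique ⟨hx1 _, hx2 _⟩ ⟨?_, ?_⟩
      · rw [hσ φ, Function.update_self]
        exact fun h => hx1 φ ((S.prod _).act_injective _ h).symm
      · convert φ.2.1.act S (γ φ) using 1
        ext1 l
        by_cases hl : l = k
        · subst hl; rw [Function.update_self]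
        · rw [Function.update_of_ne hl, hσk φ l hl]
    have h2 : (σ (σ φ)).1 = fun l => (S.prod (Fin (d + 1))).act (γ (σ φ) * γ φ) (φ.1 l) := by
      ext1 l
      rw [hσ (σ φ), ← SignedAction.act_act]
      by_cases hl : l = k
      · subst hl; rw [Function.update_self, h1]
      · rw [Function.update_of_ne hl, hσk φ l hl]
    have h3 : γ (σ φ) * γ φ = 1 := by
      have h := (σ (σ φ)).2.2
      rw [h2, hS.normalizer_act hL0 _ (φ.2.1.isGridCell hL _), φ.2.2, one_mul] at h
      exact inv_eq_one.1 h
    apply Subtype.ext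
    rw [h2, h3]
    simp only [SignedAction.act_one]
  · intro φ h
    have : Nontrivial (Fin (Fintype.card V * d + 1)) := Fin.nontrivial_iff_two_le.2 (by omega)
    obtain ⟨l, hl⟩ := exists_ne k
    have h1 := hσk φ l hl
    rw [h] at h1
    have h2 : γ φ = 1 := hS.eq_one_of_act_eq hL0 (φ.2.1.isGridCell hL _) h1.symm
    have h3 := hσ φ k
    rw [h, h2, Function.update_self, SignedAction.act_one] at h3
    exact hx1 φ h3.symm

open Classical in
/-- The parity of the number of flags over the origin does not depend on the (generic) equivariant
assignment. -/
lemma sum_zeroInHull_extend_eq [Fintype (PosFlag hS d L)] (hL : Odd L) (hD : 0 < Fintype.card V * d)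
    (R : Bool → (V × Fin (d + 1) → ℤ) → V × Fin d → ℝ)
    (hR : ∀ τ : V × Fin d → Bool × (V × Fin (d + 1) → ℤ), Function.Injective τ →
      (∀ q, IsGridCell L (τ q).2) → ∀ h : V × Fin d → G,
      LinearIndependent ℝ fun q => (S.prod (Fin d)).act (h q) (R (τ q).1 (τ q).2)) :
    ∑ φ : PosFlag hS d L,
      (if ZeroInHull (fun k => hS.extend (R false) (φ.1 k)) then (1 : ZMod 2) else 0) =
    ∑ φ : PosFlag hS d L,
      (if ZeroInHull (fun k => hS.extend (R true) (φ.1 k)) then (1 : ZMod 2) else 0) := by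
  have hL0 : L ≠ 0 := by rintro rfl; exact absurd hL (by decide)
  set D := Fintype.card V * d with hDdef
  have hfin : Module.finrank ℝ (V × Fin d → ℝ) = D := by simp [hDdef]
  let W : ℕ → PosFlag hS d L → Fin (D + 1) → V × Fin d → ℝ := fun j φ k =>
    hS.extend (R (decide ((k : ℕ) < j))) (φ.1 k)
  have step : ∀ j : ℕ, ∀ hj : j < D + 1,
      ∑ φ : PosFlag hS d L, (if ZeroInHull (W j φ) then (1 : ZMod 2) else 0) =
      ∑ φ : PosFlag hS d L, (if ZeroInHull (W (j + 1) φ) then (1 : ZMod 2) else 0) := by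
    intro j hj
    have hW : ∀ φ, W (j + 1) φ =
        Function.update (W j φ) ⟨j, hj⟩ (hS.extend (R true) (φ.1 ⟨j, hj⟩)) := by
      intro φ
      ext1 k
      by_cases hk : k = ⟨j, hj⟩
      · subst hk; simp [W]
      · rw [Function.update_of_ne hk]
        have : (k : ℕ) ≠ j := fun h => hk (Fin.ext h)
        have : ((k : ℕ) < j + 1) ↔ (k : ℕ) < j := by omega
        simp only [W, this]
    simp only [hW]
    refine sum_zeroInHull_update_eq (by rw [hfin, Fintype.card_fin]) (W j) ⟨j, hj⟩ _ ?_ ?_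
    · intro i hi
      obtain ⟨σ, h1, h2, h3⟩ := PosFlag.exists_involution hS hL hD i
      refine ⟨σ, h1, h2, fun φ => ?_⟩
      obtain ⟨g, hg⟩ := h3 φ
      refine ⟨(S.prod (Fin d)).linearEquiv g, fun k hk => ?_, ?_⟩
      · simp only [W]
        rw [hg k hk, hS.extend_act _ hL0 _ (φ.2.1.isGridCell hL _)]
        rfl
      · rw [hg _ hi.symm, hS.extend_act _ hL0 _ (φ.2.1.isGridCell hL _)]
        rfl
    · intro φ c hc0 hcs
      obtain ⟨i₁, i₂, hi, hi1, hi2⟩ := hc0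
      -- the remaining vertices are linearly independent
      let o : Option (Fin (D + 1)) → Bool × (V × Fin (d + 1) → ℤ) := fun x =>
        x.elim (true, hS.rep (φ.1 ⟨j, hj⟩)) fun k => (decide ((k : ℕ) < j), hS.rep (φ.1 k))
      have hdim : ∀ k, cellDim (hS.rep (φ.1 k)) = k := fun k => by
        rw [SignedAction.SimplyTransitive.rep, SignedAction.cellDim_act, φ.2.1.cellDim hL]
      have ho : Function.Injective o := by
        rintro (_ | k) (_ | l) h
        · rfl
        · simp only [o, Option.elim_none, Option.elim_some, Prod.mk.injEq] at h
          have h1 := congrArg cellDim h.2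
          rw [hdim, hdim] at h1
          have h2 := h.1
          simp at h1 h2; omega
        · simp only [o, Option.elim_none, Option.elim_some, Prod.mk.injEq] at h
          have h1 := congrArg cellDim h.2
          rw [hdim, hdim] at h1
          have h2 := h.1
          simp at h1 h2; omega
        · simp only [o, Option.elim_some, Prod.mk.injEq] at h
          have h1 := congrArg cellDim h.2
          rw [hdim, hdim] at h1
          rw [Fin.ext h1]
      have hog : ∀ x, IsGridCell L (o x).2 := by
        rintro (_ | k) <;> exact (φ.2.1.isGridCell hL _).act S _
      let h' : Option (Fin (D + 1)) → G := fun x =>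
        x.elim (hS.normalizer (φ.1 ⟨j, hj⟩))⁻¹ fun k => (hS.normalizer (φ.1 k))⁻¹
      have hval : ∀ x : Option (Fin (D + 1)), x.elim (hS.extend (R true) (φ.1 ⟨j, hj⟩)) (W j φ) =
          (S.prod (Fin d)).act (h' x) (R (o x).1 (o x).2) := by
        rintro (_ | k) <;> rfl
      have hc2 : Fintype.card (V × Fin d) =
          Fintype.card {x : Option (Fin (D + 1)) // x ∉ ({i₁, i₂} : Finset _)} := by
        rw [Fintype.card_subtype_compl, Fintype.card_coe, card_pair hi]
        simp [hDdef]
      let E := Fintype.equivOfCardEq hc2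
      have hli := hR (fun q => o (E q).1) (ho.comp (Subtype.val_injective.comp E.injective))
        (fun q => hog _) (fun q => h' (E q).1)
      have hz := Fintype.linearIndependent_iff.1 hli (fun q => c (E q).1) (by
        rw [E.sum_comp (fun x => c x.1 • (S.prod (Fin d)).act (h' x.1) (R (o x.1).1 (o x.1).2)),
          ← hcs, ← Fintype.sum_subtype_add_sum_subtype (fun x => x ∉ ({i₁, i₂} : Finset _))]
        rw [sum_eq_zero (s := (univ : Finset {x // ¬ x ∉ ({i₁, i₂} : Finset _)})), add_zero]
        · simp only [hval]
        · intro x _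
          have hx := not_not.1 x.2
          simp only [mem_insert, mem_singleton] at hx
          rcases hx with hx | hx <;> rw [hx] <;> simp [hi1, hi2])
      ext x
      by_cases hx : x ∈ ({i₁, i₂} : Finset _)
      · simp only [mem_insert, mem_singleton] at hx
        rcases hx with rfl | rfl <;> assumption
      · simpa using hz (E.symm ⟨x, hx⟩)
  have all : ∀ j : ℕ, j ≤ D + 1 →
      ∑ φ : PosFlag hS d L, (if ZeroInHull (W 0 φ) then (1 : ZMod 2) else 0) =
      ∑ φ : PosFlag hS d L, (if ZeroInHull (W j φ) then (1 : ZMod 2) else 0) := by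
    intro j
    induction j with
    | zero => intro _; rfl
    | succ j ih => intro hj; rw [ih (by omega), step j (by omega)]
  have h0 : ∀ φ, W 0 φ = fun k => hS.extend (R false) (φ.1 k) := fun φ => by ext1 k; simp [W]
  have h1 : ∀ φ, W (D + 1) φ = fun k => hS.extend (R true) (φ.1 k) := fun φ => by
    ext1 k; simp [W, k.2]
  simpa only [h0, h1] using all (D + 1) le_rfl

end Flags

section Standard
variable {V : Type*} {d : ℕ}

/-- The first `d` coordinates of every block. -/
def truncCell (z : V × Fin (d + 1) → ℤ) : V × Fin d → ℝ := fun q => z (q.1, q.2.castSucc)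

/-- The top cell centred at the poles. -/
def poleCell (V : Type*) (d : ℕ) (L : ℤ) : V × Fin (d + 1) → ℤ :=
  fun q => Fin.snoc (α := fun _ => ℤ) (fun _ => 0) L q.2

/-- A flag below the polar cell, ordered by `e`. -/
def stdFlag {D : ℕ} (e : V × Fin d ≃ Fin D) (L : ℤ) (k : Fin (D + 1)) : V × Fin (d + 1) → ℤ :=
  fun q => Fin.snoc (α := fun _ => ℤ)
    (fun j => if (k : ℕ) ≤ e (q.1, j) then 1 else 0) L q.2

open Classical in
/-- The truncation, perturbed at the pole. -/
noncomputable def stdMap {D : ℕ} (e : V × Fin d ≃ Fin D) (L : ℤ) (z : V × Fin (d + 1) → ℤ) :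
    V × Fin d → ℝ :=
  if z = poleCell V d L then fun q => -((e q : ℕ) + 1 : ℝ) else truncCell z

@[simp] lemma poleCell_castSucc (L : ℤ) (v : V) (j : Fin d) :
    poleCell V d L (v, j.castSucc) = 0 := by simp [poleCell]

@[simp] lemma poleCell_last (L : ℤ) (v : V) : poleCell V d L (v, Fin.last d) = L := by
  simp [poleCell]

@[simp] lemma stdFlag_castSucc {D : ℕ} (e : V × Fin d ≃ Fin D) (L : ℤ) (k : Fin (D + 1))
    (v : V) (j : Fin d) :
    stdFlag e L k (v, j.castSucc) = if (k : ℕ) ≤ e (v, j) then 1 else 0 := by simp [stdFlag]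

@[simp] lemma stdFlag_apply_last {D : ℕ} (e : V × Fin d ≃ Fin D) (L : ℤ) (k : Fin (D + 1))
    (v : V) : stdFlag e L k (v, Fin.last d) = L := by simp [stdFlag]

lemma stdFlag_last {D : ℕ} (e : V × Fin d ≃ Fin D) (L : ℤ) :
    stdFlag e L (Fin.last D) = poleCell V d L := by
  ext ⟨v, p⟩
  induction p using Fin.lastCases with
  | last => simp
  | cast j => simp [(e (v, j)).2]

lemma isTopCell_poleCell {L : ℤ} (hL : 0 < L) : IsTopCell L (poleCell V d L) := by
  intro v
  refine ⟨Fin.last d, by simp [abs_of_pos hL], fun p hp => ?_⟩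
  induction p using Fin.lastCases with
  | last => exact absurd rfl hp
  | cast j => simp [hL.le]

lemma isCellFlag_stdFlag {D : ℕ} (e : V × Fin d ≃ Fin D) {L : ℤ} (hL : 0 < L) :
    IsCellFlag L (stdFlag e L) := by
  refine ⟨by rw [stdFlag_last]; exact isTopCell_poleCell hL, fun k => ?_⟩
  obtain ⟨⟨v, j⟩, hq⟩ := e.surjective k
  refine ⟨(v, j.castSucc), ?_, ?_, ?_⟩
  · simp [hq]
  · simp [hq]
  · rintro ⟨v', p⟩ hp
    induction p using Fin.lastCases with
    | last => simp
    | cast j' =>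
      have hne : e (v', j') ≠ k := by
        rw [← hq]
        intro h
        have := e.injective h
        simp only [Prod.mk.injEq] at this
        exact hp (by rw [this.1, this.2])
      have hne' : (e (v', j') : ℕ) ≠ k := fun h => hne (Fin.ext h)
      simp only [stdFlag_castSucc, Fin.val_castSucc, Fin.val_succ]
      have : (k : ℕ) ≤ e (v', j') ↔ (k : ℕ) + 1 ≤ e (v', j') := by omega
      simp [this]

lemma lexSign_poleCell {L : ℤ} (hL : 0 < L) (v : V) :
    lexSign (fun p => poleCell V d L (v, p)) = 1 := by
  rw [lexSign, if_pos]
  refine ⟨Fin.last d, fun j hj => ?_, ?_⟩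
  · obtain ⟨i, rfl⟩ := Fin.exists_castSucc_eq.2 (ne_of_lt hj)
    exact (poleCell_castSucc L v i).symm
  · change (0 : ℤ) < poleCell V d L (v, Fin.last d)
    simpa using hL

lemma eq_poleCell_of_lexSign {L : ℤ} (hL : 0 < L) {z : V × Fin (d + 1) → ℤ}
    (hz : ∀ v, lexSign (fun p => z (v, p)) = 1) (h0 : ∀ v (j : Fin d), z (v, j.castSucc) = 0)
    (h1 : ∀ v, |z (v, Fin.last d)| = L) : z = poleCell V d L := by
  ext ⟨v, p⟩
  induction p using Fin.lastCases with
  | cast j => simp [h0]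
  | last =>
    rw [poleCell_last]
    rcases eq_or_eq_neg_of_abs_eq (h1 v) with h | h
    · exact h
    · exfalso
      have h2 := hz v
      rw [lexSign] at h2
      split_ifs at h2 with h3
      · obtain ⟨p, hp1, hp2⟩ := h3
        have hp3 : 0 < z (v, p) := hp2
        induction p using Fin.lastCases with
        | last => omega
        | cast j => rw [h0] at hp3; omega
      · exact absurd h2 (by decide)

lemma not_zeroInHull_of_one_le {ι Q : Type*} [Fintype ι] {a : ι → Q → ℝ} (q : Q) (s : ℝ)
    (h : ∀ k, 1 ≤ s * a k q) : ¬ ZeroInHull a := by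
  rintro ⟨c, h0, h1, h2⟩
  have h3 := congrFun h2 q
  simp only [Finset.sum_apply, Pi.smul_apply, smul_eq_mul, Pi.zero_apply] at h3
  have : ∑ i, c i ≤ s * ∑ i, c i * a i q := by
    rw [mul_sum]
    refine sum_le_sum fun i _ => ?_
    have := mul_le_mul_of_nonneg_left (h i) (h0 i)
    linarith
  rw [h3, h1] at this
  linarith

variable {G : Type*} [Group G] {S : SignedAction G V} (hS : S.SimplyTransitive) {L : ℤ}

lemma truncCell_act (g : G) (z : V × Fin (d + 1) → ℤ) :
    truncCell ((S.prod (Fin (d + 1))).act g z) = (S.prod (Fin d)).act g (truncCell z) := by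
  ext q
  simp only [truncCell, SignedAction.act_apply, SignedAction.prod_sign, SignedAction.prod_perm]
  rcases Int.units_eq_one_or (S.sign g q.1) with h | h <;> simp [h]

variable [Fintype V]

open Classical in
lemma PosFlag.extend_stdMap (hL : Odd L) (hL0 : 0 < L)
    (e : V × Fin d ≃ Fin (Fintype.card V * d)) (φ : PosFlag hS d L)
    (k : Fin (Fintype.card V * d + 1)) :
    hS.extend (stdMap e L) (φ.1 k) =
      if k = Fin.last _ ∧ φ.1 (Fin.last _) = poleCell V d L then fun q => -((e q : ℕ) + 1 : ℝ)
      else truncCell (φ.1 k) := by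
  have hlast : hS.rep (φ.1 (Fin.last _)) = φ.1 (Fin.last _) := by
    rw [SignedAction.SimplyTransitive.rep, φ.2.2, SignedAction.act_one]
  by_cases hk : hS.rep (φ.1 k) = poleCell V d L
  · have h1 : cellDim (hS.rep (φ.1 k)) = k := by
      rw [SignedAction.SimplyTransitive.rep, SignedAction.cellDim_act, φ.2.1.cellDim hL]
    rw [hk, (isTopCell_poleCell hL0).cellDim hL] at h1
    have h2 : k = Fin.last _ := Fin.ext h1.symm
    subst h2
    rw [hlast] at hk
    rw [if_pos ⟨rfl, hk⟩, SignedAction.SimplyTransitive.extend, φ.2.2, inv_one,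
      SignedAction.act_one, hlast, stdMap, if_pos hk]
  · rw [if_neg, SignedAction.SimplyTransitive.extend, stdMap, if_neg hk,
      SignedAction.SimplyTransitive.rep, truncCell_act, SignedAction.act_inv_act]
    rintro ⟨rfl, h⟩
    exact hk (hlast.trans h)

lemma PosFlag.eq_stdFlag_of_zeroInHull (hL : Odd L) (hL0 : 0 < L)
    (e : V × Fin d ≃ Fin (Fintype.card V * d)) (φ : PosFlag hS d L)
    (h : ZeroInHull fun k => hS.extend (stdMap e L) (φ.1 k)) : φ.1 = stdFlag e L := by
  classical
  have hsign := (hS.normalizer_eq_one_iff).1 φ.2.2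
  simp only [PosFlag.extend_stdMap hS hL hL0 e] at h
  obtain ⟨c, hc, hnorm⟩ := φ
  simp only at h hsign ⊢
  by_cases hpole : c (Fin.last _) = poleCell V d L
  swap
  · exfalso
    simp only [hpole, and_false, if_false] at h
    choose p hp1 hp2 using hc.top
    have hq : ∃ v, ∃ j : Fin d, c (Fin.last _) (v, j.castSucc) ≠ 0 := by
      by_contra! h0
      refine hpole (eq_poleCell_of_lexSign hL0 hsign h0 fun v => ?_)
      have : p v = Fin.last d := by
        by_contra hne
        obtain ⟨j, hj⟩ := Fin.exists_castSucc_eq.2 hne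
        have := hp1 v
        rw [← hj, h0] at this
        simp at this; omega
      rw [← this, hp1]
    obtain ⟨v, j, hvj⟩ := hq
    have key := hc.apply_eq_or (v, j.castSucc)
    set b := c (Fin.last _) (v, j.castSucc) with hb
    refine not_zeroInHull_of_one_le (v, j) (b.sign : ℝ) (fun k => ?_) h
    have : 1 ≤ b.sign * c k (v, j.castSucc) := by
      rcases lt_or_gt_of_ne hvj with hneg | hpos
      · rw [Int.sign_eq_neg_one_of_neg hneg]
        rcases key k with h | ⟨⟨t, ht⟩, h⟩ <;> omega
      · rw [Int.sign_eq_one_of_pos hpos]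
        rcases key k with h | ⟨⟨t, ht⟩, h⟩ <;> omega
    simp only [truncCell]
    exact_mod_cast this
  simp only [hpole, and_true] at h
  obtain ⟨w, hw0, hw1, hw2⟩ := h
  -- the coordinate that changes at each step
  choose q hqe hqs hqo using hc.covers
  have hlast : ∀ k v, c k (v, Fin.last d) = L := by
    intro k v
    have := hc.apply_eq_or (v, Fin.last d) k
    rw [hpole, poleCell_last] at this
    exact this.resolve_right fun h => (Int.not_even_iff_odd.2 hL) h.1
  have hqr : ∀ i, ∃ r : V × Fin d, q i = (r.1, r.2.castSucc) := by
    intro i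
    have hne : (q i).2 ≠ Fin.last d := by
      intro h
      have h1 := hqe i
      rw [show q i = ((q i).1, Fin.last d) from Prod.ext rfl h, hlast] at h1
      exact (Int.not_even_iff_odd.2 hL) h1
    obtain ⟨j, hj⟩ := Fin.exists_castSucc_eq.2 hne
    exact ⟨((q i).1, j), Prod.ext rfl hj.symm⟩
  choose r hr using hqr
  -- below the step where it changes, a coordinate is constant and odd
  have hzero : ∀ (r' : V × Fin d) k, Even (c k (r'.1, r'.2.castSucc)) →
      c k (r'.1, r'.2.castSucc) = 0 := by
    intro r' k h
    have := hc.apply_eq_or (r'.1, r'.2.castSucc) k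
    rw [hpole, poleCell_castSucc] at this
    rcases this with h' | ⟨-, h' | h'⟩
    · exact h'
    · rw [h'] at h; exact absurd h (by decide)
    · rw [h'] at h; exact absurd h (by decide)
  have hstep : ∀ (i : Fin (Fintype.card V * d)) (q' : V × Fin (d + 1)), Odd (c i.succ q') →
      c i.castSucc q' = c i.succ q' := by
    intro i q' h
    exact hqo i q' fun h' => (Int.not_even_iff_odd.2 h) (h' ▸ hqe i)
  have hoddq : ∀ i, Odd (c i.castSucc (q i)) := by
    intro i
    rcases hqs i with h | h <;> rw [h]
    · exact (hqe i).add_one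
    · exact (hqe i).sub_odd odd_one
  have hdown : ∀ i (l : Fin (Fintype.card V * d + 1)), l ≤ i.castSucc →
      c l (q i) = c i.castSucc (q i) := by
    intro i l hl
    induction l using Fin.reverseInduction with
    | last =>
      have := Fin.castSucc_lt_last i
      exact absurd hl (not_le.2 this)
    | cast l ih =>
      rcases eq_or_lt_of_le hl with h | h
      · rw [h]
      · have := ih (by
          rw [Fin.lt_def] at h
          rw [Fin.le_def]
          simp only [Fin.val_castSucc, Fin.val_succ] at h ⊢
          omega)
        rw [← this]
        exact hstep l _ (by rw [this]; exact hoddq i)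
  have hrinj : Function.Injective r := by
    have : ∀ i i', i < i' → r i ≠ r i' := by
      intro i i' hlt h
      have hqq : q i = q i' := by rw [hr, hr, h]
      have h1 := hdown i' i.succ (by simpa [Fin.le_def, Nat.succ_le_iff] using hlt)
      have h2 := hqe i
      rw [hqq, h1] at h2
      exact (Int.not_even_iff_odd.2 (hoddq i')) h2
    intro i i' h
    by_contra hne
    rcases lt_or_gt_of_ne hne with h' | h'
    · exact this _ _ h' h
    · exact this _ _ h' h.symm
  have hup : ∀ i (l : Fin (Fintype.card V * d + 1)), i.castSucc < l →
      c l (q i) = 0 := by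
    intro i l
    induction l using Fin.induction with
    | zero => intro h; exact absurd h (not_lt.2 (Fin.zero_le _))
    | succ l ih =>
      intro h
      rcases eq_or_lt_of_le (show i ≤ l by
        rw [Fin.lt_def] at h
        rw [Fin.le_def]
        simp only [Fin.val_castSucc, Fin.val_succ] at h
        omega)
        with h' | h'
      · subst h'
        rw [hr]; exact hzero _ _ (by rw [← hr]; exact hqe i)
      · rw [← ih (by simpa using h')]
        symm
        exact hqo l _ fun h'' => h'.ne (hrinj (by
          have : q i = q l := h''
          rw [hr, hr] at this
          simp only [Prod.mk.injEq, Fin.castSucc_inj] at this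
          exact Prod.ext this.1 this.2))
  have hpm : ∀ i, c i.castSucc (q i) = 1 ∨ c i.castSucc (q i) = -1 := by
    intro i
    have h1 : c i.succ (q i) = 0 := hup i _ (by simp [Fin.lt_def])
    rcases hqs i with h | h <;> rw [h, h1] <;> simp
  -- the barycentric equations
  let A : Fin (Fintype.card V * d) → ℝ := fun i =>
    ∑ l : Fin (Fintype.card V * d), if l ≤ i then w l.castSucc else 0
  have hAnonneg : ∀ i, 0 ≤ A i := fun i => sum_nonneg fun l _ => by
    split_ifs
    · exact hw0 _
    · exact le_rfl
  have hAmono : ∀ i i', i ≤ i' → A i ≤ A i' := fun i i' hii => sum_le_sum fun l _ => by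
    by_cases h : l ≤ i
    · rw [if_pos h, if_pos (h.trans hii)]
    · rw [if_neg h]
      split_ifs
      · exact hw0 _
      · exact le_rfl
  have heq : ∀ i, (c i.castSucc (q i) : ℝ) * A i =
      w (Fin.last _) * (((e (r i) : ℕ) : ℝ) + 1) := by
    intro i
    have h := congrFun hw2 (r i)
    simp only [Finset.sum_apply, Pi.smul_apply, smul_eq_mul, Pi.zero_apply] at h
    rw [Fin.sum_univ_castSucc] at h
    simp only [if_true] at h
    have h1 : ∀ l : Fin (Fintype.card V * d), (if l.castSucc = Fin.last _ then
        (fun q => -(((e q : ℕ) : ℝ) + 1)) else truncCell (c l.castSucc)) (r i) =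
        if l ≤ i then (c i.castSucc (q i) : ℝ) else 0 := by
      intro l
      rw [if_neg (Fin.castSucc_lt_last l).ne, truncCell, ← hr]
      by_cases hl : l ≤ i
      · rw [if_pos hl, hdown i _ (by simpa using hl)]
      · rw [if_neg hl, hup i _ (by simpa using hl)]; simp
    simp only [h1] at h
    have h2 : ∑ l : Fin (Fintype.card V * d), w l.castSucc *
        (if l ≤ i then (c i.castSucc (q i) : ℝ) else 0) = (c i.castSucc (q i) : ℝ) * A i := by
      rw [mul_sum]
      exact sum_congr rfl fun l _ => by split_ifs <;> ring
    rw [h2] at h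
    linarith
  have hwpos : 0 < w (Fin.last _) := by
    refine lt_of_le_of_ne (hw0 _) fun h0 => ?_
    have hA0 : ∀ i, A i = 0 := by
      intro i
      have h := heq i
      rw [← h0, zero_mul] at h
      rcases hpm i with h' | h' <;> rw [h'] at h <;> simpa using h
    have hw : ∀ l : Fin (Fintype.card V * d), w l.castSucc = 0 := by
      intro l
      have := (sum_eq_zero_iff_of_nonneg (fun l _ => by
        split_ifs
        · exact hw0 _
        · exact le_rfl)).1 (hA0 l) l (mem_univ l)
      simpa using this
    rw [Fin.sum_univ_castSucc, ← h0] at hw1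
    simp [hw] at hw1
  have hone : ∀ i, c i.castSucc (q i) = 1 := by
    intro i
    refine (hpm i).resolve_right fun h => ?_
    have h1 := heq i
    rw [h] at h1
    have h2 := hAnonneg i
    have h3 : 0 < w (Fin.last _) * (((e (r i) : ℕ) : ℝ) + 1) := by positivity
    push_cast at h1
    linarith
  have hmono : StrictMono fun i => e (r i) := by
    refine Monotone.strictMono_of_injective ?_ (e.injective.comp hrinj)
    intro i i' hii
    have h1 := heq i
    have h2 := heq i'
    rw [hone] at h1 h2
    have h3 := hAmono i i' hii
    simp only [Int.cast_one, one_mul] at h1 h2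
    rw [h1, h2] at h3
    have h4 := le_of_mul_le_mul_left h3 hwpos
    have : ((e (r i) : ℕ) : ℝ) ≤ ((e (r i') : ℕ) : ℝ) := by linarith
    exact_mod_cast this
  have hid : ∀ i, e (r i) = i := congrFun hmono.eq_id
  ext k ⟨v, p⟩
  induction p using Fin.lastCases with
  | last => rw [hlast, stdFlag_apply_last]
  | cast j =>
    have hrv : r (e (v, j)) = (v, j) := e.injective (hid _)
    have hqv : q (e (v, j)) = (v, j.castSucc) := by rw [hr, hrv]
    rw [stdFlag_castSucc, ← hqv]
    split_ifs with hk
    · rw [hdown _ _ (by simpa [Fin.le_def] using hk), hone]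
    · exact hup _ _ (by simpa [Fin.lt_def] using hk)

end Standard

section Discrete
variable {G V : Type*} [Group G] {S : SignedAction G V}
  {d : ℕ} {L : ℤ}

lemma SignedAction.norm_act {G V : Type*} [Group G] [Fintype V] (S : SignedAction G V) (g : G)
    (x : V → ℝ) : ‖S.act g x‖ = ‖x‖ := by
  have key : ∀ (g : G) (x : V → ℝ), ‖S.act g x‖ ≤ ‖x‖ := fun g x => by
    refine (pi_norm_le_iff_of_nonneg (norm_nonneg _)).2 fun v => ?_
    rw [S.act_apply]
    rcases Int.units_eq_one_or (S.sign g v) with h | h <;> simp [h, Units.smul_def] <;>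
      exact norm_le_pi_norm x _
  refine le_antisymm (key g x) ?_
  conv_lhs => rw [← S.act_inv_act g x]
  exact key _ _

/-- The sum of the first values of a truncated flag, read off at one coordinate. -/
lemma sum_stdFlag_eq {D : ℕ} (c : Fin (D + 1) → ℝ) (i : Fin D) :
    (∑ k : Fin D, c k.castSucc * if (k : ℕ) ≤ i then (1 : ℝ) else 0) =
      ∑ k ∈ range (i + 1), (if h : k < D + 1 then c ⟨k, h⟩ else 0) := by
  rw [← Fin.sum_univ_eq_sum_range (fun k => if h : k < D + 1 then c ⟨k, h⟩ else 0)]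
  simp only [mul_ite, mul_one, mul_zero]
  rw [← sum_filter]
  symm
  refine sum_bij (fun k _ => ⟨k, lt_of_lt_of_le k.2 i.2⟩) ?_ ?_ ?_ ?_
  · intro k _; rw [mem_filter]; exact ⟨mem_univ _, Nat.le_of_lt_succ k.2⟩
  · intro a _ b _ h; simpa [Fin.ext_iff] using h
  · intro b hb
    simp at hb
    exact ⟨⟨b, by omega⟩, mem_univ _, rfl⟩
  · intro k _
    have h1 : (k : ℕ) < D + 1 := lt_of_lt_of_le k.2 (Nat.succ_le_succ i.2.le)
    simp [h1]

lemma eventually_zeroInHull_stdFlag [Fintype V] {D : ℕ} (e : V × Fin d ≃ Fin D) (L : ℤ)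
    (a : Fin (D + 1) → V × Fin d → ℝ)
    (ha : ∀ k, a k = if k = Fin.last _ then fun q => -((e q : ℕ) + 1 : ℝ)
      else truncCell (stdFlag e L k)) :
    ∀ᶠ b in 𝓝 a, ZeroInHull b := by
  have hD : Fintype.card (V × Fin d) = D := by rw [Fintype.card_congr e, Fintype.card_fin]
  have hval : ∀ (c : Fin (D + 1) → ℝ) (q : V × Fin d), (∑ k, c k • a k) q =
      ∑ k ∈ range (e q + 1), (if h : k < D + 1 then c ⟨k, h⟩ else 0) -
        c (Fin.last _) * ((e q : ℕ) + 1) := by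
    intro c q
    rw [Finset.sum_apply, Fin.sum_univ_castSucc, ← sum_stdFlag_eq]
    simp only [ha, if_true, Pi.smul_apply, smul_eq_mul]
    have : ∀ k : Fin D, (if k.castSucc = Fin.last D then fun q => -(((e q : ℕ) : ℝ) + 1)
        else truncCell (stdFlag e L k.castSucc)) q = if (k : ℕ) ≤ e q then (1 : ℝ) else 0 := by
      intro k
      rw [if_neg (Fin.castSucc_lt_last k).ne, truncCell]
      obtain ⟨v, j⟩ := q
      rw [stdFlag_castSucc]
      push_cast
      simp
    simp only [this]
    ring
  refine eventually_zeroInHull (by rw [hD, Fintype.card_fin]) a (fun _ => 1 / (D + 1))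
    (fun _ => by positivity) ?_ ?_ ?_
  · simp; field_simp
  · ext q
    rw [hval]
    have h1 : ∀ k ∈ range ((e q : ℕ) + 1), (if h : k < D + 1 then (1 / (D + 1) : ℝ) else 0) =
        1 / (D + 1) := by
      intro k hk
      rw [dif_pos]
      have := (e q).2
      simp at hk; omega
    rw [sum_congr rfl h1]
    simp
    ring
  · intro c hc0 hc
    have hP : ∀ i, i ≤ D → ∑ k ∈ range i, (if h : k < D + 1 then c ⟨k, h⟩ else 0) =
        c (Fin.last _) * i := by
      intro i hi
      rcases i with _ | i
      · simp
      · have h1 := congrFun hc (e.symm ⟨i, hi⟩)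
        rw [hval] at h1
        simp only [Equiv.apply_symm_apply, Pi.zero_apply] at h1
        push_cast
        linarith
    have hall : ∀ k, c k = c (Fin.last _) := by
      intro k
      induction k using Fin.lastCases with
      | last => rfl
      | cast k =>
        have h1 := hP (k + 1) k.2
        have h3 : (k : ℕ) < D + 1 := k.2.trans (Nat.lt_succ_self _)
        rw [sum_range_succ, hP k k.2.le, dif_pos h3] at h1
        push_cast at h1
        have h4 : c k.castSucc = c ⟨k, h3⟩ := rfl
        rw [h4]; linarith
    have h0 : c (Fin.last _) = 0 := by
      rw [sum_congr rfl fun k _ => hall k] at hc0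
      simp at hc0
      rcases hc0 with h | h
      · have : (0 : ℝ) ≤ D := by positivity
        linarith
      · exact h
    ext k
    rw [hall, h0]; rfl

theorem exists_isCellFlag_norm_le [Finite G] [Fintype V] (hS : S.SimplyTransitive) (hL : Odd L)
    (hL0 : 0 < L) (hD : 0 < Fintype.card V * d) (F : (V × Fin (d + 1) → ℤ) → V × Fin d → ℝ)
    (hF : ∀ z, IsGridCell L z → ∀ g, F ((S.prod (Fin (d + 1))).act g z) =
      (S.prod (Fin d)).act g (F z)) {ε : ℝ} (hε : 0 < ε) :
    ∃ c : Fin (Fintype.card V * d + 1) → V × Fin (d + 1) → ℤ, IsCellFlag L c ∧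
      ∃ w : Fin (Fintype.card V * d + 1) → ℝ, (∀ k, 0 ≤ w k) ∧ ∑ k, w k = 1 ∧
        ‖∑ k, w k • F (c k)‖ ≤ ε := by
  classical
  have : Finite (PosFlag hS d L) := finite_posFlag hS hL
  let _ := Fintype.ofFinite (PosFlag hS d L)
  have : Finite {z : V × Fin (d + 1) → ℤ // IsGridCell L z} := by
    have : {z : V × Fin (d + 1) → ℤ | IsGridCell L z}.Finite :=
      (Set.finite_Icc (fun _ => -L) (fun _ => L)).subset fun z hz =>
        ⟨fun q => (abs_le.1 (hz.2 q)).1, fun q => (abs_le.1 (hz.2 q)).2⟩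
    exact this
  let _ := Fintype.ofFinite {z : V × Fin (d + 1) → ℤ // IsGridCell L z}
  let e : V × Fin d ≃ Fin (Fintype.card V * d) := Fintype.equivFinOfCardEq (by simp)
  let T := Bool × {z : V × Fin (d + 1) → ℤ // IsGridCell L z}
  let hat : (T → V × Fin d → ℝ) → Bool → (V × Fin (d + 1) → ℤ) → V × Fin d → ℝ :=
    fun R b z => if h : IsGridCell L z then R (b, ⟨z, h⟩) else 0
  let R₀ : T → V × Fin d → ℝ := fun t => if t.1 then stdMap e L t.2.1 else F t.2.1
  have hrep : ∀ z : V × Fin (d + 1) → ℤ, IsGridCell L z → IsGridCell L (hS.rep z) :=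
    fun z hz => hz.act S _
  have hcont : ∀ b z, Continuous fun R => hS.extend (hat R b) z := by
    intro b z
    refine (LinearMap.continuous_of_finiteDimensional
      ((S.prod (Fin d)).linearEquiv (hS.normalizer z)⁻¹).toLinearMap).comp ?_
    by_cases h : IsGridCell L (hS.rep z)
    · simp only [hat, h, dif_pos]; exact continuous_apply _
    · simp only [hat, h, dif_neg, not_false_eq_true]; exact continuous_const
  have hR₀ : ∀ (φ : PosFlag hS d L) k,
      hS.extend (hat R₀ true) (φ.1 k) = hS.extend (stdMap e L) (φ.1 k) := by
    intro φ k
    simp only [SignedAction.SimplyTransitive.extend, hat, dif_pos (hrep _ (φ.2.1.isGridCell hL k)),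
      R₀, if_true]
  have hlast : stdFlag e L (Fin.last _) = poleCell V d L := stdFlag_last e L
  let φ₀ : PosFlag hS d L := ⟨stdFlag e L, isCellFlag_stdFlag e hL0, by
    rw [hlast, hS.normalizer_eq_one_iff]
    exact lexSign_poleCell hL0⟩
  have ev1 : ∀ᶠ R in 𝓝 R₀, ∀ φ : PosFlag hS d L, φ ≠ φ₀ →
      ¬ ZeroInHull fun k => hS.extend (hat R true) (φ.1 k) := by
    refine eventually_all.2 fun φ => ?_
    by_cases hφ : φ = φ₀
    · exact Eventually.of_forall fun R h => absurd hφ h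
    · have h1 : ¬ ZeroInHull fun k => hS.extend (hat R₀ true) (φ.1 k) := fun h =>
        hφ (Subtype.ext (PosFlag.eq_stdFlag_of_zeroInHull hS hL hL0 e φ
          (by simpa only [hR₀] using h)))
      have hc : Continuous fun R => fun k => hS.extend (hat R true) (φ.1 k) :=
        continuous_pi fun k => hcont _ _
      filter_upwards [(isClosed_setOf_zeroInHull.preimage hc).isOpen_compl.mem_nhds h1] with R hR _
      exact hR
  have ev2 : ∀ᶠ R in 𝓝 R₀, ZeroInHull fun k => hS.extend (hat R true) (φ₀.1 k) := by
    have hc : Continuous fun R => fun k => hS.extend (hat R true) (φ₀.1 k) :=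
      continuous_pi fun k => hcont _ _
    refine hc.continuousAt.eventually (eventually_zeroInHull_stdFlag e L _ fun k => ?_)
    change hS.extend (hat R₀ true) (φ₀.1 k) = _
    rw [hR₀, PosFlag.extend_stdMap hS hL hL0 e]
    simp only [φ₀, hlast, and_true]
  have ev3 : ∀ᶠ R in 𝓝 R₀, dist R R₀ < ε := Metric.ball_mem_nhds _ hε
  obtain ⟨R, hRg, hR1, hR2, hR3⟩ := (dense_setOf_linearIndependent (T := T)
    fun g : G => (S.prod (Fin d)).linearEquiv g).inter_nhds_nonempty (ev1.and (ev2.and ev3))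
  have hpar := sum_zeroInHull_extend_eq hS hL hD (hat R) (by
    intro τ hτ hgrid h
    have := hRg (fun q => ((τ q).1, ⟨(τ q).2, hgrid q⟩)) (fun q q' hq => hτ (by
      simp only [T, Prod.mk.injEq, Subtype.mk.injEq] at hq
      exact Prod.ext hq.1 hq.2)) h
    convert this using 2 with q
    simp only [hat, dif_pos (hgrid q)]
    rfl)
  have hone : ∑ φ : PosFlag hS d L,
      (if ZeroInHull (fun k => hS.extend (hat R true) (φ.1 k)) then (1 : ZMod 2) else 0) = 1 := by
    rw [sum_eq_single φ₀, if_pos hR2]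
    · intro φ _ hφ
      rw [if_neg (hR1 φ hφ)]
    · intro h; exact absurd (mem_univ _) h
  rw [hone] at hpar
  obtain ⟨φ, hφ⟩ : ∃ φ : PosFlag hS d L, ZeroInHull fun k => hS.extend (hat R false) (φ.1 k) := by
    by_contra! h
    rw [sum_eq_zero fun φ _ => if_neg (h φ)] at hpar
    exact zero_ne_one hpar
  obtain ⟨w, hw0, hw1, hw2⟩ := hφ
  refine ⟨φ.1, φ.2.1, w, hw0, hw1, ?_⟩
  have hclose : ∀ k, ‖F (φ.1 k) - hS.extend (hat R false) (φ.1 k)‖ ≤ ε := by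
    intro k
    have hg := φ.2.1.isGridCell hL k
    rw [← hS.extend_of_equivariant F (hF _ hg)]
    simp only [SignedAction.SimplyTransitive.extend]
    have hsub : ∀ g x y, (S.prod (Fin d)).act g x - (S.prod (Fin d)).act g y =
        (S.prod (Fin d)).act g (x - y : V × Fin d → ℝ) := fun g x y =>
      (((S.prod (Fin d)).linearEquiv g).map_sub x y).symm
    rw [hsub, SignedAction.norm_act]
    simp only [hat, dif_pos (hrep _ hg)]
    rw [← dist_eq_norm, dist_comm]
    have h1 := dist_le_pi_dist R R₀ (false, ⟨_, hrep _ hg⟩)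
    simp only [R₀] at h1
    exact h1.trans hR3.le
  calc ‖∑ k, w k • F (φ.1 k)‖
      = ‖∑ k, w k • (F (φ.1 k) - hS.extend (hat R false) (φ.1 k))‖ := by
        simp only [smul_sub, sum_sub_distrib, hw2, sub_zero]
    _ ≤ ∑ k, w k * ε := (norm_sum_le _ _).trans (sum_le_sum fun k _ => by
        rw [norm_smul, Real.norm_of_nonneg (hw0 k)]
        exact mul_le_mul_of_nonneg_left (hclose k) (hw0 k))
    _ = ε := by rw [← sum_mul, hw1, one_mul]

end Discrete

section Continuous
variable {G V : Type*} [Group G] {S : SignedAction G V} {d : ℕ}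

lemma IsGridCell.norm_div_eq_one {L : ℤ} (hL : 0 < L) {z : V × Fin (d + 1) → ℤ}
    (hz : IsGridCell L z) (v : V) : ‖fun p => (z (v, p) : ℝ) / L‖ = 1 := by
  have hL' : (0 : ℝ) < L := by exact_mod_cast hL
  refine le_antisymm ((pi_norm_le_iff_of_nonneg zero_le_one).2 fun p => ?_) ?_
  · rw [Real.norm_eq_abs, abs_div, abs_of_pos hL', div_le_one hL']
    exact_mod_cast hz.2 (v, p)
  · obtain ⟨p, hp⟩ := hz.1 v
    refine le_trans (le_of_eq ?_) (norm_le_pi_norm (fun p => (z (v, p) : ℝ) / L) p)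
    rw [Real.norm_eq_abs, abs_div, abs_of_pos hL', ← Int.cast_abs, hp, div_self hL'.ne']

theorem SignedAction.SimplyTransitive.exists_eq_zero [Finite G] [Fintype V]
    (hS : S.SimplyTransitive) (F : (V × Fin (d + 1) → ℝ) → V × Fin d → ℝ)
    (hF : ContinuousOn F {x | ∀ v, ‖fun p => x (v, p)‖ = 1})
    (hequiv : ∀ x : V × Fin (d + 1) → ℝ, (∀ v, ‖fun p => x (v, p)‖ = 1) → ∀ g,
      F ((S.prod (Fin (d + 1))).act g x) = (S.prod (Fin d)).act g (F x)) :
    ∃ x : V × Fin (d + 1) → ℝ, (∀ v, ‖fun p => x (v, p)‖ = 1) ∧ F x = 0 := by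
  set K : Set (V × Fin (d + 1) → ℝ) := {x | ∀ v, ‖fun p => x (v, p)‖ = 1} with hK
  have hKne : K.Nonempty := ⟨fun _ => 1, fun v => by
    change ‖fun _ : Fin (d + 1) => (1 : ℝ)‖ = 1
    rw [pi_norm_const, norm_one]⟩
  rcases Nat.eq_zero_or_pos (Fintype.card V * d) with hD | hD
  · obtain ⟨x, hx⟩ := hKne
    refine ⟨x, hx, ?_⟩
    have : IsEmpty (V × Fin d) := Fintype.card_eq_zero_iff.1 (by simpa using hD)
    exact Subsingleton.elim _ _
  have hKc : IsCompact K := by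
    refine Metric.isCompact_of_isClosed_isBounded ?_ ?_
    · have : K = ⋂ v, {x | ‖fun p => x (v, p)‖ = 1} := by ext; simp [hK]
      rw [this]
      exact isClosed_iInter fun v => isClosed_eq (by fun_prop) continuous_const
    · refine (Metric.isBounded_closedBall (x := (0 : V × Fin (d + 1) → ℝ)) (r := 1)).subset ?_
      intro x hx
      rw [mem_closedBall_zero_iff]
      refine (pi_norm_le_iff_of_nonneg zero_le_one).2 fun q => ?_
      rw [← hx q.1]
      exact norm_le_pi_norm (fun p => x (q.1, p)) q.2
  obtain ⟨x₀, hx₀, hmin⟩ := hKc.exists_isMinOn hKne hF.norm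
  refine ⟨x₀, hx₀, ?_⟩
  by_contra hne
  have hm : 0 < ‖F x₀‖ := norm_pos_iff.2 hne
  set ε := ‖F x₀‖ / 4 with hε
  have hε0 : 0 < ε := by positivity
  obtain ⟨δ, hδ, hu⟩ := Metric.uniformContinuousOn_iff.1 (hKc.uniformContinuousOn_of_continuous hF)
    ε hε0
  obtain ⟨n, hn⟩ := exists_nat_gt (1 / δ)
  let L : ℤ := 2 * n + 1
  have hLo : Odd L := ⟨n, rfl⟩
  have hL0 : 0 < L := by positivity
  have hL' : (0 : ℝ) < L := by exact_mod_cast hL0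
  have hLδ : 1 / (L : ℝ) < δ := by
    rw [div_lt_comm₀ hL' hδ]
    refine hn.trans_le ?_
    simp only [L]; push_cast
    have : (0 : ℝ) ≤ n := n.cast_nonneg
    linarith
  let s : (V × Fin (d + 1) → ℤ) → V × Fin (d + 1) → ℝ := fun z q => z q / L
  have hs : ∀ z, IsGridCell L z → s z ∈ K := fun z hz v => hz.norm_div_eq_one hL0 v
  obtain ⟨c, hc, w, hw0, hw1, hw2⟩ := exists_isCellFlag_norm_le hS hLo hL0 hD (fun z => F (s z))
    (fun z hz g => by
      rw [← hequiv _ (hs z hz)]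
      congr 1
      ext q
      simp only [s, SignedAction.act_apply]
      rcases Int.units_eq_one_or (S.sign g q.1) with h | h <;>
        simp [h, Units.smul_def, neg_div]) hε0
  have hgrid := fun k => hs _ (hc.isGridCell hLo k)
  have hclose : ∀ k, ‖F (s (c (Fin.last _))) - F (s (c k))‖ ≤ ε := by
    intro k
    rw [← dist_eq_norm]
    refine (hu _ (hgrid _) _ (hgrid _) (lt_of_le_of_lt ?_ hLδ)).le
    refine (dist_pi_le_iff (by positivity)).2 fun q => ?_
    simp only [s]
    rw [Real.dist_eq, ← sub_div, abs_div, abs_of_pos hL']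
    refine div_le_div_of_nonneg_right ?_ hL'.le
    have : |c (Fin.last _) q - c k q| ≤ 1 := by
      rcases hc.apply_eq_or q k with h | ⟨-, h | h⟩ <;> rw [h] <;> simp
    exact_mod_cast this
  have h1 : F (s (c (Fin.last _))) = ∑ k, w k • (F (s (c (Fin.last _))) - F (s (c k))) +
      ∑ k, w k • F (s (c k)) := by
    rw [← sum_add_distrib]
    simp only [← smul_add, sub_add_cancel]
    rw [← sum_smul, hw1, one_smul]
  have h2 : ‖∑ k, w k • (F (s (c (Fin.last _))) - F (s (c k)))‖ ≤ ε := by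
    refine (norm_sum_le _ _).trans ?_
    calc ∑ k, ‖w k • (F (s (c (Fin.last _))) - F (s (c k)))‖ ≤ ∑ k, w k * ε :=
          sum_le_sum fun k _ => by
            rw [norm_smul, Real.norm_of_nonneg (hw0 k)]
            exact mul_le_mul_of_nonneg_left (hclose k) (hw0 k)
      _ = ε := by rw [← sum_mul, hw1, one_mul]
  have h3 : ‖F x₀‖ ≤ ‖F (s (c (Fin.last _)))‖ := hmin (hgrid _)
  have h4 : ‖F (s (c (Fin.last _)))‖ ≤ ε + ε := by
    rw [h1]
    exact (norm_add_le _ _).trans (add_le_add h2 hw2)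
  rw [hε] at h4
  linarith

end Continuous

section Tree
variable {N d : ℕ}

/-- Internal nodes of the binary tree with leaves `Fin N → Bool`. -/
abbrev TreeNode (N : ℕ) : Type := Σ i : Fin N, (Fin i → Bool)

/-- The ancestor at level `i` of a leaf. -/
def treeNode (i : Fin N) (l : Fin N → Bool) : TreeNode N := ⟨i, fun j => l ⟨j, j.2.trans i.2⟩⟩

/-- The sign of the branch taken. -/
def branchSign (b : Bool) : ℤˣ := if b then -1 else 1

lemma branchSign_injective : Function.Injective branchSign := by decide

@[simp] lemma branchSign_not (b : Bool) : branchSign (!b) = -branchSign b := by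
  cases b <;> decide

@[simp] lemma branchSign_decide (u : ℤˣ) : branchSign (decide (u = -1)) = u := by
  rcases Int.units_eq_one_or u with rfl | rfl <;> decide

lemma treeNode_eq_iff {i : Fin N} {l l' : Fin N → Bool} :
    treeNode i l = treeNode i l' ↔ ∀ j < i, l j = l' j := by
  simp only [treeNode, Sigma.mk.injEq, heq_eq_eq, true_and, funext_iff]
  exact ⟨fun h j hj => h ⟨j, hj⟩, fun h j => h ⟨j, j.2.trans i.2⟩ j.2⟩

lemma exists_treeNode_eq (v : TreeNode N) : ∃ l, treeNode v.1 l = v ∧ l v.1 = false := by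
  obtain ⟨i, p⟩ := v
  refine ⟨fun j => if h : j < i then p ⟨j, h⟩ else false, ?_, by simp⟩
  simp only [treeNode, Sigma.mk.injEq, heq_eq_eq, true_and]
  ext1 j
  have : (⟨j, j.2.trans i.2⟩ : Fin N) < i := j.2
  simp [this]

/-- Automorphisms of the binary tree, as permutations of leaves. -/
def treeAut (N : ℕ) : Subgroup (Equiv.Perm (Fin N → Bool)) where
  carrier := {g | ∀ (k : ℕ) l l', (∀ j : Fin N, (j : ℕ) < k → g l j = g l' j) ↔
    ∀ j : Fin N, (j : ℕ) < k → l j = l' j}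
  mul_mem' {g h} hg hh k l l' := (hg k (h l) (h l')).trans (hh k l l')
  one_mem' _ _ _ := Iff.rfl
  inv_mem' {g} hg k l l' := by
    have := hg k (g⁻¹ l) (g⁻¹ l')
    simp only [Equiv.Perm.inv_def, Equiv.apply_symm_apply] at this
    exact this.symm

lemma treeAut.treeNode_eq_iff (g : treeAut N) {i : Fin N} {l l' : Fin N → Bool} :
    treeNode i (g.1 l) = treeNode i (g.1 l') ↔ treeNode i l = treeNode i l' := by
  rw [_root_.treeNode_eq_iff, _root_.treeNode_eq_iff]
  exact g.2 i l l'

lemma treeAut.apply_eq_iff (g : treeAut N) {i : Fin N} {l l' : Fin N → Bool}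
    (h : treeNode i l = treeNode i l') : g.1 l i = g.1 l' i ↔ l i = l' i := by
  rw [_root_.treeNode_eq_iff] at h
  have h1 := g.2 (i + 1) l l'
  have h2 := (g.2 i l l').2 h
  constructor
  · intro h3
    refine h1.1 (fun j hj => ?_) i (Nat.lt_succ_self _)
    rcases Nat.lt_succ_iff_lt_or_eq.1 hj with h4 | h4
    · exact h2 j h4
    · rw [Fin.ext h4]; exact h3
  · intro h3
    refine h1.2 (fun j hj => ?_) i (Nat.lt_succ_self _)
    rcases Nat.lt_succ_iff_lt_or_eq.1 hj with h4 | h4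
    · exact h j h4
    · rw [Fin.ext h4]; exact h3

/-- A leaf below a given node. -/
noncomputable def someLeaf (v : TreeNode N) : Fin N → Bool := (exists_treeNode_eq v).choose

lemma treeNode_someLeaf (v : TreeNode N) : treeNode v.1 (someLeaf v) = v :=
  (exists_treeNode_eq v).choose_spec.1

lemma someLeaf_apply (v : TreeNode N) : someLeaf v v.1 = false :=
  (exists_treeNode_eq v).choose_spec.2

lemma treeNode_fst (i : Fin N) (l : Fin N → Bool) : (treeNode i l).1 = i := rfl

lemma treeAut.perm_aux (g : treeAut N) (i : Fin N) (l : Fin N → Bool) :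
    treeNode i (g.1 (someLeaf (treeNode i l))) = treeNode i (g.1 l) :=
  (treeAut.treeNode_eq_iff g).2 (treeNode_someLeaf (treeNode i l))

lemma branchSign_mul_eq {a b a' b' : Bool} (h : a = b ↔ a' = b') :
    branchSign a * branchSign a' = branchSign b * branchSign b' := by
  revert a b a' b'; decide

lemma treeAut.sign_aux (g : treeAut N) (i : Fin N) (l : Fin N → Bool) :
    branchSign (g.1 (someLeaf (treeNode i l)) i) = branchSign (l i) * branchSign (g.1 l i) := by
  have h := branchSign_mul_eq
    (treeAut.apply_eq_iff g (treeNode_someLeaf (treeNode i l) : treeNode i _ = _)).symm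
  have h2 : someLeaf (treeNode i l) i = false := someLeaf_apply (treeNode i l)
  rw [treeNode_fst, h2] at h
  simpa [branchSign] using h

/-- The action of tree automorphisms on nodes, with the signs recording swapped branches. -/
noncomputable def treeAction (N : ℕ) : SignedAction (treeAut N) (TreeNode N) where
  perm g v := treeNode v.1 (g⁻¹.1 (someLeaf v))
  sign g v := branchSign (g⁻¹.1 (someLeaf v) v.1)
  perm_one v := by simpa using treeNode_someLeaf v
  sign_one v := by simp [someLeaf_apply, branchSign]
  perm_mul g h v := by
    rw [treeNode_fst]
    simp only [mul_inv_rev]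
    exact (treeAut.perm_aux h⁻¹ v.1 _).symm
  sign_mul g h v := by
    rw [treeNode_fst, treeAut.sign_aux h⁻¹, ← mul_assoc]
    simp [← sq, mul_inv_rev]

lemma treeAction_perm (g : treeAut N) (i : Fin N) (l : Fin N → Bool) :
    (treeAction N).perm g (treeNode i l) = treeNode i (g⁻¹.1 l) := treeAut.perm_aux g⁻¹ i l

lemma treeAction_sign (g : treeAut N) (i : Fin N) (l : Fin N → Bool) :
    (treeAction N).sign g (treeNode i l) = branchSign (l i) * branchSign (g⁻¹.1 l i) :=
  treeAut.sign_aux g⁻¹ i l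

lemma simplyTransitive_treeAction : (treeAction N).SimplyTransitive := by
  intro s
  let γ : (Fin N → Bool) → Fin N → Bool := fun l i =>
    decide (branchSign (l i) * s (treeNode i l) = -1)
  have hγ : ∀ l i, branchSign (γ l i) = branchSign (l i) * s (treeNode i l) := fun l i =>
    branchSign_decide _
  have hagree : ∀ (k : ℕ) l l', (∀ j : Fin N, (j : ℕ) < k → γ l j = γ l' j) ↔
      ∀ j : Fin N, (j : ℕ) < k → l j = l' j := by
    intro k l l'
    constructor
    · induction k with
      | zero => intro _ j hj; exact absurd hj (Nat.not_lt_zero _)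
      | succ k ih =>
        intro h j hj
        have h1 := ih fun j hj => h j (hj.trans (Nat.lt_succ_self _))
        have h2 : treeNode j l = treeNode j l' := treeNode_eq_iff.2 fun j' hj' =>
          h1 j' (lt_of_lt_of_le hj' (Nat.le_of_lt_succ hj))
        have h3 := congrArg branchSign (h j hj)
        rw [hγ, hγ, h2] at h3
        exact branchSign_injective (mul_right_cancel h3)
    · intro h j hj
      have h2 : treeNode j l = treeNode j l' :=
        treeNode_eq_iff.2 fun j' hj' => h j' (lt_trans (Fin.lt_def.1 hj') hj)
      apply branchSign_injective
      rw [hγ, hγ, h2, h j hj]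
  have hinj : Function.Injective γ := fun l l' h => by
    ext j
    rw [(hagree N l l').1 (fun j _ => by rw [h]) j j.2]
  let g : treeAut N := ⟨Equiv.ofBijective γ (Finite.injective_iff_bijective.1 hinj), hagree⟩
  have hact : ∀ g' : treeAut N, (treeAction N).act g' s = (fun _ => 1) ↔ ∀ l, g'.1 l = γ l := by
    intro g'
    constructor
    · intro h l
      ext i
      have h1 := congrFun h (treeNode i (g'.1 l))
      rw [SignedAction.act_apply, treeAction_perm, treeAction_sign] at h1
      simp only [InvMemClass.coe_inv, Equiv.Perm.inv_def, Equiv.symm_apply_apply, smul_eq_mul] at h1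
      have : g'.1 l i = γ l i := by
        apply branchSign_injective
        rw [hγ]
        rw [mul_assoc] at h1
        rw [eq_comm, ← inv_eq_of_mul_eq_one_right h1, Int.units_inv_eq_self]
      rw [this]
    · intro h
      ext1 v
      have hv : v = treeNode v.1 (g'.1 (g'.1.symm (someLeaf v))) := by
        rw [Equiv.apply_symm_apply, treeNode_someLeaf]
      set l := g'.1.symm (someLeaf v)
      rw [hv, SignedAction.act_apply, treeAction_perm, treeAction_sign]
      simp only [InvMemClass.coe_inv, Equiv.Perm.inv_def, Equiv.symm_apply_apply, smul_eq_mul]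
      rw [mul_assoc, h, ← hγ, Int.units_mul_self]
  refine ⟨g, (hact g).2 fun l => rfl, fun g' hg' => ?_⟩
  apply Subtype.ext
  ext1 l
  exact (hact g').1 hg' l

/-- The labels along the path to a leaf, with signs. -/
def treePath {P : Type*} (x : TreeNode N × P → ℝ) (l : Fin N → Bool) (i : Fin N) : P → ℝ :=
  fun p => branchSign (l i) • x (treeNode i l, p)

lemma treePath_act {P : Type*} (g : treeAut N) (x : TreeNode N × P → ℝ) (l : Fin N → Bool) :
    treePath (((treeAction N).prod P).act g x) l = treePath x (g⁻¹.1 l) := by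
  ext i p
  simp only [treePath, SignedAction.act_apply, SignedAction.prod_sign, SignedAction.prod_perm,
    treeAction_perm, treeAction_sign, smul_smul, ← mul_assoc, Int.units_mul_self, one_mul]

lemma eq_of_forall_sum_treeNode_eq_zero (a : (Fin N → Bool) → ℝ)
    (h : ∀ v : TreeNode N, ∑ l with treeNode v.1 l = v, branchSign (l v.1) • a l = 0)
    (l l' : Fin N → Bool) : a l = a l' := by
  suffices H : ∀ k ≤ N, ∀ l l' : Fin N → Bool,
      (∀ j : Fin N, (j : ℕ) < N - k → l j = l' j) → a l = a l' from
    H N le_rfl l l' fun j hj => absurd hj (by simp)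
  intro k
  induction k with
  | zero =>
    intro _ l l' hl
    rw [show l = l' from funext fun j => hl j j.2]
  | succ k ih =>
    intro hk l l' hl
    set i : Fin N := ⟨N - (k + 1), by omega⟩ with hi
    have hstep : ∀ l l' : Fin N → Bool, treeNode i l = treeNode i l' → l i = l' i → a l = a l' := by
      intro l l' h1 h2
      refine ih (by omega) l l' fun j hj => ?_
      rcases lt_or_eq_of_le (show (j : ℕ) ≤ i by simp [hi]; omega) with h3 | h3
      · exact treeNode_eq_iff.1 h1 j h3
      · rw [Fin.ext h3, h2]
    have hll : treeNode i l = treeNode i l' := treeNode_eq_iff.2 fun j hj => hl j hj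
    by_cases hli : l i = l' i
    · exact hstep l l' hll hli
    have hsum := h (treeNode i l)
    rw [treeNode_fst] at hsum
    have hterm : ∀ m ∈ (univ.filter fun m => treeNode i m = treeNode i l),
        branchSign (m i) • a m = ((branchSign (m i) : ℤ) : ℝ) * ((a l + a l') / 2) +
          ((branchSign (l i) : ℤ) : ℝ) * ((a l - a l') / 2) := by
      intro m hm
      rw [mem_filter] at hm
      by_cases hmi : m i = l i
      · rw [hstep m l hm.2 hmi, hmi, Units.smul_def, zsmul_eq_mul]; ring
      · have h1 : m i = l' i := by
          revert hmi hli; cases m i <;> cases l i <;> cases l' i <;> simp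
        have h2 : m i = !(l i) := by
          revert hmi; cases m i <;> cases l i <;> simp
        rw [hstep m l' (hm.2.trans hll) h1, h2, Units.smul_def, zsmul_eq_mul]
        simp; ring
    rw [sum_congr rfl hterm, sum_add_distrib, ← sum_mul] at hsum
    have hz : ∑ m with treeNode i m = treeNode i l, ((branchSign (m i) : ℤ) : ℝ) = 0 := by
      refine sum_involution (fun m _ => Function.update m i (!(m i))) ?_ ?_ ?_ ?_
      · intro m _; simp
      · intro m _ _ h
        have := congrFun h i
        simp at this
      · intro m hm
        rw [mem_filter] at hm ⊢
        refine ⟨mem_univ _, ?_⟩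
        rw [← hm.2, treeNode_eq_iff]
        intro j hj
        rw [Function.update_of_ne hj.ne]
      · intro m _; simp
    rw [hz, zero_mul, zero_add, sum_const, nsmul_eq_mul] at hsum
    have hc : ((univ.filter fun m => treeNode i m = treeNode i l).card : ℝ) ≠ 0 := by
      have : l ∈ univ.filter fun m => treeNode i m = treeNode i l := by simp
      exact_mod_cast (card_pos.2 ⟨l, this⟩).ne'
    have hs : ((branchSign (l i) : ℤ) : ℝ) ≠ 0 := by
      exact_mod_cast (branchSign (l i)).ne_zero
    rcases mul_eq_zero.1 hsum with h1 | h1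
    · exact absurd h1 hc
    · rcases mul_eq_zero.1 h1 with h2 | h2
      · exact absurd h2 hs
      · linarith

/-- A Borsuk–Ulam type theorem for binary trees of hyperplane cuts. -/
theorem exists_treePath_eq (Ψ : (Fin N → Fin (d + 1) → ℝ) → Fin d → ℝ)
    (hΨ : ContinuousOn Ψ {w | ∀ i, ‖w i‖ = 1}) :
    ∃ x : TreeNode N × Fin (d + 1) → ℝ, (∀ v, ‖fun p => x (v, p)‖ = 1) ∧
      ∀ l l', Ψ (treePath x l) = Ψ (treePath x l') := by
  obtain ⟨x, hx, hF⟩ := (simplyTransitive_treeAction (N := N)).exists_eq_zero (d := d)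
    (fun x q => ∑ l with treeNode q.1.1 l = q.1, branchSign (l q.1.1) • Ψ (treePath x l) q.2)
    (by
      refine continuousOn_pi.2 fun q => continuousOn_finsetSum _ fun l _ => ?_
      have h1 : Continuous fun x : TreeNode N × Fin (d + 1) → ℝ => treePath x l := by
        refine continuous_pi fun i => continuous_pi fun p => ?_
        exact (continuous_apply (treeNode i l, p)).const_smul (branchSign (l i))
      have h2 : ContinuousOn (fun x : TreeNode N × Fin (d + 1) → ℝ => Ψ (treePath x l))
          {x | ∀ v, ‖fun p => x (v, p)‖ = 1} := by
        refine hΨ.comp h1.continuousOn fun x hx i => ?_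
        rw [← hx (treeNode i l)]
        rcases Int.units_eq_one_or (branchSign (l i)) with h | h
        · have : treePath x l i = fun p => x (treeNode i l, p) := by
            ext p; simp [treePath, h]
          rw [this]
        · have : treePath x l i = -fun p => x (treeNode i l, p) := by
            ext p; simp [treePath, h, Units.neg_smul]
          rw [this, norm_neg]
      exact (continuousOn_pi.1 h2 q.2).const_smul _)
    (by
      intro x _ g
      ext ⟨v, p⟩
      simp only [SignedAction.act_apply, SignedAction.prod_sign, SignedAction.prod_perm,
        treePath_act]
      have hv : ∀ l, treeNode v.1 l = v ↔
          treeNode v.1 (g⁻¹.1 l) = (treeAction N).perm g v := by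
        intro l
        have : (treeAction N).perm g v = treeNode v.1 (g⁻¹.1 (someLeaf v)) := rfl
        rw [this, treeAut.treeNode_eq_iff g⁻¹, treeNode_someLeaf]
      have hv1 : ((treeAction N).perm g v).1 = v.1 := rfl
      rw [smul_sum]
      simp only [hv1]
      refine sum_bij (fun l _ => g⁻¹.1 l) ?_ (fun _ _ _ _ h => (g⁻¹.1).injective h) ?_ ?_
      · intro l hl
        rw [mem_filter] at hl ⊢
        exact ⟨mem_univ _, (hv l).1 hl.2⟩
      · intro l hl
        rw [mem_filter] at hl
        refine ⟨g.1 l, ?_, by simp⟩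
        rw [mem_filter, hv]
        simpa using hl.2
      · intro l hl
        rw [mem_filter] at hl
        have h1 := treeAction_sign g v.1 l
        rw [hl.2] at h1
        rw [h1, smul_smul, mul_assoc, Int.units_mul_self, mul_one])
  refine ⟨x, hx, fun l l' => funext fun p => ?_⟩
  exact eq_of_forall_sum_treeNode_eq_zero (fun l => Ψ (treePath x l) p)
    (fun v => congrFun hF (v, p)) l l'

end Tree

end BorsukUlam

section CubeWaist

open Finset MeasureTheory

section PrekopaLeindler

lemma volume_add_le_of_isCompact {P Q C : Set ℝ} (hP : IsCompact P) (hQ : IsCompact Q)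
    (hPn : P.Nonempty) (hQn : Q.Nonempty) (hC : ∀ x ∈ P, ∀ y ∈ Q, x + y ∈ C) :
    volume P + volume Q ≤ volume C := by
  obtain ⟨p, hp, hpmax⟩ := hP.exists_isMaxOn hPn continuousOn_id
  obtain ⟨q, hq, hqmin⟩ := hQ.exists_isMinOn hQn continuousOn_id
  have h1 : volume ((fun x => x + q) '' P) = volume P := by
    rw [Set.image_add_right]; exact measure_preimage_add_right _ _ _
  have h2 : volume ((fun y => p + y) '' Q) = volume Q := by
    rw [Set.image_add_left]; exact measure_preimage_add _ _ _
  rw [← h1, ← h2, ← measure_union₀]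
  · refine measure_mono ?_
    rintro _ (⟨x, hx, rfl⟩ | ⟨y, hy, rfl⟩)
    · exact hC x hx q hq
    · exact hC p hp y hy
  · exact ((hQ.image (by fun_prop)).measurableSet).nullMeasurableSet
  · refine measure_mono_null (t := {p + q}) ?_ (by simp)
    rintro _ ⟨⟨x, hx, rfl⟩, ⟨y, hy, hxy⟩⟩
    have hx' : x ≤ p := hpmax hx
    have hy' : q ≤ y := hqmin hy
    simp only [Set.mem_singleton_iff] at *
    linarith

lemma volume_add_le_of_measurableSet {A B C : Set ℝ} (hA : MeasurableSet A) (hB : MeasurableSet B)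
    (hAn : A.Nonempty) (hBn : B.Nonempty) (hC : ∀ x ∈ A, ∀ y ∈ B, x + y ∈ C) :
    volume A + volume B ≤ volume C := by
  have key : ∀ P ⊆ A, IsCompact P → ∀ Q ⊆ B, IsCompact Q → volume P + volume Q ≤ volume C := by
    intro P hPA hP Q hQB hQ
    obtain ⟨x, hx⟩ := hAn
    obtain ⟨y, hy⟩ := hBn
    refine (add_le_add (measure_mono (Set.subset_insert x P))
      (measure_mono (Set.subset_insert y Q))).trans ?_
    refine volume_add_le_of_isCompact (hP.insert x) (hQ.insert y) (Set.insert_nonempty _ _)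
      (Set.insert_nonempty _ _) fun x' hx' y' hy' => hC _ ?_ _ ?_
    · rcases hx' with rfl | h
      exacts [hx, hPA h]
    · rcases hy' with rfl | h
      exacts [hy, hQB h]
  rw [hA.measure_eq_iSup_isCompact, hB.measure_eq_iSup_isCompact]
  simp only [iSup_and']
  exact ENNReal.biSup_add_biSup_le' ⟨∅, by simp⟩ ⟨∅, by simp⟩
    fun P hP Q hQ => key P hP.1 hP.2 Q hQ.1 hQ.2

lemma lintegral_eq_lintegral_ofReal_lt {f : ℝ → ℝ≥0∞} (hf : Measurable f) (h1 : ∀ x, f x ≠ ⊤) :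
    ∫⁻ x, f x = ∫⁻ t in Set.Ioi (0 : ℝ), volume {x | ENNReal.ofReal t < f x} := by
  have h := lintegral_eq_lintegral_meas_lt volume (f := fun x => (f x).toReal)
    (Eventually.of_forall fun x => ENNReal.toReal_nonneg) hf.ennreal_toReal.aemeasurable
  simp only [ENNReal.ofReal_toReal (h1 _)] at h
  rw [h]
  refine setLIntegral_congr_fun measurableSet_Ioi fun t ht => ?_
  congr 1
  ext x
  simp only [Set.mem_ofPred_eq]
  exact (ENNReal.ofReal_lt_iff_lt_toReal (le_of_lt ht) (h1 x)).symm

lemma lintegral_add_le_of_min_le {f g h : ℝ → ℝ≥0∞} (hf : Measurable f)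
    (hg : Measurable g) (hh : Measurable h) {α β : ℝ} (hα : 0 < α) (hβ : 0 < β)
    (hf1 : ∀ x, f x ≤ 1) (hg1 : ∀ x, g x ≤ 1) (hfs : ∀ s < 1, ∃ x, s < f x)
    (hgs : ∀ s < 1, ∃ x, s < g x) (H : ∀ x y, min (f x) (g y) ≤ h (α * x + β * y)) :
    ENNReal.ofReal α * (∫⁻ x, f x) + ENNReal.ofReal β * (∫⁻ x, g x) ≤ ∫⁻ x, h x := by
  have hm : Measurable fun x => min (h x) 1 := hh.min measurable_const
  refine le_trans ?_ (lintegral_mono fun x => min_le_left (h x) 1)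
  have hne : ∀ {u : ℝ → ℝ≥0∞}, (∀ x, u x ≤ 1) → ∀ x, u x ≠ ⊤ := fun hu x =>
    ne_top_of_le_ne_top ENNReal.one_ne_top (hu x)
  rw [lintegral_eq_lintegral_ofReal_lt hf (hne hf1), lintegral_eq_lintegral_ofReal_lt hg (hne hg1),
    lintegral_eq_lintegral_ofReal_lt hm (hne fun x => min_le_right _ _)]
  have hmeas : ∀ u : ℝ → ℝ≥0∞, Measurable fun t : ℝ => volume {x | ENNReal.ofReal t < u x} :=
    fun u => Antitone.measurable fun s t hst => measure_mono fun x hx =>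
      lt_of_le_of_lt (ENNReal.ofReal_le_ofReal hst) hx
  rw [← lintegral_const_mul _ (hmeas f), ← lintegral_const_mul _ (hmeas g),
    ← lintegral_add_left ((hmeas f).const_mul _)]
  refine setLIntegral_mono (hmeas _) fun t ht => ?_
  rcases le_or_gt 1 t with h1 | h1
  · have h2 : ∀ {u : ℝ → ℝ≥0∞}, (∀ x, u x ≤ 1) → {x | ENNReal.ofReal t < u x} = ∅ := by
      intro u hu
      ext x
      simp only [Set.mem_ofPred_eq, Set.mem_empty_iff_false, iff_false, not_lt]
      exact (hu x).trans (ENNReal.one_le_ofReal.2 h1)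
    rw [h2 hf1, h2 hg1]; simp
  have ht1 : ENNReal.ofReal t < 1 := ENNReal.ofReal_lt_one.2 h1
  have hscale : ∀ {γ : ℝ}, 0 < γ → ∀ A : Set ℝ,
      ENNReal.ofReal γ * volume A = volume ((fun x => γ * x) '' A) := by
    intro γ hγ A
    have := Measure.addHaar_smul volume γ A
    simp only [Module.finrank_self, pow_one, abs_of_pos hγ] at this
    rw [← this]; rfl
  have hms : ∀ {γ : ℝ}, 0 < γ → ∀ {A : Set ℝ}, MeasurableSet A →
      MeasurableSet ((fun x => γ * x) '' A) := fun hγ A hA =>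
    (Homeomorph.mulLeft₀ _ hγ.ne').measurableEmbedding.measurableSet_image.2 hA
  rw [hscale hα, hscale hβ]
  refine volume_add_le_of_measurableSet (hms hα (measurableSet_lt measurable_const hf))
    (hms hβ (measurableSet_lt measurable_const hg)) (Set.Nonempty.image _ (hfs _ ht1))
    (Set.Nonempty.image _ (hgs _ ht1)) ?_
  rintro _ ⟨x, hx, rfl⟩ _ ⟨y, hy, rfl⟩
  exact lt_min ((lt_min hx hy).trans_le (H x y)) ht1

lemma ENNReal.rpow_mul_rpow_le_add {α β : ℝ} (hα : 0 < α) (hβ : 0 < β) (hαβ : α + β = 1)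
    (x y : ℝ≥0∞) : x ^ α * y ^ β ≤ ENNReal.ofReal α * x + ENNReal.ofReal β * y := by
  rcases eq_or_ne x ⊤ with rfl | hx
  · rw [ENNReal.mul_top (by simpa using hα)]; simp
  rcases eq_or_ne y ⊤ with rfl | hy
  · rw [ENNReal.mul_top (a := ENNReal.ofReal β) (by simpa using hβ)]; simp
  have h := Real.geom_mean_le_arith_mean2_weighted hα.le hβ.le (ENNReal.toReal_nonneg (a := x))
    (ENNReal.toReal_nonneg (a := y)) hαβ
  have h2 := ENNReal.ofReal_le_ofReal h
  rwa [ENNReal.ofReal_mul (by positivity), ENNReal.ofReal_add (by positivity) (by positivity),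
    ENNReal.ofReal_mul hα.le, ENNReal.ofReal_mul hβ.le,
    ← ENNReal.ofReal_rpow_of_nonneg (by positivity) hα.le,
    ← ENNReal.ofReal_rpow_of_nonneg (by positivity) hβ.le, ENNReal.ofReal_toReal hx,
    ENNReal.ofReal_toReal hy] at h2

lemma ENNReal.min_le_rpow_mul_rpow {α β : ℝ} (hα : 0 < α) (hβ : 0 < β) (hαβ : α + β = 1)
    (x y : ℝ≥0∞) : min x y ≤ x ^ α * y ^ β := by
  calc min x y = min x y ^ α * min x y ^ β := by
        rw [← ENNReal.rpow_add_of_nonneg _ _ hα.le hβ.le, hαβ, ENNReal.rpow_one]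
    _ ≤ x ^ α * y ^ β := mul_le_mul' (ENNReal.rpow_le_rpow (min_le_left _ _) hα.le)
        (ENNReal.rpow_le_rpow (min_le_right _ _) hβ.le)

lemma rpow_lintegral_mul_le_of_bounded {f g h : ℝ → ℝ≥0∞} (hf : Measurable f)
    (hg : Measurable g) (hh : Measurable h) {α β : ℝ} (hα : 0 < α) (hβ : 0 < β) (hαβ : α + β = 1)
    {M : ℝ≥0∞} (hM : M ≠ ⊤) (hfM : ∀ x, f x ≤ M) (hgM : ∀ x, g x ≤ M)
    (H : ∀ x y, f x ^ α * g y ^ β ≤ h (α * x + β * y)) :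
    (∫⁻ x, f x) ^ α * (∫⁻ x, g x) ^ β ≤ ∫⁻ x, h x := by
  by_cases hf0 : ⨆ x, f x = 0
  · have : ∀ x, f x = 0 := by simpa using hf0
    simp [this, hα]
  by_cases hg0 : ⨆ x, g x = 0
  · have : ∀ x, g x = 0 := by simpa using hg0
    simp [this, hβ]
  set c := (⨆ x, f x)⁻¹ with hc
  set d := (⨆ x, g x)⁻¹ with hd
  have hft : ⨆ x, f x ≠ ⊤ := ne_top_of_le_ne_top hM (iSup_le hfM)
  have hgt : ⨆ x, g x ≠ ⊤ := ne_top_of_le_ne_top hM (iSup_le hgM)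
  have hc0 : c ≠ 0 := ENNReal.inv_ne_zero.2 hft
  have hd0 : d ≠ 0 := ENNReal.inv_ne_zero.2 hgt
  have hct : c ≠ ⊤ := ENNReal.inv_ne_top.2 hf0
  have hdt : d ≠ ⊤ := ENNReal.inv_ne_top.2 hg0
  have hsup : ∀ u : ℝ → ℝ≥0∞, ⨆ x, u x ≠ 0 → ⨆ x, u x ≠ ⊤ →
      ∀ s < 1, ∃ x, s < (⨆ x, u x)⁻¹ * u x := by
    intro u h0 ht s hs
    by_contra! hcon
    have h1 : ⨆ x, (⨆ x, u x)⁻¹ * u x ≤ s := iSup_le hcon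
    rw [← ENNReal.mul_iSup, ENNReal.inv_mul_cancel h0 ht] at h1
    exact absurd h1 (not_le.2 hs)
  have hle : ∀ u : ℝ → ℝ≥0∞, ∀ x, (⨆ x, u x)⁻¹ * u x ≤ 1 := fun u x =>
    (mul_le_mul' le_rfl (le_iSup u x)).trans (ENNReal.inv_mul_le_one _)
  set e := c ^ α * d ^ β with he
  have hmul : ∀ x y, (c * x) ^ α * (d * y) ^ β = e * (x ^ α * y ^ β) := by
    intro x y
    rw [ENNReal.mul_rpow_of_nonneg _ _ hα.le, ENNReal.mul_rpow_of_nonneg _ _ hβ.le, he]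
    ring
  have h1 := lintegral_add_le_of_min_le (hf.const_mul c) (hg.const_mul d) (hh.const_mul e) hα hβ
    (hle f) (hle g) (hsup f hf0 hft) (hsup g hg0 hgt) (fun x y =>
      (ENNReal.min_le_rpow_mul_rpow hα hβ hαβ _ _).trans (by
        rw [hmul]; exact mul_le_mul' le_rfl (H x y)))
  have h2 := (ENNReal.rpow_mul_rpow_le_add hα hβ hαβ _ _).trans h1
  rw [lintegral_const_mul _ hf, lintegral_const_mul _ hg, lintegral_const_mul _ hh, hmul] at h2
  have he0 : e ≠ 0 := mul_ne_zero (by simp [hc0, hct]) (by simp [hd0, hdt])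
  have het : e ≠ ⊤ := ENNReal.mul_ne_top (ENNReal.rpow_ne_top_of_nonneg hα.le hct)
    (ENNReal.rpow_ne_top_of_nonneg hβ.le hdt)
  exact (ENNReal.mul_le_mul_iff_right he0 het).1 h2

lemma rpow_lintegral_mul_le_real {f g h : ℝ → ℝ≥0∞} (hf : Measurable f)
    (hg : Measurable g) (hh : Measurable h) {α β : ℝ} (hα : 0 < α) (hβ : 0 < β) (hαβ : α + β = 1)
    (H : ∀ x y, f x ^ α * g y ^ β ≤ h (α * x + β * y)) :
    (∫⁻ x, f x) ^ α * (∫⁻ x, g x) ^ β ≤ ∫⁻ x, h x := by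
  by_cases hf0 : ∫⁻ x, f x = 0
  · simp [hf0, hα]
  by_cases hg0 : ∫⁻ x, g x = 0
  · simp [hg0, hβ]
  have htend : ∀ {u : ℝ → ℝ≥0∞}, Measurable u →
      Tendsto (fun N : ℕ => ∫⁻ x, min (u x) N) atTop (𝓝 (∫⁻ x, u x)) := by
    intro u hu
    refine lintegral_tendsto_of_tendsto_of_monotone
      (fun N => (hu.min measurable_const).aemeasurable) ?_ ?_
    · exact Eventually.of_forall fun x N M hNM => min_le_min le_rfl (by exact_mod_cast hNM)
    · refine Eventually.of_forall fun x => ?_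
      have := (tendsto_const_nhds (x := u x)).min ENNReal.tendsto_nat_nhds_top
      simpa using this
  have hlim : Tendsto (fun N : ℕ => (∫⁻ x, min (f x) N) ^ α * (∫⁻ x, min (g x) N) ^ β) atTop
      (𝓝 ((∫⁻ x, f x) ^ α * (∫⁻ x, g x) ^ β)) := by
    refine ENNReal.Tendsto.mul ((ENNReal.continuous_rpow_const.tendsto _).comp (htend hf)) ?_
      ((ENNReal.continuous_rpow_const.tendsto _).comp (htend hg)) ?_
    · left; simp [hf0, hα, not_lt.2 hα.le]
    · left; simp [hg0, hβ, not_lt.2 hβ.le]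
  refine le_of_tendsto' hlim fun N => ?_
  refine rpow_lintegral_mul_le_of_bounded (hf.min measurable_const) (hg.min measurable_const) hh
    hα hβ hαβ (ENNReal.natCast_ne_top N) (fun x => min_le_right _ _) (fun x => min_le_right _ _)
    fun x y => le_trans ?_ (H x y)
  exact mul_le_mul' (ENNReal.rpow_le_rpow (min_le_left _ _) hα.le)
    (ENNReal.rpow_le_rpow (min_le_left _ _) hβ.le)

/-- The Prékopa–Leindler inequality. -/
theorem prekopa_leindler {n : ℕ} {f g h : (Fin n → ℝ) → ℝ≥0∞} (hf : Measurable f)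
    (hg : Measurable g) (hh : Measurable h) {α β : ℝ} (hα : 0 < α) (hβ : 0 < β) (hαβ : α + β = 1)
    (H : ∀ x y, f x ^ α * g y ^ β ≤ h (α • x + β • y)) :
    (∫⁻ x, f x) ^ α * (∫⁻ x, g x) ^ β ≤ ∫⁻ x, h x := by
  induction n with
  | zero =>
    rw [Measure.volume_pi_eq_dirac 0]
    simp only [lintegral_dirac]
    convert H 0 0
  | succ n ih =>
    have hmp := volume_preserving_piFinSuccAbove (fun _ : Fin (n + 1) => ℝ) 0
    have hvolInt : ∀ {u : (Fin (n + 1) → ℝ) → ℝ≥0∞}, Measurable u →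
        ∫⁻ x, u x = ∫⁻ s : ℝ, ∫⁻ x : Fin n → ℝ, u (Fin.cons s x) := by
      intro u hu
      rw [← hmp.symm.lintegral_comp hu]
      rw [Measure.volume_eq_prod, lintegral_prod _ (by fun_prop)]
      simp [MeasurableEquiv.piFinSuccAbove, Fin.consEquiv]
    have hcons : Measurable fun p : ℝ × (Fin n → ℝ) => (Fin.cons p.1 p.2 : Fin (n + 1) → ℝ) := by
      fun_prop
    rw [hvolInt hf, hvolInt hg, hvolInt hh]
    refine rpow_lintegral_mul_le_real ((hf.comp hcons).lintegral_prod_right')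
      ((hg.comp hcons).lintegral_prod_right') ((hh.comp hcons).lintegral_prod_right') hα hβ hαβ
      fun s t => ?_
    refine ih (hf.comp (hcons.comp measurable_prodMk_left))
      (hg.comp (hcons.comp measurable_prodMk_left)) (hh.comp (hcons.comp measurable_prodMk_left))
      fun x y => ?_
    refine (H _ _).trans (le_of_eq ?_)
    congr 1
    ext j
    refine Fin.cases ?_ (fun j => ?_) j <;> simp

/-- The dimension free form of the Brunn–Minkowski inequality. -/
theorem min_volume_le {n : ℕ} {A B C : Set (Fin n → ℝ)} (hA : MeasurableSet A)
    (hB : MeasurableSet B) (hC : MeasurableSet C) {α β : ℝ} (hα : 0 < α) (hβ : 0 < β)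
    (hαβ : α + β = 1) (H : ∀ x ∈ A, ∀ y ∈ B, α • x + β • y ∈ C) :
    min (volume A) (volume B) ≤ volume C := by
  have h := prekopa_leindler (measurable_one.indicator hA) (measurable_one.indicator hB)
    (measurable_one.indicator hC) hα hβ hαβ (fun x y => by
      by_cases hx : x ∈ A
      · by_cases hy : y ∈ B
        · simp [hx, hy, H x hx y hy]
        · simp [hy, hβ]
      · simp [hx, hα])
  rw [lintegral_indicator_one hA, lintegral_indicator_one hB, lintegral_indicator_one hC] at h
  exact (ENNReal.min_le_rpow_mul_rpow hα hβ hαβ _ _).trans h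

end PrekopaLeindler

section Piece

variable {k n : ℕ}

lemma lintegral_volume_inter_closedBall {T : Set (Fin n → ℝ)} (hT : MeasurableSet T)
    {g : (Fin k → ℝ) → Fin n → ℝ} (hg : Measurable g) (δ : ℝ) :
    ∫⁻ s, volume (T ∩ Metric.closedBall (g s) δ) = ∫⁻ y in T, volume {s | ‖y - g s‖ ≤ δ} := by
  have hD : MeasurableSet {p : (Fin k → ℝ) × (Fin n → ℝ) | p.2 ∈ T ∧ ‖p.2 - g p.1‖ ≤ δ} :=
    (measurable_snd hT).inter
      (measurableSet_le (f := fun p : (Fin k → ℝ) × (Fin n → ℝ) => ‖p.2 - g p.1‖)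
        (by fun_prop) measurable_const)
  have h1 := Measure.prod_apply (μ := volume) (ν := volume) hD
  have h2 := Measure.prod_apply_symm (μ := volume) (ν := volume) hD
  rw [h1] at h2
  convert h2 using 1
  · refine lintegral_congr fun s => ?_
    congr 1
  · rw [← lintegral_indicator hT]
    refine lintegral_congr fun y => ?_
    by_cases hy : y ∈ T
    · simp [hy]
    · simp [hy]

lemma volume_norm_sub_le_le (B : (Fin k → ℝ) →ₗ[ℝ] (Fin n → ℝ)) (w : Fin n → ℝ) (δ : ℝ) :
    volume {s | ‖w - B s‖ ≤ δ} ≤ volume {s | ‖B s‖ ≤ δ} := by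
  have hB : Continuous B := B.continuous_of_finiteDimensional
  have hm : ∀ w : Fin n → ℝ, MeasurableSet {s | ‖w - B s‖ ≤ δ} := fun w =>
    measurableSet_le (by fun_prop) measurable_const
  have hneg : volume {s | ‖-w - B s‖ ≤ δ} = volume {s | ‖w - B s‖ ≤ δ} := by
    rw [← Measure.measure_neg (μ := volume) {s | ‖w - B s‖ ≤ δ}]
    congr 1
    ext s
    simp only [Set.mem_ofPred_eq, Set.mem_neg, map_neg]
    rw [← norm_neg]
    congr! 2
    abel
  have h := min_volume_le (hm w) (hm (-w)) (C := {s | ‖B s‖ ≤ δ})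
    (measurableSet_le (by fun_prop) measurable_const) (α := 1 / 2) (β := 1 / 2) (by norm_num)
    (by norm_num) (by norm_num) (by
      intro x hx y hy
      simp only [Set.mem_ofPred_eq] at *
      have : B ((1 / 2 : ℝ) • x + (1 / 2 : ℝ) • y)
          = (1 / 2 : ℝ) • (-((w - B x) + (-w - B y))) := by
        simp only [map_add, map_smul]
        module
      rw [this, norm_smul, norm_neg]
      have := norm_add_le (w - B x) (-w - B y)
      norm_num
      linarith)
  rwa [hneg, min_self] at h

lemma min_volume_inter_closedBall_le {P : Set (Fin n → ℝ)} (hPm : MeasurableSet P)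
    (hPc : Convex ℝ P) {δ α β : ℝ} (hα : 0 < α) (hβ : 0 < β) (hαβ : α + β = 1)
    (c x : Fin n → ℝ) :
    min (volume (P ∩ Metric.closedBall c δ)) (volume (P ∩ Metric.closedBall x δ)) ≤
      volume (P ∩ Metric.closedBall (α • c + β • x) δ) := by
  have hm : ∀ x, MeasurableSet (P ∩ Metric.closedBall x δ) := fun x =>
    hPm.inter Metric.isClosed_closedBall.measurableSet
  refine min_volume_le (hm c) (hm x) (hm _) hα hβ hαβ ?_
  rintro y ⟨hy, hyc⟩ z ⟨hz, hzx⟩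
  refine ⟨hPc hy hz hα.le hβ.le hαβ, ?_⟩
  rw [Metric.mem_closedBall, dist_eq_norm] at *
  have : α • y + β • z - (α • c + β • x) = α • (y - c) + β • (z - x) := by module
  rw [this]
  refine (norm_add_le _ _).trans ?_
  rw [norm_smul, norm_smul, Real.norm_of_nonneg hα.le, Real.norm_of_nonneg hβ.le]
  calc α * ‖y - c‖ + β * ‖z - x‖ ≤ α * δ + β * δ := by gcongr
    _ = δ := by rw [← add_mul, hαβ, one_mul]

lemma norm_sub_le_one_of_mem_Icc {y z : Fin n → ℝ} (hy : y ∈ Set.Icc (0 : Fin n → ℝ) 1)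
    (hz : z ∈ Set.Icc (0 : Fin n → ℝ) 1) : ‖y - z‖ ≤ 1 := by
  refine (pi_norm_le_iff_of_nonneg zero_le_one).2 fun i => ?_
  have h1 := hy.1 i
  have h2 := hy.2 i
  have h3 := hz.1 i
  have h4 := hz.2 i
  simp only [Pi.zero_apply, Pi.one_apply] at *
  rw [Pi.sub_apply, Real.norm_eq_abs, abs_le]
  constructor <;> linarith

lemma le_volume_inter_closedBall_of_flat {P : Set (Fin n → ℝ)} (hPm : MeasurableSet P)
    (hPc : Convex ℝ P) (hPI : P ⊆ Set.Icc 0 1) {δ η θ ρ : ℝ} (hη : 0 < η) (hηδ : η < δ)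
    (hθ1 : θ ≤ 1) (hρ : 0 < ρ) (hρ1 : ρ < 1) {c x₀ : Fin n → ℝ}
    (hc : ∀ x, ENNReal.ofReal θ * volume (P ∩ Metric.closedBall x δ) ≤
      volume (P ∩ Metric.closedBall c δ))
    (hc0 : volume (P ∩ Metric.closedBall c δ) ≠ 0)
    {A : (Fin k → ℝ) →ₗ[ℝ] (Fin n → ℝ)} (hA : Function.Injective A)
    (hPA : ∀ y ∈ P, ∃ s, ‖y - x₀ - A s‖ ≤ η) :
    ENNReal.ofReal θ * ENNReal.ofReal ((ρ * ((δ - η) / δ)) ^ k) * volume P ≤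
      volume (P ∩ Metric.closedBall c (ρ * (1 + 2 * δ) + δ)) := by
  have hδ : 0 < δ := hη.trans hηδ
  have hδη : 0 < δ - η := sub_pos.2 hηδ
  set R := ρ * (1 + 2 * δ) + δ with hR
  set P' := P ∩ Metric.closedBall c R with hP'
  have hP'm : MeasurableSet P' := hPm.inter Metric.isClosed_closedBall.measurableSet
  have hAc : Continuous A := A.continuous_of_finiteDimensional
  have step1 : ∀ x, ENNReal.ofReal θ * volume (P ∩ Metric.closedBall x δ) ≤
      volume (P' ∩ Metric.closedBall ((1 - ρ) • c + ρ • x) δ) := by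
    intro x
    by_cases hx0 : volume (P ∩ Metric.closedBall x δ) = 0
    · simp [hx0]
    obtain ⟨y, hyP, hy⟩ := nonempty_of_measure_ne_zero hx0
    obtain ⟨z, hzP, hz⟩ := nonempty_of_measure_ne_zero hc0
    have hxc : ‖x - c‖ ≤ 1 + 2 * δ := by
      have h1 := norm_sub_le_one_of_mem_Icc (hPI hyP) (hPI hzP)
      rw [Metric.mem_closedBall, dist_eq_norm] at hy hz
      rw [norm_sub_rev] at hy
      have : x - c = (x - y) + (y - z) + (z - c) := by abel
      rw [this]
      have h2 := norm_add₃_le (a := x - y) (b := y - z) (c := z - c)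
      linarith
    have h1 := min_volume_inter_closedBall_le hPm hPc (δ := δ) (sub_pos.2 hρ1) hρ (by ring) c x
    have h2 : ENNReal.ofReal θ * volume (P ∩ Metric.closedBall x δ) ≤
        volume (P ∩ Metric.closedBall x δ) := by
      calc _ ≤ 1 * volume (P ∩ Metric.closedBall x δ) := by
            gcongr; exact ENNReal.ofReal_le_one.2 hθ1
        _ = _ := one_mul _
    refine ((le_min (hc x) h2).trans h1).trans (measure_mono ?_)
    rintro u ⟨huP, hu⟩
    refine ⟨⟨huP, ?_⟩, hu⟩
    rw [Metric.mem_closedBall, dist_eq_norm] at *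
    have : u - c = ρ • (x - c) + (u - ((1 - ρ) • c + ρ • x)) := by module
    rw [this]
    refine (norm_add_le _ _).trans ?_
    rw [norm_smul, Real.norm_of_nonneg hρ.le, hR]
    gcongr
  set L := volume {s | ‖A s‖ ≤ δ - η} with hL
  have hL0 : L ≠ 0 := by
    have ho : IsOpen {s | ‖A s‖ < δ - η} := isOpen_lt (by fun_prop) continuous_const
    have := ho.measure_pos volume ⟨0, by simpa using hδη⟩
    exact (this.trans_le (measure_mono fun s (hs : ‖A s‖ < δ - η) => hs.le)).ne'
  have hLt : L ≠ ⊤ := by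
    obtain ⟨K, -, hK⟩ := A.injective_iff_antilipschitz.1 hA
    have hb : Bornology.IsBounded (A ⁻¹' Metric.closedBall 0 (δ - η)) :=
      hK.isBounded_preimage Metric.isBounded_closedBall
    have : {s | ‖A s‖ ≤ δ - η} = A ⁻¹' Metric.closedBall 0 (δ - η) := by
      ext s; simp
    rw [hL, this]
    exact hb.measure_lt_top.ne
  have hlow : L * volume P ≤ ∫⁻ s, volume (P ∩ Metric.closedBall (x₀ + A s) δ) := by
    rw [lintegral_volume_inter_closedBall hPm (by fun_prop), ← setLIntegral_const]
    refine setLIntegral_mono' hPm fun y hy => ?_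
    obtain ⟨s₀, hs₀⟩ := hPA y hy
    rw [hL, ← measure_preimage_add_right volume (-s₀)]
    refine measure_mono fun s hs => ?_
    simp only [Set.mem_ofPred_eq, Set.mem_preimage, ← sub_eq_add_neg, map_sub] at *
    have : y - (x₀ + A s) = (y - x₀ - A s₀) - (A s - A s₀) := by abel
    rw [this]
    refine (norm_sub_le _ _).trans ?_
    linarith
  set q := ρ * ((δ - η) / δ) with hq
  have hq0 : 0 < q := by positivity
  have hup : ∫⁻ s, volume (P' ∩ Metric.closedBall ((1 - ρ) • c + ρ • (x₀ + A s)) δ) ≤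
      ENNReal.ofReal (q ^ k)⁻¹ * L * volume P' := by
    rw [lintegral_volume_inter_closedBall hP'm (by fun_prop), ← setLIntegral_const]
    refine setLIntegral_mono' hP'm fun y hy => ?_
    have h1 := volume_norm_sub_le_le (ρ • A) (y - (1 - ρ) • c - ρ • x₀) δ
    have h2 : {s | ‖(ρ • A) s‖ ≤ δ} = (fun s => q • s) ⁻¹' {s | ‖A s‖ ≤ δ - η} := by
      ext s
      simp only [Set.mem_ofPred_eq, Set.mem_preimage, map_smul, LinearMap.smul_apply, norm_smul,
        Real.norm_of_nonneg hρ.le, Real.norm_of_nonneg hq0.le]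
      have : q * ‖A s‖ = (ρ * ‖A s‖) * (δ - η) / δ := by rw [hq]; ring
      rw [this, div_le_iff₀ hδ, mul_comm (δ - η) δ, mul_le_mul_iff_left₀ hδη]
    rw [h2, Measure.addHaar_preimage_smul _ hq0.ne', Module.finrank_fin_fun,
      abs_of_pos (by positivity)] at h1
    refine le_trans (le_of_eq ?_) h1
    congr! 5
    simp only [LinearMap.smul_apply]
    module
  have hmain : ENNReal.ofReal θ * (L * volume P) ≤ ENNReal.ofReal (q ^ k)⁻¹ * L * volume P' := by
    refine (mul_le_mul' le_rfl hlow).trans (le_trans ?_ hup)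
    rw [← lintegral_const_mul' _ _ ENNReal.ofReal_ne_top]
    exact lintegral_mono fun s => step1 _
  have hqk : ENNReal.ofReal (q ^ k) * ENNReal.ofReal (q ^ k)⁻¹ = 1 := by
    rw [← ENNReal.ofReal_mul (by positivity), mul_inv_cancel₀ (by positivity), ENNReal.ofReal_one]
  have hmain2 := mul_le_mul' (le_refl (ENNReal.ofReal (q ^ k))) hmain
  refine (ENNReal.mul_le_mul_iff_right hL0 hLt).1 ?_
  calc L * (ENNReal.ofReal θ * ENNReal.ofReal (q ^ k) * volume P)
      = ENNReal.ofReal (q ^ k) * (ENNReal.ofReal θ * (L * volume P)) := by ring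
    _ ≤ ENNReal.ofReal (q ^ k) * (ENNReal.ofReal (q ^ k)⁻¹ * L * volume P') := hmain2
    _ = ENNReal.ofReal (q ^ k) * ENNReal.ofReal (q ^ k)⁻¹ * (L * volume P') := by ring
    _ = L * volume P' := by rw [hqk, one_mul]

end Piece

section Flat

variable {n : ℕ}

lemma exists_and_not_succ {p : ℕ → Prop} (h0 : p 0) {m : ℕ} (hm : ¬ p (m + 1)) :
    ∃ k ≤ m, p k ∧ ¬ p (k + 1) := by
  by_contra! hcon
  have : ∀ k ≤ m + 1, p k := by
    intro k
    induction k with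
    | zero => exact fun _ => h0
    | succ k ih => exact fun hk => hcon k (by omega) (ih (by omega))
  exact hm (this _ le_rfl)

lemma abs_det_le_of_image_subset {d : ℕ} (hd : 0 < d) {P : Set (Fin n → ℝ)} (hPc : Convex ℝ P)
    {x₀ : Fin n → ℝ} (hx₀ : x₀ ∈ P) {J : Fin d → Fin n} {Q : Set (Fin d → ℝ)}
    (hQ : ∀ x ∈ P, x ∘ J ∈ Q) {ε : ℝ} (hQε : volume Q ≤ ENNReal.ofReal ε) (hε : 0 ≤ ε)
    {x : Fin d → Fin n → ℝ} (hx : ∀ a, x a ∈ P) :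
    |(Matrix.of fun a b => x a (J b) - x₀ (J b)).det| ≤ (d : ℝ) ^ d * ε := by
  have hd' : (0 : ℝ) < d := by exact_mod_cast hd
  set M : Matrix (Fin d) (Fin d) ℝ := Matrix.of fun a b => x a (J b) - x₀ (J b) with hM
  have h1 := Measure.addHaar_image_linearMap volume
    (Matrix.toLin' ((d : ℝ)⁻¹ • M.transpose)) (Set.Icc (0 : Fin d → ℝ) 1)
  rw [LinearMap.det_toLin', Matrix.det_smul, Matrix.det_transpose, Real.volume_Icc_pi] at h1
  simp only [Fintype.card_fin, Pi.one_apply, Pi.zero_apply, sub_zero, ENNReal.ofReal_one,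
    prod_const_one, mul_one] at h1
  have h2 : volume ((Matrix.toLin' ((d : ℝ)⁻¹ • M.transpose)) '' Set.Icc (0 : Fin d → ℝ) 1) ≤
      volume Q := by
    rw [← measure_preimage_add volume (x₀ ∘ J) Q]
    refine measure_mono ?_
    rintro _ ⟨s, hs, rfl⟩
    have hy : x₀ + ∑ a, (s a / d) • (x a - x₀) ∈ P := by
      have h := hPc.sum_mem (t := univ) (w := fun a : Option (Fin d) => a.elim
        (1 - ∑ a, s a / d) fun a => s a / d) (z := fun a => a.elim x₀ x) (by
          rintro (_ | a) -
          · have : ∑ a, s a / d ≤ ∑ a : Fin d, (1 : ℝ) / d :=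
              sum_le_sum fun a _ => div_le_div_of_nonneg_right (hs.2 a) hd'.le
            simp [hd'.ne'] at this
            simpa using this
          · exact div_nonneg (hs.1 a) hd'.le)
        (by simp [Fintype.sum_option]) (by rintro (_ | a) - ; exacts [hx₀, hx a])
      convert h using 1
      simp only [Fintype.sum_option, Option.elim, smul_sub, sum_sub_distrib, ← sum_smul]
      module
    have := hQ _ hy
    rw [Set.mem_preimage]
    convert this using 1
    ext b
    simp only [Pi.add_apply, Function.comp, Matrix.toLin'_apply, Matrix.smul_mulVec,
      Pi.smul_apply, Matrix.mulVec, dotProduct, Matrix.transpose_apply, hM, Matrix.of_apply,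
      smul_eq_mul, Finset.sum_apply, Pi.sub_apply, mul_sum]
    congr 1
    exact sum_congr rfl fun a _ => by ring
  rw [h1] at h2
  have h3 := (ENNReal.ofReal_le_ofReal_iff hε).1 (h2.trans hQε)
  rw [abs_mul, abs_of_pos (by positivity), inv_pow, inv_mul_le_iff₀ (by positivity)] at h3
  exact h3

/-- A convex set all of whose `(m + 1)`-dimensional coordinate projections are small is close to
an affine subspace of dimension at most `m`. -/
theorem exists_flat_of_volume_image_le {m : ℕ} {P : Set (Fin n → ℝ)} (hPc : Convex ℝ P)
    (hPn : P.Nonempty) {ε η : ℝ} (hε : 0 ≤ ε) (hη : 0 < η)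
    (hεη : ((m + 1 : ℕ) : ℝ) ^ (m + 1) * ε < η ^ (m + 1))
    (hP : ∀ J : Fin (m + 1) ↪ Fin n, ∃ Q : Set (Fin (m + 1) → ℝ),
      (∀ x ∈ P, x ∘ J ∈ Q) ∧ volume Q ≤ ENNReal.ofReal ε) :
    ∃ k ≤ m, ∃ x₀ : Fin n → ℝ, ∃ A : (Fin k → ℝ) →ₗ[ℝ] (Fin n → ℝ), Function.Injective A ∧
      ∀ y ∈ P, ∃ s, ‖y - x₀ - A s‖ ≤ η := by
  obtain ⟨x₀, hx₀⟩ := hPn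
  obtain ⟨k, hk, ⟨x, J, hx, hdet⟩, hk'⟩ := exists_and_not_succ (m := m)
    (p := fun k => ∃ (x : Fin k → Fin n → ℝ) (J : Fin k → Fin n), (∀ a, x a ∈ P) ∧
      η ^ k ≤ |(Matrix.of fun a b => x a (J b) - x₀ (J b)).det|)
    ⟨fun a => a.elim0, fun a => a.elim0, fun a => a.elim0, by simp⟩ (by
      rintro ⟨x, J, hx, hdet⟩
      by_cases hJ : Function.Injective J
      · obtain ⟨Q, hQ, hQε⟩ := hP ⟨J, hJ⟩
        have := abs_det_le_of_image_subset m.succ_pos hPc hx₀ hQ hQε hε hx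
        exact absurd (hdet.trans this) (not_le.2 hεη)
      · rw [Function.Injective] at hJ
        push Not at hJ
        obtain ⟨a, b, hab, hne⟩ := hJ
        rw [Matrix.det_zero_of_column_eq hne (by intro i; simp [hab]), abs_zero] at hdet
        exact absurd hdet (not_le.2 (by positivity)))
  push Not at hk'
  set M : Matrix (Fin k) (Fin k) ℝ := Matrix.of fun a b => x a (J b) - x₀ (J b) with hM
  have hη0 : 0 < η ^ k := by positivity
  have hM0 : M.det ≠ 0 := abs_pos.1 (hη0.trans_le hdet)
  have hMu : IsUnit M.det := isUnit_iff_ne_zero.2 hM0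
  let V : Matrix (Fin k) (Fin n) ℝ := Matrix.of fun a i => x a i - x₀ i
  refine ⟨k, hk, x₀, V.vecMulLinear, ?_, fun y hy => ?_⟩
  · rw [← LinearMap.ker_eq_bot, LinearMap.ker_eq_bot']
    intro s hs
    have h0 : Matrix.vecMul s M = 0 := by
      ext b
      have := congrFun hs (J b)
      simpa [Matrix.vecMul, dotProduct, V, hM] using this
    exact Matrix.eq_zero_of_vecMul_eq_zero hM0 h0
  · have _ := M.invertibleOfIsUnitDet hMu
    let u : Fin k → ℝ := fun b => y (J b) - x₀ (J b)
    refine ⟨Matrix.vecMul u M⁻¹, (pi_norm_le_iff_of_nonneg hη.le).2 fun i => ?_⟩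
    have hlt := hk' (Fin.snoc x y) (Fin.snoc J i) (fun a => by
      refine Fin.lastCases ?_ (fun a => ?_) a
      · simpa using hy
      · simpa using hx a)
    have hblock : (Matrix.of fun a b => (Fin.snoc x y : Fin (k + 1) → Fin n → ℝ) a
          ((Fin.snoc J i : Fin (k + 1) → Fin n) b) -
          x₀ ((Fin.snoc J i : Fin (k + 1) → Fin n) b)).submatrix
        (finSumFinEquiv (m := k) (n := 1)) (finSumFinEquiv (m := k) (n := 1)) =
        Matrix.fromBlocks M (Matrix.of fun a _ => x a i - x₀ i) (Matrix.of fun _ b => u b)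
          (Matrix.of fun _ _ => y i - x₀ i) := by
      have hr : ∀ c : Fin 1, (Fin.natAdd k c : Fin (k + 1)) = Fin.last k := by
        intro c
        ext
        simp
      have hl : ∀ a : Fin k, (Fin.castAdd 1 a : Fin (k + 1)) = a.castSucc := fun _ => rfl
      ext a b
      rcases a with a | a <;> rcases b with b | b <;>
        simp [hr, hl, hM, u, -Fin.natAdd_eq_addNat, -Fin.castSucc_natAdd]
    rw [← Matrix.det_submatrix_equiv_self (finSumFinEquiv (m := k) (n := 1)), hblock,
      Matrix.det_fromBlocks₁₁, abs_mul, Matrix.det_unique (n := Fin 1),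
      Matrix.invOf_eq_nonsing_inv] at hlt
    have hent : ((Matrix.of fun _ _ => y i - x₀ i : Matrix (Fin 1) (Fin 1) ℝ) -
        (Matrix.of fun _ b => u b : Matrix (Fin 1) (Fin k) ℝ) * M⁻¹ *
          (Matrix.of fun a _ => x a i - x₀ i : Matrix (Fin k) (Fin 1) ℝ)) default default =
        (y - x₀ - V.vecMulLinear (Matrix.vecMul u M⁻¹)) i := by
      simp only [Matrix.sub_apply, Matrix.mul_apply, Matrix.of_apply, Pi.sub_apply,
        Matrix.vecMulLinear_apply, Matrix.vecMul, dotProduct, V]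
    rw [hent] at hlt
    have h1 := (mul_le_mul_of_nonneg_right hdet (abs_nonneg
      ((y - x₀ - V.vecMulLinear (Matrix.vecMul u M⁻¹)) i))).trans hlt.le
    rw [pow_succ] at h1
    exact (mul_le_mul_iff_right₀ hη0).1 h1

end Flat

section TreeCount

variable {N : ℕ}

lemma exists_leaf (σ : TreeNode N → Bool) : ∃ l : Fin N → Bool, ∀ i, l i = σ (treeNode i l) := by
  have key : ∀ k ≤ N, ∃ l : Fin N → Bool, ∀ i : Fin N, (i : ℕ) < k → l i = σ (treeNode i l) := by
    intro k
    induction k with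
    | zero => exact fun _ => ⟨fun _ => true, fun i hi => absurd hi (Nat.not_lt_zero _)⟩
    | succ k ih =>
      intro hk
      obtain ⟨l, hl⟩ := ih (by omega)
      let K : Fin N := ⟨k, by omega⟩
      refine ⟨Function.update l K (σ (treeNode K l)), fun i hi => ?_⟩
      have hnode : treeNode i (Function.update l K (σ (treeNode K l))) = treeNode i l := by
        rw [treeNode_eq_iff]
        intro j hj
        refine Function.update_of_ne (fun h => ?_) _ _
        have : (j : ℕ) = k := congrArg Fin.val h
        have := Fin.lt_def.1 hj
        omega
      rw [hnode]
      by_cases hik : i = K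
      · subst hik
        rw [Function.update_self]
      · rw [Function.update_of_ne hik]
        refine hl i ?_
        have : (i : ℕ) ≠ k := fun h => hik (Fin.ext h)
        omega
  obtain ⟨l, hl⟩ := key N le_rfl
  exact ⟨l, fun i => hl i i.2⟩

lemma card_filter_leaf_le (σ : TreeNode N → Bool) (S : Finset (Fin N)) :
    (univ.filter fun l : Fin N → Bool => ∀ i ∈ S, l i = σ (treeNode i l)).card ≤
      2 ^ (N - S.card) := by
  have hinj : Set.InjOn (fun (l : Fin N → Bool) (i : (Sᶜ : Finset (Fin N))) => l i)
      (univ.filter fun l : Fin N → Bool => ∀ i ∈ S, l i = σ (treeNode i l)) := by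
    intro l hl l' hl' h
    simp only [coe_filter, mem_univ, true_and, Set.mem_ofPred_eq] at hl hl'
    have : ∀ k : ℕ, ∀ i : Fin N, (i : ℕ) = k → l i = l' i := by
      intro k
      induction k using Nat.strong_induction_on with
      | _ k ih =>
        intro i hi
        by_cases hiS : i ∈ S
        · rw [hl i hiS, hl' i hiS]
          congr 1
          rw [treeNode_eq_iff]
          exact fun j hj => ih j (hi ▸ Fin.lt_def.1 hj) j rfl
        · exact congrFun h ⟨i, mem_compl.2 hiS⟩
    exact funext fun i => this i i rfl
  have h := card_le_card_of_injOn (t := univ) _ (fun _ _ => mem_univ _) hinj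
  refine h.trans (le_of_eq ?_)
  simp

lemma exists_leaf_nonneg (a : TreeNode N → ℝ) :
    ∃ l : Fin N → Bool, ∀ i, 0 ≤ branchSign (l i) • a (treeNode i l) := by
  obtain ⟨l, hl⟩ := exists_leaf fun v => decide (a v < 0)
  refine ⟨l, fun i => ?_⟩
  rw [hl i]
  by_cases h : a (treeNode i l) < 0
  · rw [decide_eq_true h]
    simpa [branchSign, Units.neg_smul] using h.le
  · rw [decide_eq_false h]
    simpa [branchSign] using h

lemma card_filter_leaf_nonneg_le (a : TreeNode N → ℝ) (S : Finset (Fin N))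
    (ha : ∀ v : TreeNode N, a v ≠ 0) :
    (univ.filter fun l : Fin N → Bool =>
      ∀ i ∈ S, 0 ≤ branchSign (l i) • a (treeNode i l)).card ≤ 2 ^ (N - S.card) := by
  refine (card_le_card fun l hl => ?_).trans
    (card_filter_leaf_le (fun v => decide (a v < 0)) S)
  rw [mem_filter] at hl ⊢
  refine ⟨mem_univ _, fun i hi => ?_⟩
  have h := hl.2 i hi
  cases hli : l i
  · rw [hli] at h
    simpa [branchSign] using h
  · rw [hli] at h
    simp only [branchSign, if_true, Units.neg_smul, one_smul,
      Left.nonneg_neg_iff] at h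
    simpa using lt_of_le_of_ne h (ha _)

lemma sum_measure_leaf_le {Y : Type*} [MeasurableSpace Y] (ν : Measure Y)
    {a : TreeNode N → Y → ℝ} (ha : ∀ v, Measurable (a v)) (ha0 : ∀ v, ∀ᵐ y ∂ν, a v y ≠ 0)
    (S : Finset (Fin N)) {T : Set Y} (hT : MeasurableSet T) :
    ∑ l : Fin N → Bool, ν {y ∈ T | ∀ i ∈ S, 0 ≤ branchSign (l i) • a (treeNode i l) y} ≤
      2 ^ (N - S.card) * ν T := by
  have hm : ∀ l : Fin N → Bool,
      MeasurableSet {y ∈ T | ∀ i ∈ S, 0 ≤ branchSign (l i) • a (treeNode i l) y} := by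
    intro l
    have : {y ∈ T | ∀ i ∈ S, 0 ≤ branchSign (l i) • a (treeNode i l) y} =
        T ∩ ⋂ i ∈ S, {y | 0 ≤ branchSign (l i) • a (treeNode i l) y} := by
      ext y; simp
    rw [this]
    refine hT.inter ?_
    refine Finset.measurableSet_biInter _ fun i _ => measurableSet_le measurable_const ?_
    exact (ha _).const_smul _
  simp only [← lintegral_indicator_one (hm _)]
  rw [← lintegral_finsetSum _ fun l _ => measurable_one.indicator (hm l),
    ← setLIntegral_const, ← lintegral_indicator hT]
  refine lintegral_mono_ae ?_
  filter_upwards [ae_all_iff.2 ha0] with y hy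
  classical
  by_cases hyT : y ∈ T
  · simp only [Set.indicator_apply, Set.mem_ofPred_eq, hyT, true_and, Pi.one_apply, if_true]
    rw [Finset.sum_boole]
    exact_mod_cast card_filter_leaf_nonneg_le (fun v => a v y) S hy
  · simp [hyT]

end TreeCount

section Region

variable {m n N : ℕ}

/-- The affine form with linear coefficients `w 0, …, w m` in the coordinates `J 0, …, J m` and
constant coefficient `w (m + 1)`. -/
noncomputable def affForm (J : Fin (m + 1) → Fin n) (w : Fin (m + 2) → ℝ) (x : Fin n → ℝ) : ℝ :=
  ∑ j, w j.castSucc * x (J j) + w (Fin.last _)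

lemma continuous_affForm (J : Fin (m + 1) → Fin n) :
    Continuous fun p : (Fin (m + 2) → ℝ) × (Fin n → ℝ) => affForm J p.1 p.2 := by
  unfold affForm
  fun_prop

lemma affForm_units_smul (J : Fin (m + 1) → Fin n) (ε : ℤˣ) (w : Fin (m + 2) → ℝ)
    (x : Fin n → ℝ) : affForm J (fun p => ε • w p) x = ε • affForm J w x := by
  rcases Int.units_eq_one_or ε with rfl | rfl
  · simp
  · simp only [affForm, Units.neg_smul, one_smul, neg_add, neg_mul, sum_neg_distrib]

lemma affForm_combo (J : Fin (m + 1) → Fin n) (w : Fin (m + 2) → ℝ) (x y : Fin n → ℝ) {α β : ℝ}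
    (h : α + β = 1) :
    affForm J w (α • x + β • y) = α * affForm J w x + β * affForm J w y := by
  simp only [affForm, Pi.add_apply, Pi.smul_apply, smul_eq_mul, mul_add, sum_add_distrib, mul_sum]
  have h1 : ∀ u : Fin n → ℝ, ∀ γ : ℝ, ∑ j : Fin (m + 1), w j.castSucc * (γ * u (J j)) =
      ∑ j : Fin (m + 1), γ * (w j.castSucc * u (J j)) := fun u γ =>
    sum_congr rfl fun j _ => by ring
  rw [h1, h1]
  linear_combination -w (Fin.last _) * h

lemma volume_affForm_eq_zero {J : Fin (m + 1) → Fin n} (hJ : Function.Injective J)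
    {w : Fin (m + 2) → ℝ} (hw : w ≠ 0) : volume {x | affForm J w x = 0} = 0 := by
  rcases Set.eq_empty_or_nonempty {x | affForm J w x = 0} with h | ⟨x₀, hx₀⟩
  · rw [h, measure_empty]
  let L : (Fin n → ℝ) →ₗ[ℝ] ℝ := ∑ j, w j.castSucc • LinearMap.proj (J j)
  have hL : ∀ x, affForm J w x = L x + w (Fin.last _) := by
    intro x
    simp [affForm, L]
  have hx₀' : L x₀ + w (Fin.last _) = 0 := by rw [← hL]; exact hx₀
  have hset : {x | affForm J w x = 0} = (AffineSubspace.mk' x₀ L.ker : Set (Fin n → ℝ)) := by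
    ext x
    simp only [Set.mem_ofPred_eq, SetLike.mem_coe, AffineSubspace.mem_mk', vsub_eq_sub,
      LinearMap.mem_ker, map_sub, hL]
    constructor <;> intro h <;> linarith
  rw [hset]
  refine Measure.addHaar_affineSubspace _ _ fun htop => hw ?_
  have hall : ∀ x, affForm J w x = 0 := by
    intro x
    have : x ∈ {x | affForm J w x = 0} := by rw [hset, htop]; trivial
    exact this
  have h0 : w (Fin.last _) = 0 := by simpa [affForm] using hall 0
  ext i
  refine Fin.lastCases h0 (fun j => ?_) i
  have := hall (Pi.single (J j) 1)
  simpa [affForm, Pi.single_apply, hJ.eq_iff, h0] using this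

/-- The part of the unit cube where all the affine forms with coefficients `w i` are
nonnegative. -/
def region (J : Fin N → Fin (m + 1) ↪ Fin n) (w : Fin N → Fin (m + 2) → ℝ) : Set (Fin n → ℝ) :=
  {x ∈ Set.Icc 0 1 | ∀ i, 0 ≤ affForm (J i) (w i) x}

variable (J : Fin N → Fin (m + 1) ↪ Fin n)

lemma measurableSet_region (w : Fin N → Fin (m + 2) → ℝ) : MeasurableSet (region J w) := by
  have : region J w = Set.Icc 0 1 ∩ ⋂ i, {x | 0 ≤ affForm (J i) (w i) x} := by
    ext x; simp [region]
  rw [this]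
  refine measurableSet_Icc.inter (MeasurableSet.iInter fun i => ?_)
  exact measurableSet_le measurable_const ((continuous_affForm (J i)).comp
    (Continuous.prodMk_right (w i))).measurable

lemma region_subset (w : Fin N → Fin (m + 2) → ℝ) : region J w ⊆ Set.Icc 0 1 := fun _ h => h.1

lemma convex_region (w : Fin N → Fin (m + 2) → ℝ) : Convex ℝ (region J w) := by
  rintro x ⟨hx, hx'⟩ y ⟨hy, hy'⟩ α β hα hβ hαβ
  refine ⟨convex_Icc _ _ hx hy hα hβ hαβ, fun i => ?_⟩
  rw [affForm_combo _ _ _ _ hαβ]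
  exact add_nonneg (mul_nonneg hα (hx' i)) (mul_nonneg hβ (hy' i))

lemma volume_unitCube : volume (Set.Icc (0 : Fin n → ℝ) 1) = 1 := by
  simp [Real.volume_Icc_pi]

lemma tendsto_volume_symmDiff_region {w : Fin N → Fin (m + 2) → ℝ} (hw : ∀ i, w i ≠ 0) :
    Tendsto (fun w' => volume (symmDiff (region J w) (region J w'))) (𝓝 w) (𝓝 0) := by
  rw [← measure_empty (μ := volume) (α := Fin n → ℝ)]
  refine tendsto_measure_of_ae_tendsto_indicator _ MeasurableSet.empty
    (fun w' => (measurableSet_region J w).symmDiff (measurableSet_region J w'))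
    (measurableSet_Icc (a := (0 : Fin n → ℝ)) (b := 1)) (by simp [volume_unitCube])
    (Eventually.of_forall fun w' => ?_) ?_
  · exact (Set.symmDiff_subset_union).trans
      (Set.union_subset (region_subset J w) (region_subset J w'))
  · have h0 : ∀ i, ∀ᵐ x : Fin n → ℝ, affForm (J i) (w i) x ≠ 0 := fun i => by
      rw [ae_iff]
      simpa using volume_affForm_eq_zero (J i).injective (hw i)
    filter_upwards [ae_all_iff.2 h0] with x hx
    have hsign : ∀ i, ∀ᶠ w' : Fin N → Fin (m + 2) → ℝ in 𝓝 w,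
        (0 ≤ affForm (J i) (w' i) x ↔ 0 ≤ affForm (J i) (w i) x) := by
      intro i
      have hc : Continuous fun w' : Fin N → Fin (m + 2) → ℝ => affForm (J i) (w' i) x :=
        (continuous_affForm (J i)).comp (f := fun w' : Fin N → Fin (m + 2) → ℝ => (w' i, x))
          ((continuous_apply i).prodMk continuous_const)
      rcases lt_or_gt_of_ne (hx i) with h | h
      · filter_upwards [hc.continuousAt.eventually_lt continuousAt_const h] with w' hw'
        exact iff_of_false (not_le.2 hw') (not_le.2 h)
      · filter_upwards [continuousAt_const.eventually_lt hc.continuousAt h] with w' hw'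
        exact iff_of_true hw'.le h.le
    filter_upwards [eventually_all.2 hsign] with w' hw'
    have : x ∈ region J w' ↔ x ∈ region J w := by
      simp only [region, Set.mem_ofPred_eq, hw']
    simp [Set.mem_symmDiff, this]

lemma measureReal_le_add_symmDiff {A B T : Set (Fin n → ℝ)} (hA : A ⊆ Set.Icc 0 1)
    (hB : B ⊆ Set.Icc 0 1) :
    volume.real (A ∩ T) ≤ volume.real (B ∩ T) + volume.real (symmDiff A B) := by
  have hfin : ∀ {U : Set (Fin n → ℝ)}, U ⊆ Set.Icc 0 1 → volume U ≠ ⊤ := fun hU =>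
    ne_top_of_le_ne_top (by simp [volume_unitCube]) (measure_mono hU)
  have hAB := Set.symmDiff_subset_union.trans (Set.union_subset hA hB)
  refine (measureReal_mono (s₂ := (B ∩ T) ∪ symmDiff A B) (fun x hx => ?_) (hfin
    (Set.union_subset (Set.inter_subset_left.trans hB) hAB))).trans
    (measureReal_union_le _ _)
  by_cases hxB : x ∈ B
  · exact Or.inl ⟨hxB, hx.2⟩
  · exact Or.inr (Or.inl ⟨hx.1, hxB⟩)

lemma exists_volume_inter_closedBall_pos {A : Set (Fin n → ℝ)} (hA : volume A ≠ 0) {δ : ℝ}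
    (hδ : 0 < δ) : ∃ z, volume (A ∩ Metric.closedBall z δ) ≠ 0 := by
  by_contra! hcon
  exact hA (measure_null_of_locally_null A fun x _ => ⟨A ∩ Metric.closedBall x δ,
    inter_mem_nhdsWithin _ (Metric.closedBall_mem_nhds x hδ), hcon x⟩)

/-- A convex body depending continuously on a parameter has a continuously varying point around
which it has almost maximal mass at a given scale. -/
theorem exists_continuous_center {X : Type*} [TopologicalSpace X] [NormalSpace X]
    [ParacompactSpace X] {B : X → Set (Fin n → ℝ)} (hBm : ∀ x, MeasurableSet (B x))
    (hBc : ∀ x, Convex ℝ (B x)) (hBI : ∀ x, B x ⊆ Set.Icc 0 1) (hB0 : ∀ x, volume (B x) ≠ 0)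
    (hB : ∀ x, Tendsto (fun y => volume (symmDiff (B x) (B y))) (𝓝 x) (𝓝 0))
    {δ θ : ℝ} (hδ : 0 < δ) (hθ : 0 ≤ θ) (hθ1 : θ < 1) :
    ∃ c : X → Fin n → ℝ, Continuous c ∧ ∀ x z, θ * volume.real (B x ∩ Metric.closedBall z δ) ≤
      volume.real (B x ∩ Metric.closedBall (c x) δ) := by
  have hfin : ∀ x T, volume (B x ∩ T) ≠ ⊤ := fun x T =>
    ne_top_of_le_ne_top (by simp [volume_unitCube])
      (measure_mono (Set.inter_subset_left.trans (hBI x)))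
  have hle1 : ∀ x T, volume.real (B x ∩ T) ≤ 1 := fun x T => by
    refine (measureReal_mono (Set.inter_subset_left.trans (hBI x))
      (by simp [volume_unitCube])).trans ?_
    simp [measureReal_def, volume_unitCube]
  obtain ⟨g, hg⟩ := exists_continuous_forall_mem_convex_of_local_const
    (t := fun x => {c | ∀ z, θ * volume.real (B x ∩ Metric.closedBall z δ) ≤
      volume.real (B x ∩ Metric.closedBall c δ)}) (fun x => by
      rw [convex_iff_forall_pos]
      intro c hc c' hc' α β hα hβ hαβ z
      have h := min_volume_inter_closedBall_le (hBm x) (hBc x) (δ := δ) hα hβ hαβ c c'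
      have h' := ENNReal.toReal_mono (hfin x _) h
      rw [ENNReal.toReal_min (hfin x _) (hfin x _)] at h'
      exact (le_min (hc z) (hc' z)).trans h') (fun x => by
      obtain ⟨z₀, hz₀⟩ := exists_volume_inter_closedBall_pos (hB0 x) hδ
      set S := ⨆ z, volume.real (B x ∩ Metric.closedBall z δ) with hS
      have hbdd : BddAbove (Set.range fun z => volume.real (B x ∩ Metric.closedBall z δ)) :=
        ⟨1, by rintro _ ⟨z, rfl⟩; exact hle1 x _⟩
      have hS0 : 0 < S := (ENNReal.toReal_pos hz₀ (hfin x _)).trans_le (le_ciSup hbdd z₀)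
      obtain ⟨c, hc⟩ := exists_lt_of_lt_ciSup (show (1 + θ) / 2 * S < S by nlinarith)
      refine ⟨c, ?_⟩
      have he : 0 < (1 - θ) * S / 4 := by
        have : 0 < 1 - θ := by linarith
        positivity
      filter_upwards [(hB x).eventually_lt_const (ENNReal.ofReal_pos.2 he)] with y hy z
      have hey : volume.real (symmDiff (B x) (B y)) ≤ (1 - θ) * S / 4 :=
        ENNReal.toReal_le_of_le_ofReal he.le hy.le
      have h1 := measureReal_le_add_symmDiff (T := Metric.closedBall c δ) (hBI x) (hBI y)
      have h2 := measureReal_le_add_symmDiff (T := Metric.closedBall z δ) (hBI y) (hBI x)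
      rw [symmDiff_comm] at h2
      have h3 : volume.real (B x ∩ Metric.closedBall z δ) ≤ S := le_ciSup hbdd z
      have h4 := mul_le_mul_of_nonneg_left (h2.trans (add_le_add h3 hey)) hθ
      nlinarith)
  exact ⟨g, g.continuous, fun x => hg x⟩

lemma continuousOn_dite_smul {X F : Type*} [TopologicalSpace X] [NormedAddCommGroup F]
    [NormedSpace ℝ F] {S : Set X} {v : X → ℝ} [∀ x, Decidable (x ∈ S ∧ 0 < v x)]
    (hv : ContinuousOn v S) (hv0 : ∀ x, 0 ≤ v x)
    {g : {x // x ∈ S ∧ 0 < v x} → F} (hg : Continuous g) {M : ℝ} (hM : ∀ x, ‖g x‖ ≤ M) :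
    ContinuousOn (fun x => if h : x ∈ S ∧ 0 < v x then v x • g ⟨x, h⟩ else 0) S := by
  intro x hx
  rcases (hv0 x).eq_or_lt with h0 | h0
  · have hval : (if h : x ∈ S ∧ 0 < v x then v x • g ⟨x, h⟩ else 0) = 0 := by
      rw [dif_neg]; rintro ⟨-, h⟩; exact h.ne h0
    change Tendsto _ _ (𝓝 (if h : x ∈ S ∧ 0 < v x then v x • g ⟨x, h⟩ else 0))
    rw [hval]
    refine squeeze_zero_norm (a := fun y => v y * |M|) (fun y => ?_) ?_
    · split_ifs with h
      · rw [norm_smul, Real.norm_of_nonneg (hv0 y)]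
        exact mul_le_mul_of_nonneg_left ((hM _).trans (le_abs_self M)) (hv0 y)
      · rw [norm_zero]
        exact mul_nonneg (hv0 y) (abs_nonneg M)
    · have := (hv x hx).tendsto.mul_const |M|
      rwa [← h0, zero_mul] at this
  · have hU : {y | y ∈ S ∧ 0 < v y} ∈ 𝓝[S] x := by
      filter_upwards [self_mem_nhdsWithin, (hv x hx).eventually_const_lt h0] with y hy hy'
      exact ⟨hy, hy'⟩
    refine ContinuousWithinAt.mono_of_mem_nhdsWithin ?_ hU
    have hc : ContinuousOn (fun x => if h : x ∈ S ∧ 0 < v x then v x • g ⟨x, h⟩ else 0)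
        {y | y ∈ S ∧ 0 < v y} := by
      rw [continuousOn_iff_continuous_domRestrict]
      have : Set.domRestrict {y | y ∈ S ∧ 0 < v y}
          (fun x => if h : x ∈ S ∧ 0 < v x then v x • g ⟨x, h⟩ else 0) =
          fun y => v y.1 • g y := by
        ext1 y
        exact dif_pos y.2
      rw [this]
      refine Continuous.smul ?_ hg
      exact (hv.mono fun y hy => hy.1).domRestrict
    exact hc x ⟨hx, h0⟩

end Region

section Partition

variable {m n N : ℕ}

/-- The coordinatewise nearest point projection onto the unit cube. -/
def cubeClamp (x : Fin n → ℝ) : Fin n → ℝ := fun i => max 0 (min 1 (x i))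

lemma continuous_cubeClamp : Continuous (cubeClamp : (Fin n → ℝ) → Fin n → ℝ) := by
  unfold cubeClamp
  fun_prop

lemma cubeClamp_mem (x : Fin n → ℝ) : cubeClamp x ∈ Set.Icc (0 : Fin n → ℝ) 1 :=
  ⟨fun _ => le_max_left _ _, fun _ => max_le zero_le_one (min_le_left _ _)⟩

lemma norm_cubeClamp_sub_le {x y : Fin n → ℝ} (hy : y ∈ Set.Icc (0 : Fin n → ℝ) 1) {δ : ℝ}
    (h : ‖y - x‖ ≤ δ) : ‖cubeClamp x - x‖ ≤ δ := by
  refine (pi_norm_le_iff_of_nonneg ((norm_nonneg _).trans h)).2 fun i => ?_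
  have h1 := (norm_le_pi_norm (y - x) i).trans h
  have h2 := hy.1 i
  have h3 := hy.2 i
  simp only [Pi.sub_apply, Real.norm_eq_abs, abs_le, Pi.zero_apply, Pi.one_apply,
    cubeClamp] at *
  rcases le_total 1 (x i) with h4 | h4
  · rw [min_eq_left h4, max_eq_right zero_le_one]
    constructor <;> linarith
  · rw [min_eq_right h4]
    rcases le_total 0 (x i) with h5 | h5
    · rw [max_eq_right h5]
      constructor <;> linarith
    · rw [max_eq_left h5]
      constructor <;> linarith

lemma norm_treePath {d : ℕ} {x : TreeNode N × Fin d → ℝ} (hx : ∀ v, ‖fun p => x (v, p)‖ = 1)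
    (l : Fin N → Bool) (i : Fin N) : ‖treePath x l i‖ = 1 := by
  rw [← hx (treeNode i l)]
  rcases Int.units_eq_one_or (branchSign (l i)) with h | h
  · congr 1
    ext p
    simp [treePath, h]
  · rw [← norm_neg]
    congr 1
    ext p
    simp [treePath, h, Units.neg_smul]

lemma affForm_treePath {n' : ℕ} (J : Fin (m + 1) → Fin n') (x : TreeNode N × Fin (m + 2) → ℝ)
    (l : Fin N → Bool) (i : Fin N) (y : Fin n' → ℝ) :
    affForm J (treePath x l i) y =
      branchSign (l i) • affForm J (fun p => x (treeNode i l, p)) y :=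
  affForm_units_smul J _ _ y

variable (J : Fin N → Fin (m + 1) ↪ Fin n)

lemma continuousOn_volume_region :
    ContinuousOn (fun w => volume.real (region J w)) {w | ∀ i, ‖w i‖ = 1} := by
  intro w hw
  refine ContinuousAt.continuousWithinAt ?_
  have h := tendsto_volume_symmDiff_region J (w := w) fun i => by
    rw [← norm_ne_zero_iff, hw i]
    exact one_ne_zero
  have h' := (ENNReal.tendsto_toReal ENNReal.zero_ne_top).comp h
  refine tendsto_iff_norm_sub_tendsto_zero.2 (squeeze_zero (fun _ => norm_nonneg _)
    (fun w' => ?_) h')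
  have h1 := measureReal_le_add_symmDiff (T := Set.univ) (region_subset J w) (region_subset J w')
  have h2 := measureReal_le_add_symmDiff (T := Set.univ) (region_subset J w') (region_subset J w)
  rw [symmDiff_comm] at h2
  simp only [Set.inter_univ] at h1 h2
  rw [Real.norm_eq_abs, abs_le]
  change -volume.real _ ≤ _ ∧ _ ≤ volume.real _
  constructor <;> linarith

lemma exists_leaf_regions {f : (Fin n → ℝ) → Fin m → ℝ} (hf : ContinuousOn f (Set.Icc 0 1))
    {δ θ : ℝ} (hδ : 0 < δ) (hθ : 0 ≤ θ) (hθ1 : θ < 1) :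
    ∃ (x : TreeNode N × Fin (m + 2) → ℝ) (c : (Fin N → Bool) → Fin n → ℝ) (v : ℝ≥0∞)
      (t : Fin m → ℝ), (∀ u, ‖fun p => x (u, p)‖ = 1) ∧ 1 ≤ 2 ^ N * v ∧
      (∀ l, volume (region J (treePath x l)) = v) ∧ (∀ l, f (cubeClamp (c l)) = t) ∧
      ∀ l z, θ * volume.real (region J (treePath x l) ∩ Metric.closedBall z δ) ≤
        volume.real (region J (treePath x l) ∩ Metric.closedBall (c l) δ) := by
  classical
  have hfin : ∀ w, volume (region J w) ≠ ⊤ := fun w =>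
    ne_top_of_le_ne_top (by simp [volume_unitCube]) (measure_mono (region_subset J w))
  obtain ⟨c, hc, hcmax⟩ := exists_continuous_center
    (X := {w : Fin N → Fin (m + 2) → ℝ // w ∈ {w | ∀ i, ‖w i‖ = 1} ∧ 0 < volume.real (region J w)})
    (B := fun w => region J w.1) (fun w => measurableSet_region J w.1)
    (fun w => convex_region J w.1) (fun w => region_subset J w.1)
    (fun w h => w.2.2.ne' (by rw [measureReal_def, h, ENNReal.toReal_zero]))
    (fun w => (tendsto_volume_symmDiff_region J fun i => by
      rw [← norm_ne_zero_iff, w.2.1 i]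
      exact one_ne_zero).comp continuous_subtype_val.continuousAt) hδ hθ hθ1
  obtain ⟨M, hM⟩ := isCompact_Icc.exists_bound_of_continuousOn hf
  have hΨ := continuousOn_dite_smul (continuousOn_volume_region J)
    (fun w => measureReal_nonneg) (g := fun w => (Fin.cons 1 (f (cubeClamp (c w))) :
      Fin (m + 1) → ℝ)) (M := max 1 M)
    (by
      have : Continuous fun w => f (cubeClamp (c w)) :=
        hf.comp_continuous (continuous_cubeClamp.comp hc) fun w => cubeClamp_mem _
      refine continuous_pi fun j => ?_
      refine Fin.cases ?_ (fun j => ?_) j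
      · simpa using continuous_const
      · exact (continuous_apply j).comp this)
    (fun w => by
      refine (pi_norm_le_iff_of_nonneg (le_max_of_le_left zero_le_one)).2 fun j => ?_
      refine Fin.cases ?_ (fun j => ?_) j
      · simp
      · simp only [Fin.cons_succ]
        exact (norm_le_pi_norm _ j).trans ((hM _ (cubeClamp_mem _)).trans (le_max_right _ _)))
  obtain ⟨x, hx, hxΨ⟩ := exists_treePath_eq _ hΨ
  have hS : ∀ l, treePath x l ∈ {w : Fin N → Fin (m + 2) → ℝ | ∀ i, ‖w i‖ = 1} := fun l i =>
    norm_treePath hx l i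
  have hv : ∀ l l', volume.real (region J (treePath x l)) =
      volume.real (region J (treePath x l')) := by
    have h0 : ∀ l, (if h : treePath x l ∈ {w : Fin N → Fin (m + 2) → ℝ | ∀ i, ‖w i‖ = 1} ∧
        0 < volume.real (region J (treePath x l)) then volume.real (region J (treePath x l)) •
          (Fin.cons 1 (f (cubeClamp (c ⟨treePath x l, h⟩))) : Fin (m + 1) → ℝ) else 0) 0 =
        volume.real (region J (treePath x l)) := by
      intro l
      split_ifs with h
      · simp
      · have : ¬ 0 < volume.real (region J (treePath x l)) := fun h' => h ⟨hS l, h'⟩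
        exact le_antisymm measureReal_nonneg (not_lt.1 this)
    intro l l'
    rw [← h0 l, ← h0 l']
    exact congrFun (hxΨ l l') 0
  have hv' : ∀ l l', volume (region J (treePath x l)) = volume (region J (treePath x l')) :=
    fun l l' => (measureReal_eq_measureReal_iff (hfin _) (hfin _)).1 (hv l l')
  have hcover : 1 ≤ 2 ^ N * volume (region J (treePath x fun _ => true)) := by
    rw [← volume_unitCube (n := n)]
    calc volume (Set.Icc (0 : Fin n → ℝ) 1) ≤ volume (⋃ l, region J (treePath x l)) := by
          refine measure_mono fun y hy => ?_
          obtain ⟨l, hl⟩ := exists_leaf_nonneg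
            (fun u : TreeNode N => affForm (J u.1) (fun p => x (u, p)) y)
          refine Set.mem_iUnion.2 ⟨l, hy, fun i => ?_⟩
          rw [affForm_treePath]
          exact hl i
      _ ≤ ∑ l, volume (region J (treePath x l)) := measure_iUnion_fintype_le _ _
      _ = ∑ l : Fin N → Bool, volume (region J (treePath x fun _ => true)) :=
          sum_congr rfl fun l _ => hv' l _
      _ = _ := by simp
  have hpos : ∀ l, 0 < volume.real (region J (treePath x l)) := by
    intro l
    rw [hv l fun _ => true]
    refine ENNReal.toReal_pos (fun h => ?_) (hfin _)
    rw [h, mul_zero] at hcover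
    simp at hcover
  refine ⟨x, fun l => c ⟨treePath x l, hS l, hpos l⟩, _,
    f (cubeClamp (c ⟨treePath x fun _ => true, hS _, hpos _⟩)), hx, hcover,
    fun l => hv' l _, fun l => ?_, fun l z => hcmax ⟨treePath x l, hS l, hpos l⟩ z⟩
  have h := hxΨ l fun _ => true
  rw [dif_pos ⟨hS l, hpos l⟩, dif_pos ⟨hS _, hpos _⟩] at h
  have key : ∀ {a b : ℝ} {X Y : Fin (m + 1) → ℝ}, a = b → 0 < b → a • X = b • Y → X = Y := by
    rintro a _ X Y rfl hb h
    exact smul_right_injective _ hb.ne' h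
  exact (Fin.cons_inj.1 (key (hv l _) (hpos _) h)).2

lemma sum_volume_inter_region_le {x : TreeNode N × Fin (m + 2) → ℝ}
    (hx : ∀ u, ‖fun p => x (u, p)‖ = 1) {T : Set (Fin n → ℝ)} (hT : MeasurableSet T) :
    ∑ l, volume (region J (treePath x l) ∩ T) ≤ volume (Set.Icc 0 1 ∩ T) := by
  have h := sum_measure_leaf_le volume
    (a := fun u : TreeNode N => affForm (J u.1) (fun p => x (u, p)))
    (fun u => ((continuous_affForm (J u.1)).comp
      (Continuous.prodMk_right (fun p => x (u, p)))).measurable)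
    (fun u => by
      rw [ae_iff]
      have hne : (fun p => x (u, p)) ≠ 0 := by
        rw [← norm_ne_zero_iff, hx u]
        exact one_ne_zero
      simpa using volume_affForm_eq_zero (J u.1).injective hne)
    univ (measurableSet_Icc (a := (0 : Fin n → ℝ)) (b := 1) |>.inter hT)
  simp only [card_univ, Fintype.card_fin, Nat.sub_self, pow_zero, one_mul] at h
  refine le_trans (le_of_eq (sum_congr rfl fun l _ => ?_)) h
  congr 1
  ext y
  simp only [region, Set.mem_inter_iff, Set.mem_ofPred_eq, mem_univ, true_implies,
    affForm_treePath]
  tauto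

/-- The shadow of a leaf region under the coordinate projection along `J'`, as controlled by the
levels of the tree which use this projection. -/
def shadow (J' : Fin (m + 1) ↪ Fin n) (x : TreeNode N × Fin (m + 2) → ℝ) (l : Fin N → Bool) :
    Set (Fin (m + 1) → ℝ) :=
  {y ∈ Set.Icc 0 1 | ∀ i ∈ univ.filter fun i => J i = J',
    0 ≤ branchSign (l i) • affForm id (fun p => x (treeNode i l, p)) y}

lemma comp_mem_shadow (J' : Fin (m + 1) ↪ Fin n) {x : TreeNode N × Fin (m + 2) → ℝ}
    {l : Fin N → Bool} {y : Fin n → ℝ} (hy : y ∈ region J (treePath x l)) :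
    y ∘ J' ∈ shadow J J' x l := by
  refine ⟨⟨fun j => hy.1.1 (J' j), fun j => hy.1.2 (J' j)⟩, fun i hi => ?_⟩
  rw [mem_filter] at hi
  have h := hy.2 i
  rw [affForm_treePath, hi.2] at h
  exact h

lemma sum_volume_shadow_le (J' : Fin (m + 1) ↪ Fin n) {x : TreeNode N × Fin (m + 2) → ℝ}
    (hx : ∀ u, ‖fun p => x (u, p)‖ = 1) :
    ∑ l, volume (shadow J J' x l) ≤ 2 ^ (N - (univ.filter fun i => J i = J').card) := by
  have h := sum_measure_leaf_le volume
    (a := fun u : TreeNode N => affForm (id : Fin (m + 1) → _) (fun p => x (u, p)))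
    (fun u => ((continuous_affForm id).comp
      (Continuous.prodMk_right (fun p => x (u, p)))).measurable)
    (fun u => by
      rw [ae_iff]
      have hne : (fun p => x (u, p)) ≠ 0 := by
        rw [← norm_ne_zero_iff, hx u]
        exact one_ne_zero
      simpa using volume_affForm_eq_zero Function.injective_id hne)
    (univ.filter fun i => J i = J') (measurableSet_Icc (a := (0 : Fin (m + 1) → ℝ)) (b := 1))
  rwa [volume_unitCube, mul_one] at h

lemma card_filter_lt_le {ι : Type*} [Fintype ι] (u : ι → ℝ≥0∞) {ε : ℝ} (hε : 0 < ε) {B : ℝ}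
    (hB : 0 ≤ B) (h : ∑ l, u l ≤ ENNReal.ofReal B) :
    ((univ.filter fun l => ENNReal.ofReal ε < u l).card : ℝ) ≤ B / ε := by
  rw [le_div_iff₀ hε]
  refine (ENNReal.ofReal_le_ofReal_iff hB).1 (le_trans ?_ h)
  rw [ENNReal.ofReal_mul (by positivity), ENNReal.ofReal_natCast, ← nsmul_eq_mul,
    ← sum_const]
  exact (sum_le_sum fun l hl => (mem_filter.1 hl).2.le).trans
    (sum_le_sum_of_subset (filter_subset _ _))

/-- For a suitable sequence of projections, most leaves have small shadows. -/
lemma exists_levels_shadow_small (hmn : m + 1 ≤ n) {ε τ : ℝ} (hε : 0 < ε) (hτ : 0 < τ) :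
    ∃ (N : ℕ) (J : Fin N → Fin (m + 1) ↪ Fin n), ∀ x : TreeNode N × Fin (m + 2) → ℝ,
      (∀ u, ‖fun p => x (u, p)‖ = 1) → ∃ G : Finset (Fin N → Bool), (1 - τ) * 2 ^ N ≤ G.card ∧
        ∀ l ∈ G, ∀ J', volume (shadow J J' x l) ≤ ENNReal.ofReal ε := by
  classical
  set C := Fintype.card (Fin (m + 1) ↪ Fin n) with hC
  have hC0 : 0 < C := by
    have : Nonempty (Fin (m + 1) ↪ Fin n) := ⟨Fin.castLEEmb hmn⟩
    exact Fintype.card_pos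
  obtain ⟨K, hK⟩ := pow_unbounded_of_one_lt ((C : ℝ) / (ε * τ)) one_lt_two
  obtain ⟨N, hNK, ⟨e⟩⟩ : ∃ N, N = K * C ∧ Nonempty (Fin K × (Fin (m + 1) ↪ Fin n) ≃ Fin N) :=
    ⟨_, by simp [hC], ⟨Fintype.equivFin _⟩⟩
  refine ⟨N, fun i => (e.symm i).2, fun x hx => ?_⟩
  set J : Fin N → Fin (m + 1) ↪ Fin n := fun i => (e.symm i).2 with hJ
  have hcard : ∀ J', (univ.filter fun i => J i = J').card = K := by
    intro J'
    have hinj : Function.Injective fun k => e (k, J') :=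
      e.injective.comp (Prod.mk_left_injective J')
    have : (univ.filter fun i => J i = J') = (univ : Finset (Fin K)).map ⟨_, hinj⟩ := by
      ext i
      simp only [mem_filter, mem_univ, true_and, Finset.mem_map, Function.Embedding.coeFn_mk, hJ]
      constructor
      · rintro rfl
        exact ⟨(e.symm i).1, by simp⟩
      · rintro ⟨k, rfl⟩
        simp
    rw [this, card_map, card_univ, Fintype.card_fin]
  have hKN : K ≤ N := by
    rw [hNK]
    exact Nat.le_mul_of_pos_right K hC0
  let Bd := univ.filter fun l => ∃ J', ENNReal.ofReal ε < volume (shadow J J' x l)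
  have hbad : (Bd.card : ℝ) ≤ τ * 2 ^ N := by
    have h1 : Bd.card ≤
        ∑ J', (univ.filter fun l => ENNReal.ofReal ε < volume (shadow J J' x l)).card := by
      refine le_trans (card_le_card fun l hl => ?_) card_biUnion_le
      obtain ⟨J', hJ'⟩ := (mem_filter.1 hl).2
      exact mem_biUnion.2 ⟨J', mem_univ _, mem_filter.2 ⟨mem_univ _, hJ'⟩⟩
    have h2 : ∀ J', ((univ.filter fun l => ENNReal.ofReal ε < volume (shadow J J' x l)).card : ℝ)
        ≤ 2 ^ (N - K) / ε := fun J' => by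
      refine card_filter_lt_le _ hε (by positivity) ?_
      have := sum_volume_shadow_le J J' hx
      rw [hcard] at this
      refine this.trans (le_of_eq ?_)
      rw [ENNReal.ofReal_pow zero_le_two, ENNReal.ofReal_ofNat]
    calc (Bd.card : ℝ) ≤ ∑ J' : Fin (m + 1) ↪ Fin n, (2 : ℝ) ^ (N - K) / ε := by
          refine le_trans (by exact_mod_cast h1) (sum_le_sum fun J' _ => h2 J')
      _ = C * (2 ^ (N - K) / ε) := by simp [hC]
      _ ≤ τ * 2 ^ N := by
          have h3 : (2 : ℝ) ^ N = 2 ^ (N - K) * 2 ^ K := by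
            rw [← pow_add, Nat.sub_add_cancel hKN]
          rw [div_lt_iff₀ (by positivity)] at hK
          rw [h3, mul_div_assoc', div_le_iff₀ hε]
          have : (0 : ℝ) < 2 ^ (N - K) := by positivity
          nlinarith
  refine ⟨Bdᶜ, ?_, fun l hl J' => ?_⟩
  · rw [card_compl, Nat.cast_sub (card_le_univ _)]
    simp only [Fintype.card_pi, Fintype.card_bool, prod_const, card_univ, Fintype.card_fin,
      Nat.cast_pow, Nat.cast_ofNat]
    linarith
  · by_contra! hcon
    exact (mem_compl.1 hl) (mem_filter.2 ⟨mem_univ _, J', hcon⟩)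

end Partition

section Waist

variable {m n : ℕ}

lemma le_volume_inter_closedBall_cubeClamp {P : Set (Fin n → ℝ)} (hPm : MeasurableSet P)
    (hPc : Convex ℝ P) (hPI : P ⊆ Set.Icc 0 1) (hP0 : volume P ≠ 0) {δ r θ : ℝ} (hδ : 0 < δ)
    (hδr : 200 * δ ≤ r) (hr : r < 1 / 2) (hθ : 0 < θ) (hθ1 : θ ≤ 1) {c : Fin n → ℝ}
    (hc : ∀ z, θ * volume.real (P ∩ Metric.closedBall z δ) ≤
      volume.real (P ∩ Metric.closedBall c δ))
    (hP : ∀ J : Fin (m + 1) ↪ Fin n, ∃ Q : Set (Fin (m + 1) → ℝ), (∀ x ∈ P, x ∘ J ∈ Q) ∧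
      volume Q ≤ ENNReal.ofReal ((δ / 100 / (2 * (m + 1))) ^ (m + 1))) :
    ENNReal.ofReal θ * ENNReal.ofReal ((39 / 40 * r) ^ m) * volume P ≤
      volume (P ∩ Metric.closedBall (cubeClamp c) r) := by
  have hfin : ∀ T, volume (P ∩ T) ≠ ⊤ := fun T =>
    ne_top_of_le_ne_top (by simp [volume_unitCube])
      (measure_mono (Set.inter_subset_left.trans hPI))
  obtain ⟨z, hz⟩ := exists_volume_inter_closedBall_pos hP0 hδ
  have hc0 : volume (P ∩ Metric.closedBall c δ) ≠ 0 := by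
    have h := (mul_pos hθ (ENNReal.toReal_pos hz (hfin _))).trans_le (hc z)
    exact fun h' => h.ne' (by rw [measureReal_def, h', ENNReal.toReal_zero])
  obtain ⟨y, hyP, hyc⟩ := nonempty_of_measure_ne_zero hc0
  rw [mem_closedBall_iff_norm] at hyc
  have hclamp := norm_cubeClamp_sub_le (hPI hyP) hyc
  have hη : 0 < δ / 100 := by positivity
  obtain ⟨k, hk, x₀, A, hA, hPA⟩ := exists_flat_of_volume_image_le hPc ⟨y, hyP⟩
    (by positivity) hη (by
      push_cast
      rw [← mul_pow]
      refine pow_lt_pow_left₀ ?_ (by positivity) (by omega)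
      have : ((m : ℝ) + 1) * (δ / 100 / (2 * (m + 1))) = δ / 100 / 2 := by
        field_simp
      rw [this]
      linarith) hP
  set ρ := (r - 2 * δ) / (1 + 2 * δ) with hρ
  have h12 : 0 < 1 + 2 * δ := by positivity
  have hρR : ρ * (1 + 2 * δ) = r - 2 * δ := div_mul_cancel₀ _ h12.ne'
  have hρ0 : 0 < ρ := div_pos (by linarith) h12
  have hρ1 : ρ < 1 := (div_lt_one h12).2 (by linarith)
  have key := le_volume_inter_closedBall_of_flat hPm hPc hPI hη (by linarith) hθ1 hρ0 hρ1
    (fun x => by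
      rw [← ENNReal.toReal_le_toReal (ENNReal.mul_ne_top ENNReal.ofReal_ne_top (hfin _)) (hfin _),
        ENNReal.toReal_mul, ENNReal.toReal_ofReal hθ.le]
      exact hc x) hc0 hA hPA
  have hratio : (δ - δ / 100) / δ = 99 / 100 := by
    field_simp
    norm_num
  have hρr : 39 / 40 * r ≤ ρ * (99 / 100) := by
    have : 65 / 66 * r ≤ ρ := by
      rw [hρ, le_div_iff₀ h12]
      nlinarith
    linarith
  rw [hratio, hρR] at key
  refine le_trans ?_ (key.trans (measure_mono (Set.inter_subset_inter_right _ fun x hx => ?_)))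
  · gcongr ENNReal.ofReal θ * ENNReal.ofReal ?_ * _
    have hr0 : 0 ≤ 39 / 40 * r := by linarith
    exact (pow_le_pow_of_le_one hr0 (by linarith) hk).trans (pow_le_pow_left₀ hr0 hρr k)
  · rw [mem_closedBall_iff_norm] at hx ⊢
    have := norm_sub_le (x - c) (cubeClamp c - c)
    rw [sub_sub_sub_cancel_right] at this
    linarith

lemma exists_waist_at_scale (hm : 1 ≤ m) (hmn : m + 1 ≤ n) {f : (Fin n → ℝ) → Fin m → ℝ}
    (hf : ContinuousOn f (Set.Icc 0 1)) {r₀ : ℝ} (hr₀ : 0 < r₀) :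
    ∃ t ∈ f '' Set.Icc 0 1, ∀ r, r₀ ≤ r → r < 1 / 2 → ENNReal.ofReal ((2 / 3 * r) ^ m) ≤
      volume (Set.Icc 0 1 ∩ {x | ∃ y, (y ∈ Set.Icc (0 : Fin n → ℝ) 1 ∧ f y = t) ∧
        ‖x - y‖ ≤ r}) := by
  set δ := r₀ / 200 with hδ
  have hδ0 : 0 < δ := by positivity
  set θ : ℝ := (9 / 10) ^ m with hθ
  have hθ0 : 0 < θ := by positivity
  have hθ1 : θ < 1 := pow_lt_one₀ (by norm_num) (by norm_num) (by omega)
  obtain ⟨N, J, hJ⟩ := exists_levels_shadow_small (m := m) hmn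
    (ε := (δ / 100 / (2 * (m + 1))) ^ (m + 1)) (τ := 1 - θ) (by positivity) (by linarith)
  obtain ⟨x, c, v, t, hx, hv1, hv, ht, hc⟩ := exists_leaf_regions J hf hδ0 hθ0.le hθ1
  obtain ⟨G, hGcard, hG⟩ := hJ x hx
  rw [sub_sub_cancel] at hGcard
  have hv0 : v ≠ 0 := by
    rintro rfl
    simp at hv1
  refine ⟨t, ⟨_, cubeClamp_mem _, ht fun _ => true⟩, fun r hr hr1 => ?_⟩
  have hr0 : 0 ≤ r := by linarith
  set T := ⋃ l, Metric.closedBall (cubeClamp (c l)) r with hT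
  have hTm : MeasurableSet T := MeasurableSet.iUnion fun l => measurableSet_closedBall
  have hGv : ENNReal.ofReal θ ≤ G.card * v := by
    calc ENNReal.ofReal θ ≤ ENNReal.ofReal θ * (2 ^ N * v) := le_mul_of_one_le_right' hv1
      _ = ENNReal.ofReal (θ * 2 ^ N) * v := by
          rw [ENNReal.ofReal_mul hθ0.le, ENNReal.ofReal_pow zero_le_two, ENNReal.ofReal_ofNat,
            mul_assoc]
      _ ≤ G.card * v := by
          gcongr
          rw [← ENNReal.ofReal_natCast]
          exact ENNReal.ofReal_le_ofReal hGcard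
  calc ENNReal.ofReal ((2 / 3 * r) ^ m)
      ≤ ENNReal.ofReal (θ * (39 / 40 * r) ^ m * θ) := by
        refine ENNReal.ofReal_le_ofReal ?_
        rw [hθ, ← mul_pow, ← mul_pow]
        exact pow_le_pow_left₀ (by positivity) (by linarith) m
    _ = ENNReal.ofReal θ * ENNReal.ofReal ((39 / 40 * r) ^ m) * ENNReal.ofReal θ := by
        rw [ENNReal.ofReal_mul (by positivity), ENNReal.ofReal_mul hθ0.le]
    _ ≤ ENNReal.ofReal θ * ENNReal.ofReal ((39 / 40 * r) ^ m) * (G.card * v) := by gcongr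
    _ = ∑ l ∈ G, ENNReal.ofReal θ * ENNReal.ofReal ((39 / 40 * r) ^ m) * v := by
        rw [sum_const, nsmul_eq_mul]
        ring
    _ ≤ ∑ l ∈ G, volume (region J (treePath x l) ∩ T) := by
        refine sum_le_sum fun l hl => ?_
        refine le_trans ?_ (measure_mono (Set.inter_subset_inter_right _
          (Set.subset_iUnion (fun l => Metric.closedBall (cubeClamp (c l)) r) l)))
        rw [← hv l]
        refine le_volume_inter_closedBall_cubeClamp (measurableSet_region _ _)
          (convex_region _ _) (region_subset _ _) (by rwa [hv l]) hδ0 (by linarith) hr1 hθ0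
          hθ1.le (hc l) fun J' => ⟨shadow J J' x l, fun y hy => comp_mem_shadow J J' hy, hG l hl J'⟩
    _ ≤ ∑ l, volume (region J (treePath x l) ∩ T) := sum_le_sum_of_subset (subset_univ _)
    _ ≤ volume (Set.Icc 0 1 ∩ T) := sum_volume_inter_region_le J hx hTm
    _ ≤ _ := by
        refine measure_mono (Set.inter_subset_inter_right _ fun y hy => ?_)
        obtain ⟨l, hl⟩ := Set.mem_iUnion.1 hy
        exact ⟨cubeClamp (c l), ⟨cubeClamp_mem _, ht l⟩, mem_closedBall_iff_norm.1 hl⟩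

end Waist

section Limit

/-- Upper semicontinuity of the fibers of a continuous map on a compact set. -/
lemma eventually_fiber_subset_thickening {X Y : Type*} [PseudoMetricSpace X] [TopologicalSpace Y]
    [T2Space Y] {K : Set X} (hK : IsCompact K) {f : X → Y} (hf : ContinuousOn f K) (a : Y) {ε : ℝ}
    (hε : 0 < ε) : ∀ᶠ s in 𝓝 a, ∀ y ∈ K, f y = s → ∃ z ∈ K, f z = a ∧ dist y z < ε := by
  set U := ⋃ z ∈ {z | z ∈ K ∧ f z = a}, Metric.ball z ε with hU
  have hUo : IsOpen U := isOpen_biUnion fun _ _ => Metric.isOpen_ball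
  have hC : IsCompact (f '' (K ∩ Uᶜ)) :=
    (hK.inter_right hUo.isClosed_compl).image_of_continuousOn (hf.mono Set.inter_subset_left)
  have ha : a ∈ (f '' (K ∩ Uᶜ))ᶜ := by
    rintro ⟨y, ⟨hyK, hyU⟩, hy⟩
    exact hyU (Set.mem_biUnion (show y ∈ {z | z ∈ K ∧ f z = a} from ⟨hyK, hy⟩)
      (Metric.mem_ball_self hε))
  filter_upwards [hC.isClosed.isOpen_compl.mem_nhds ha] with s hs y hy hys
  by_contra! hcon
  refine hs ⟨y, ⟨hy, fun hyU => ?_⟩, hys⟩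
  obtain ⟨z, ⟨hzK, hz⟩, hyz⟩ := Set.mem_iUnion₂.1 hyU
  exact (hcon z hzK hz).not_gt hyz

lemma exists_waist_of_lt {n m : ℕ} (hm : 1 ≤ m) (hmn : m < n) {f : (Fin n → ℝ) → Fin m → ℝ}
    (hf : ContinuousOn f (Set.Icc 0 1)) :
    ∃ t, ∀ r, 0 < r → r < 1 / 2 → ENNReal.ofReal ((r / 2) ^ m) ≤
      volume (Set.Icc 0 1 ∩ {x | ∃ y, (y ∈ Set.Icc (0 : Fin n → ℝ) 1 ∧ f y = t) ∧
        ‖x - y‖ ≤ r}) := by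
  choose t ht hvol using fun k : ℕ =>
    exists_waist_at_scale hm hmn hf (r₀ := 1 / ((k : ℝ) + 1)) Nat.one_div_pos_of_nat
  obtain ⟨a, -, φ, hφ, hlim⟩ := (isCompact_Icc.image_of_continuousOn hf).tendsto_subseq ht
  refine ⟨a, fun r hr hr1 => ?_⟩
  have h1 := hlim.eventually (eventually_fiber_subset_thickening isCompact_Icc hf a
    (show 0 < r / 4 by positivity))
  have h2 := (tendsto_one_div_add_atTop_nhds_zero_nat (𝕜 := ℝ)).comp hφ.tendsto_atTop
    |>.eventually (ge_mem_nhds (show 0 < 3 / 4 * r by positivity))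
  obtain ⟨k, hk1, hk2⟩ := (h1.and h2).exists
  have h := hvol (φ k) (3 / 4 * r) hk2 (by linarith)
  have he : 2 / 3 * (3 / 4 * r) = r / 2 := by ring
  rw [he] at h
  refine h.trans (measure_mono (Set.inter_subset_inter_right _ ?_))
  rintro x ⟨y, ⟨hy, hyt⟩, hxy⟩
  obtain ⟨z, hz, hza, hyz⟩ := hk1 y hy hyt
  refine ⟨z, ⟨hz, hza⟩, ?_⟩
  rw [dist_eq_norm] at hyz
  have := norm_sub_le_norm_sub_add_norm_sub x y z
  linarith

lemma ofReal_pow_le_volume_inter_closedBall_zero {n : ℕ} {r : ℝ} (hr : 0 ≤ r) (hr1 : r ≤ 1) :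
    ENNReal.ofReal (r ^ n) ≤
      volume (Set.Icc (0 : Fin n → ℝ) 1 ∩ {x | ‖x‖ ≤ r}) := by
  have hvol : volume (Set.Icc (0 : Fin n → ℝ) fun _ => r) = ENNReal.ofReal (r ^ n) := by
    rw [Real.volume_Icc_pi]
    simp [ENNReal.ofReal_pow hr]
  rw [← hvol]
  refine measure_mono fun x hx => ⟨⟨hx.1, fun i => (hx.2 i).trans hr1⟩, ?_⟩
  refine (pi_norm_le_iff_of_nonneg hr).2 fun i => ?_
  rw [Real.norm_of_nonneg (hx.1 i)]
  exact hx.2 i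

end Limit

end CubeWaist

/-- waist inequality for the cube, measure form: for `1 ≤ m ≤ n` and any
continuous `f : [0,1]^n → ℝ^m` there is `t ∈ ℝ^m` with
`μ(f⁻¹(t) +_∞ r) ≥ (r/2)^m` for all `0 < r < 1/2`, `μ` being Lebesgue measure restricted
to the cube and `+_∞ r` the closed `r`-neighborhood in the `ℓ^∞`-norm. -/
theorem stmt_8 (n m : ℕ) (hm : 1 ≤ m) (hmn : m ≤ n)
    (f : (Fin n → ℝ) → (Fin m → ℝ)) (hf : ContinuousOn f (Set.Icc 0 1)) :
    ∃ t : Fin m → ℝ, ∀ r : ℝ, 0 < r → r < 1 / 2 →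
      ENNReal.ofReal ((r / 2) ^ m) ≤
        MeasureTheory.volume.restrict (Set.Icc (0 : Fin n → ℝ) 1)
          {x : Fin n → ℝ | ∃ y, (y ∈ Set.Icc (0 : Fin n → ℝ) 1 ∧ f y = t) ∧ ‖x - y‖ ≤ r} := by
  rcases hmn.lt_or_eq with h | rfl
  · obtain ⟨t, ht⟩ := exists_waist_of_lt hm h hf
    refine ⟨t, fun r hr hr1 => (ht r hr hr1).trans ?_⟩
    rw [Set.inter_comm]
    exact MeasureTheory.Measure.le_restrict_apply _ _
  · refine ⟨f 0, fun r hr hr1 => ?_⟩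
    refine le_trans ?_ (MeasureTheory.Measure.le_restrict_apply _ _)
    rw [Set.inter_comm]
    refine (ENNReal.ofReal_le_ofReal (pow_le_pow_left₀ (by positivity) (by linarith) m)).trans
      ((ofReal_pow_le_volume_inter_closedBall_zero hr.le (by linarith)).trans
        (MeasureTheory.measure_mono (Set.inter_subset_inter_right _ fun x hx => ?_)))
    exact ⟨0, ⟨⟨le_rfl, zero_le_one⟩, rfl⟩, by simpa using hx⟩
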